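/- arXiv:1607.01430 — 2 statements merged into one kernel-verified Lean document; each statement's English description precedes it below -/
import Mathlib

section
/- Uniform tail approximation for homogeneous functionals of threshold-dependent Gaussian fields (Theorem 2.1). Let E ⊆ ℝ^d be a compact set containing the origin, and let ι be an index type equipped with a filter l (encoding the joint limit u → ∞ uniformly over parameters τ_u ∈ K_u). For each i ∈ ι let g_i > 0, let h_i ∈ C(E,ℝ) with 1 + h_i(t) > 0 for all t, and let μ_i be a centered Gaussian measure on the separable Banach space C(E,ℝ) with unit variance at every point, i.e. ∫ (f(t))² dμ_i(f) = 1 for all t ∈ E; write ξ_i for the pushforward of μ_i under the continuous map f ↦ (t ↦ f(t)/(1+h_i(t))). Let Γ : C(E,ℝ) → ℝ be continuous with Γ(f) ≤ c·sup_{t∈E} f(t) for some c > 0 and Γ(a f + b) = a Γ(f) + b for all a > 0, b ∈ ℝ, f ∈ C(E,ℝ). Assume: (C0) g_i → ∞ along l; (C1) there is h ∈ C(E,ℝ) with h(0) = 0 such that sup_{t∈E} |g_i² h_i(t) − h(t)| → 0 along l; (C2) there is a centered Gaussian measure ν on C(E,ℝ) whose evaluation at 0 vanishes ν-a.s. such that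 for all s,t ∈ E, g_i² ∫(f(t)−f(s))² dμ_i(f) → 2∫(f(t)−f(s))² dν(f) along l, and moreover sup_{t∈E} |g_i² ∫(f(t)−f(0))² dμ_i(f) − 2∫(f(t))² dν(f)| → 0 along l (this is the form of conditions C2–C3 equivalent by Remark 2.2 ii)); (C3) there is a > 0 with limsup along l of sup_{s≠t∈E} g_i² ∫(f(t)−f(s))² dμ_i(f) / Σ_{j=1}^d |s_j − t_j|^a finite; and eventually along l, ξ_i({f : Γ(f) > g_i}) > 0. Then, along l, ξ_i({f : Γ(f) > g_i}) / Ψ(g_i) converges to H := ∫ exp(Γ(t ↦ √2 f(t) − v(t) − h(t))) dν(f), where v(t) = ∫ (f(t))² dν(f). -/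
open MeasureTheory Filter Topology
open scoped NNReal

/-- The survival function `Ψ` of a standard normal random variable:
`Ψ(x) = (2π)^{-1/2} ∫_x^∞ e^{-w²/2} dw`. -/
noncomputable def stdGaussTail (x : ℝ) : ℝ :=
  (Real.sqrt (2 * Real.pi))⁻¹ * ∫ w in Set.Ioi x, Real.exp (-w ^ 2 / 2)

/-- A centered Gaussian (Borel) measure on a topological real vector space `X`:
a probability measure whose pushforward under every continuous linear functional is a
centered Gaussian distribution on `ℝ`. -/
def IsCenteredGaussian {X : Type*} [TopologicalSpace X] [AddCommGroup X] [Module ℝ X]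
    [MeasurableSpace X] (μ : Measure X) : Prop :=
  IsProbabilityMeasure μ ∧
    ∀ L : X →L[ℝ] ℝ, ∃ v : ℝ≥0, μ.map L = ProbabilityTheory.gaussianReal 0 v

/-- The continuous self-map of `C(E,ℝ)` given by `f ↦ (t ↦ f(t)/(1 + h(t)))`, for a
continuous function `h` with `1 + h > 0`. -/
noncomputable def divByOneAdd {E : Type*} [TopologicalSpace E] (h : C(E, ℝ))
    (hpos : ∀ t, 0 < 1 + h t) (f : C(E, ℝ)) : C(E, ℝ) :=
  ⟨fun t => f t / (1 + h t),
    f.continuous.div (continuous_const.add h.continuous) fun t => (hpos t).ne'⟩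

set_option linter.unusedSectionVars false
section Gaussian
open ProbabilityTheory

variable {X : Type*} [NormedAddCommGroup X] [NormedSpace ℝ X] [CompleteSpace X]
  [MeasurableSpace X] [BorelSpace X] [SecondCountableTopology X]

theorem cg_isGaussian {X : Type*} [TopologicalSpace X] [AddCommGroup X] [Module ℝ X]
    [MeasurableSpace X] [OpensMeasurableSpace X] {μ : Measure X} (h : IsCenteredGaussian μ) :
    IsGaussian μ :=
  isGaussian_of_map_eq_gaussianReal fun L => ⟨0, h.2 L⟩

theorem cg_mean {X : Type*} [TopologicalSpace X] [AddCommGroup X] [Module ℝ X]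
    [MeasurableSpace X] [OpensMeasurableSpace X] {μ : Measure X} (h : IsCenteredGaussian μ)
    (L : X →L[ℝ] ℝ) : ∫ f, L f ∂μ = 0 := by
  obtain ⟨v, hv⟩ := h.2 L
  have : ∫ x, x ∂(μ.map L) = ∫ f, L f ∂μ := by
    rw [integral_map]
    · exact L.continuous.measurable.aemeasurable
    · fun_prop
  rw [← this, hv, integral_id_gaussianReal]

theorem cg_map {X Y : Type*} [TopologicalSpace X] [AddCommGroup X] [Module ℝ X]
    [MeasurableSpace X] [OpensMeasurableSpace X]
    [TopologicalSpace Y] [AddCommGroup Y] [Module ℝ Y]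
    [MeasurableSpace Y] [BorelSpace Y] {μ : Measure X} (h : IsCenteredGaussian μ)
    (A : X →L[ℝ] Y) : IsCenteredGaussian (μ.map A) := by
  have hA : Measurable A := A.continuous.measurable
  have := h.1
  refine ⟨Measure.isProbabilityMeasure_map hA.aemeasurable, fun L => ?_⟩
  obtain ⟨v, hv⟩ := h.2 (L.comp A)
  refine ⟨v, ?_⟩
  rw [Measure.map_map L.continuous.measurable hA, ← hv]
  rfl

theorem cg_charFunDual {μ : Measure X} (h : IsCenteredGaussian μ) (L : StrongDual ℝ X) :
    charFunDual μ L = Complex.exp (-(∫ f, (L f) ^ 2 ∂μ : ℝ) / 2) := by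
  have := cg_isGaussian h
  rw [IsGaussian.charFunDual_eq_of_forall_strongDual_eq_zero (cg_mean h) L,
    variance_of_integral_eq_zero (by fun_prop) (cg_mean h L)]

theorem cg_sq_integrable {μ : Measure X} (h : IsCenteredGaussian μ) (L : StrongDual ℝ X) :
    Integrable (fun f => (L f) ^ 2) μ := by
  have := cg_isGaussian h
  exact (IsGaussian.memLp_dual μ L 2 (by simp)).integrable_sq

theorem cg_mul_integrable {μ : Measure X} (h : IsCenteredGaussian μ) (L M : StrongDual ℝ X) :
    Integrable (fun f => L f * M f) μ := by
  have := cg_isGaussian h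
  exact (IsGaussian.memLp_dual μ L 2 (by simp)).integrable_mul
    (IsGaussian.memLp_dual μ M 2 (by simp))

/-- the regression vector -/
noncomputable def regVec (μ : Measure X) (δ : StrongDual ℝ X) : X := ∫ f, δ f • f ∂μ

theorem regVec_apply {μ : Measure X} (h : IsCenteredGaussian μ) (δ L : StrongDual ℝ X) :
    L (regVec μ δ) = ∫ f, δ f * L f ∂μ := by
  have := cg_isGaussian h
  rw [regVec, ← L.integral_comp_comm]
  · simp
  · exact memLp_one_iff_integrable.1 (MemLp.smul (p := 2) (q := 2)
      (IsGaussian.memLp_two_id (μ := μ)) (IsGaussian.memLp_dual μ δ 2 (by simp)))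

/-- the residual projection -/
noncomputable def resProj (μ : Measure X) (δ : StrongDual ℝ X) : X →L[ℝ] X :=
  ContinuousLinearMap.id ℝ X - δ.smulRight (regVec μ δ)

theorem resProj_apply (μ : Measure X) (δ : StrongDual ℝ X) (f : X) :
    resProj μ δ f = f - δ f • regVec μ δ := by simp [resProj]

theorem resProj_var {μ : Measure X} (h : IsCenteredGaussian μ) (δ L : StrongDual ℝ X)
    (hδ : ∫ f, (δ f) ^ 2 ∂μ = 1) :
    ∫ f, (L (resProj μ δ f)) ^ 2 ∂μ = (∫ f, (L f) ^ 2 ∂μ) - (L (regVec μ δ)) ^ 2 := by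
  set c := L (regVec μ δ) with hc
  have h1 : ∀ f, (L (resProj μ δ f)) ^ 2 = (L f) ^ 2 - (2 * c) * (δ f * L f) + c ^ 2 * (δ f) ^ 2 := by
    intro f
    rw [resProj_apply, map_sub, map_smul, smul_eq_mul, ← hc]; ring
  simp_rw [h1]
  have i1 := cg_sq_integrable h L
  have i2 := (cg_mul_integrable h δ L).const_mul (2 * c)
  have i3 := (cg_sq_integrable h δ).const_mul (c ^ 2)
  have e1 := integral_add (i1.sub i2) i3
  simp only [Pi.sub_apply] at e1
  rw [e1, integral_sub i1 i2, integral_const_mul, integral_const_mul, hδ,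
    ← regVec_apply h, ← hc]
  ring

theorem gauss_decomp {μ : Measure X} (h : IsCenteredGaussian μ) (δ : StrongDual ℝ X)
    (hδ : ∫ f, (δ f) ^ 2 ∂μ = 1) :
    μ = ((gaussianReal 0 1).prod (μ.map (resProj μ δ))).map
      (fun p : ℝ × X => p.1 • regVec μ δ + p.2) := by
  have := h.1
  have hP := cg_map h (resProj μ δ)
  have := hP.1
  let A : ℝ × X →L[ℝ] X := ((ContinuousLinearMap.fst ℝ ℝ X).smulRight (regVec μ δ)) +
    ContinuousLinearMap.snd ℝ ℝ X
  have hA : (fun p : ℝ × X => p.1 • regVec μ δ + p.2) = A := by ext p; simp [A]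
  rw [hA]
  have : IsProbabilityMeasure (((gaussianReal 0 1).prod (μ.map (resProj μ δ))).map A) :=
    Measure.isProbabilityMeasure_map A.continuous.measurable.aemeasurable
  refine Measure.ext_of_charFunDual (funext fun L => ?_)
  rw [charFunDual_map, charFunDual_prod, cg_charFunDual h, cg_charFunDual hP]
  have h2 : ((L.comp A).comp (.inr ℝ ℝ X)) = L := by ext f; simp [A]
  rw [h2, integral_map (resProj μ δ).continuous.measurable.aemeasurable (by fun_prop),
    resProj_var h δ L hδ]
  rw [charFunDual_eq_charFun_map_one, gaussianReal_map_continuousLinearMap, charFun_gaussianReal,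
    ← Complex.exp_add]
  congr 1
  have hm : max (L (regVec μ δ) ^ 2) 0 = L (regVec μ δ) ^ 2 := max_eq_left (sq_nonneg _)
  simp [A, hm]
  ring

theorem fernique_unif (R : ℝ) (hR : 0 < R) : ∃ M : ENNReal, M < ⊤ ∧
    ∀ μ : Measure X, IsCenteredGaussian μ → 3 / 4 ≤ μ {f | ‖f‖ ≤ R} →
      ∫⁻ f, ENNReal.ofReal (Real.exp (4 * ‖f‖)) ∂μ ≤ M := by
  set c : ENNReal := 3 / 4 with hc
  have hcr : c.toReal = 3 / 4 := by simp [hc]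
  have hc1 : (2 : ENNReal)⁻¹ < c := by
    rw [← ENNReal.toReal_lt_toReal (by simp) (by rw [hc]; finiteness), hcr]; norm_num
  have hc2 : c < 1 := by
    rw [← ENNReal.toReal_lt_toReal (by rw [hc]; finiteness) (by simp), hcr]; norm_num
  have hl := Fernique.logRatio_pos hc1 hc2
  set lam := Fernique.logRatio c * R⁻¹ ^ 2 with hlam
  have hlam0 : 0 < lam := by positivity
  set S : ENNReal := .ofReal (Real.exp (Fernique.logRatio c))
        + ∑' n : ℕ, .ofReal (Real.exp (-2⁻¹ * Real.log (c / (1 - c)).toReal * 2 ^ n)) with hS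
  have hSfin : S < ⊤ := by
    refine ENNReal.add_lt_top.mpr ⟨ENNReal.ofReal_lt_top, ?_⟩
    refine Summable.tsum_ofReal_lt_top <|
      Real.summable_exp_nat_mul_of_ge ?_ (fun i ↦ mod_cast (Nat.lt_pow_self (by simp)).le)
    refine mul_neg_of_neg_of_pos (by simp) (Real.log_pos ?_)
    rw [ENNReal.toReal_div, ENNReal.toReal_sub_of_le hc2.le (by simp), hcr]
    norm_num
  refine ⟨.ofReal (Real.exp (4 / lam)) * S, ENNReal.mul_lt_top (by simp) hSfin, fun μ h hμ => ?_⟩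
  have := cg_isGaussian h
  have key := lintegral_exp_mul_sq_norm_le_of_map_rotation_eq_self (μ := μ) (a := R)
    (IsGaussian.map_rotation_eq_self_of_forall_strongDual_eq_zero (cg_mean h) _) hμ hc1
  calc _ ≤ ∫⁻ f, ENNReal.ofReal (Real.exp (4 / lam)) *
        ENNReal.ofReal (Real.exp (lam * ‖f‖ ^ 2)) ∂μ := by
        refine lintegral_mono fun f => ?_
        rw [← ENNReal.ofReal_mul (by positivity), ← Real.exp_add]
        gcongr
        have : 4 / lam + lam * ‖f‖ ^ 2 - 4 * ‖f‖ = (lam * ‖f‖ - 2) ^ 2 / lam := by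
          field_simp; ring
        have h3 : 0 ≤ (lam * ‖f‖ - 2) ^ 2 / lam := by positivity
        linarith
    _ = _ := by rw [lintegral_const_mul' _ _ (by simp)]
    _ ≤ _ := by gcongr
end Gaussian

section Weak
open ProbabilityTheory BoundedContinuousFunction Real

variable {T : Type*} [TopologicalSpace T] [CompactSpace T]
  [MeasurableSpace C(T, ℝ)] [BorelSpace C(T, ℝ)] [SecondCountableTopology C(T, ℝ)]

/-- evaluation functional -/
noncomputable def evd (t : T) : StrongDual ℝ C(T, ℝ) := ContinuousMap.evalCLM ℝ t

@[simp] theorem evd_apply (t : T) (f : C(T, ℝ)) : evd t f = f t := rfl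

/-- finite combination of evaluations -/
noncomputable def comb (w : T →₀ ℝ) : StrongDual ℝ C(T, ℝ) := ∑ t ∈ w.support, w t • evd t

theorem comb_apply (w : T →₀ ℝ) (f : C(T, ℝ)) : comb w f = ∑ t ∈ w.support, w t * f t := by
  simp [comb]

theorem sq_diff_integrable {m : Measure C(T, ℝ)} (hm : IsCenteredGaussian m) (s t : T) :
    Integrable (fun f : C(T, ℝ) => (f t - f s) ^ 2) m := by
  simpa using cg_sq_integrable hm (evd t - evd s)

theorem comb_var {m : Measure C(T, ℝ)} (hm : IsCenteredGaussian m) (o : T)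
    (h0 : ∀ᵐ f ∂m, f o = 0) (w : T →₀ ℝ) :
    ∫ f, (comb w f) ^ 2 ∂m = ∑ s ∈ w.support, ∑ t ∈ w.support, w s * w t / 2 *
      ((∫ f, (f s - f o) ^ 2 ∂m) + (∫ f, (f t - f o) ^ 2 ∂m) - (∫ f, (f t - f s) ^ 2 ∂m)) := by
  have : ∀ᵐ f ∂m, (comb w f) ^ 2 = ∑ s ∈ w.support, ∑ t ∈ w.support, w s * w t / 2 *
      ((f s - f o) ^ 2 + (f t - f o) ^ 2 - (f t - f s) ^ 2) := by
    filter_upwards [h0] with f hf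
    rw [comb_apply, sq, Finset.sum_mul_sum]
    refine Finset.sum_congr rfl fun s _ => Finset.sum_congr rfl fun t _ => ?_
    rw [hf]; ring
  rw [integral_congr_ae this]
  have hi : ∀ s t, Integrable (fun f : C(T, ℝ) => w s * w t / 2 *
      ((f s - f o) ^ 2 + (f t - f o) ^ 2 - (f t - f s) ^ 2)) m := fun s t =>
    (((sq_diff_integrable hm o s).add (sq_diff_integrable hm o t)).sub
      (sq_diff_integrable hm s t)).const_mul _
  rw [integral_finsetSum _ fun s _ => integrable_finsetSum _ fun t _ => hi s t]
  refine Finset.sum_congr rfl fun s _ => ?_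
  rw [integral_finsetSum _ fun t _ => hi s t]
  refine Finset.sum_congr rfl fun t _ => ?_
  have e1 := integral_sub ((sq_diff_integrable hm o s).add (sq_diff_integrable hm o t))
      (sq_diff_integrable hm s t)
  simp only [Pi.add_apply] at e1
  rw [integral_const_mul, e1, integral_add (sq_diff_integrable hm o s) (sq_diff_integrable hm o t)]

theorem weak_conv {ι : Type*} {l : Filter ι} (o : T) (ρ : ι → ProbabilityMeasure C(T, ℝ))
    (ρ' : ProbabilityMeasure C(T, ℝ))
    (hρ : ∀ i, IsCenteredGaussian (ρ i : Measure C(T, ℝ)))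
    (hρ' : IsCenteredGaussian (ρ' : Measure C(T, ℝ)))
    (h0 : ∀ i, ∀ᵐ f ∂(ρ i : Measure C(T, ℝ)), f o = 0)
    (h0' : ∀ᵐ f ∂(ρ' : Measure C(T, ℝ)), f o = 0)
    (ht : IsTightMeasureSet {(ρ i : Measure C(T, ℝ)) | i})
    (hD : ∀ s t : T, Tendsto (fun i => ∫ f, (f t - f s) ^ 2 ∂(ρ i : Measure C(T, ℝ))) l
      (𝓝 (∫ f, (f t - f s) ^ 2 ∂(ρ' : Measure C(T, ℝ))))) :
    Tendsto ρ l (𝓝 ρ') := by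
  let _ : TopologicalSpace (T →₀ ℝ) := ⊥
  have : DiscreteTopology (T →₀ ℝ) := ⟨rfl⟩
  let L : C(T, ℝ) →ₗ[ℝ] (T →₀ ℝ) →ₗ[ℝ] ℝ := LinearMap.mk₂ ℝ
    (fun f w => Finsupp.linearCombination ℝ (fun t => f t) w)
    (fun f g w => by simp [Finsupp.linearCombination_apply, Finsupp.sum, mul_add, Finset.sum_add_distrib])
    (fun c f w => by
      simp only [Finsupp.linearCombination_apply, Finsupp.sum, Finset.smul_sum]
      refine Finset.sum_congr rfl fun t _ => ?_
      simp; ring)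
    (fun f w w' => by simp) (fun c f w => by simp)
  have hLc : ∀ f w, L f w = comb w f := fun f w => by
    simp [L, comb_apply, Finsupp.linearCombination_apply, Finsupp.sum]
  have hL : Continuous fun p : C(T, ℝ) × (T →₀ ℝ) => L p.1 p.2 := by
    rw [continuous_prod_of_discrete_right]
    intro w
    simp only [hLc]
    exact (comb w).continuous
  refine ProbabilityMeasure.tendsto_of_tight_of_separatesPoints (𝕜 := ℂ) ht
    (A := charPoly continuous_probChar hL) ?_ ?_
  · refine separatesPoints_charPoly continuous_probChar probChar_ne_one _ ?_
    intro v hv h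
    apply hv
    ext t
    have := DFunLike.congr_fun h (Finsupp.single t 1)
    simpa [L] using this
  · intro g hg
    rw [mem_charPoly] at hg
    obtain ⟨w, hw⟩ := hg
    have h_eq (μ : Measure C(T, ℝ)) [IsProbabilityMeasure μ] :
        ∫ x, g x ∂μ = w.coeff.sum (fun a z ↦ z * charFunDual μ (comb a)) := by
      simp_rw [hw, Finsupp.sum]
      rw [integral_finsetSum]
      · congr with y
        rw [integral_const_mul, charFunDual_apply]
        simp only [hLc]
        rfl
      · refine fun i hi ↦ Integrable.const_mul ?_ _
        exact BoundedContinuousFunction.integrable μ (char continuous_probChar hL i)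
    simp_rw [h_eq]
    refine tendsto_finsetSum _ fun y hy ↦ Tendsto.const_mul _ ?_
    simp_rw [cg_charFunDual (hρ _), cg_charFunDual hρ']
    refine (Complex.continuous_exp.tendsto _).comp (Tendsto.div_const (Tendsto.neg ?_) _)
    refine (Complex.continuous_ofReal.tendsto _).comp ?_
    simp_rw [comb_var (hρ _) o (h0 _), comb_var hρ' o h0']
    refine tendsto_finsetSum _ fun s _ => tendsto_finsetSum _ fun t _ => ?_
    exact (((hD o s).add (hD o t)).sub (hD s t)).const_mul _
end Weak

section Tight
open ProbabilityTheory Real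

variable {T : Type*} [TopologicalSpace T] [CompactSpace T]

theorem chain_det {d : ℕ} (y : T → (Fin d → ℝ)) (hy : IsInducing y)
    (A : ℕ → Finset T) (pr : ℕ → T → T) (hprA : ∀ n t, pr n t ∈ A n)
    (hpr : ∀ n t, dist (y (pr n t)) (y t) ≤ (1 / 2) ^ n) (f : C(T, ℝ)) (M r : ℝ) (hM : 0 ≤ M)
    (hr0 : 0 ≤ r) (hr : r < 1)
    (hf : ∀ n, ∀ s t, (s ∈ A n ∨ s ∈ A (n + 1)) → (t ∈ A n ∨ t ∈ A (n + 1)) →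
      dist (y s) (y t) ≤ 3 * (1 / 2) ^ n → |f s - f t| ≤ M * r ^ n)
    (k : ℕ) (s t : T) (hst : dist (y s) (y t) ≤ (1 / 2) ^ k) :
    |f s - f t| ≤ 3 * M / (1 - r) * r ^ k := by
  have hlim : ∀ t, Tendsto (fun n => f (pr n t)) atTop (𝓝 (f t)) := by
    intro t
    refine (f.continuous.tendsto t).comp ?_
    rw [hy.tendsto_nhds_iff, tendsto_iff_dist_tendsto_zero]
    refine squeeze_zero (fun _ => dist_nonneg) (fun n => hpr n t) ?_
    exact tendsto_pow_atTop_nhds_zero_of_lt_one (by norm_num) (by norm_num)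
  have hk : ∀ t, |f (pr k t) - f t| ≤ M * r ^ k / (1 - r) := by
    intro t
    have := dist_le_of_le_geometric_of_tendsto r M hr (f := fun n => f (pr n t)) (a := f t) ?_ (hlim t) k
    · rwa [Real.dist_eq] at this
    · intro n
      rw [Real.dist_eq]
      apply hf n _ _ (Or.inl (hprA n t)) (Or.inr (hprA (n + 1) t))
      calc _ ≤ dist (y (pr n t)) (y t) + dist (y t) (y (pr (n + 1) t)) := dist_triangle _ _ _
        _ ≤ (1 / 2) ^ n + (1 / 2) ^ (n + 1) := by
          gcongr
          · exact hpr _ _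
          · rw [dist_comm]; exact hpr _ _
        _ ≤ _ := by
          have : (0 : ℝ) < (1 / 2) ^ n := by positivity
          rw [pow_succ]; linarith
  have h1 : |f (pr k s) - f (pr k t)| ≤ M * r ^ k := by
    apply hf k _ _ (Or.inl (hprA k s)) (Or.inl (hprA k t))
    have a1 := dist_triangle (y (pr k s)) (y s) (y (pr k t))
    have a2 := dist_triangle (y s) (y t) (y (pr k t))
    have a3 := hpr k s
    have a4 := hpr k t
    rw [dist_comm] at a4
    linarith
  have h2 := hk s
  have h3 := hk t
  have h4 : M * r ^ k ≤ M * r ^ k / (1 - r) := by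
    rw [le_div_iff₀ (by linarith)]
    have : 0 ≤ M * r ^ k := by positivity
    nlinarith
  have e : 3 * M / (1 - r) * r ^ k = 3 * (M * r ^ k / (1 - r)) := by ring
  rw [e]
  have := abs_sub_le (f s) (f (pr k s)) (f t)
  have := abs_sub_le (f (pr k s)) (f (pr k t)) (f t)
  rw [abs_sub_comm] at h2
  linarith

theorem exists_net {d : ℕ} (y : T → (Fin d → ℝ)) (hb : ∀ t j, |y t j| ≤ 1 / 2) (o : T) (n : ℕ) :
    ∃ A : Finset T, ∃ pr : T → T, A.card ≤ (4 * 2 ^ n) ^ d ∧ ∀ t, pr t ∈ A ∧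
      dist (y (pr t)) (y t) ≤ (1 / 2) ^ n := by
  classical
  let cell : T → (Fin d → ℤ) := fun t j => ⌊(2 : ℝ) ^ n * y t j⌋
  let rep : (Fin d → ℤ) → T := fun z => if hz : ∃ t, cell t = z then hz.choose else o
  have hrep : ∀ t, cell (rep (cell t)) = cell t := by
    intro t
    have hz : ∃ s, cell s = cell t := ⟨t, rfl⟩
    simp only [rep, hz, dite_true]
    exact hz.choose_spec
  refine ⟨(Fintype.piFinset fun _ : Fin d => Finset.Icc (-(2 : ℤ) ^ n) (2 ^ n)).image rep,
    fun t => rep (cell t), ?_, fun t => ⟨?_, ?_⟩⟩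
  · refine Finset.card_image_le.trans ?_
    rw [Fintype.card_piFinset]
    simp only [Finset.prod_const, Finset.card_univ, Fintype.card_fin, Int.card_Icc]
    refine Nat.pow_le_pow_left ?_ d
    have : (1 : ℤ) ≤ 2 ^ n := one_le_pow₀ (by norm_num)
    rw [Int.toNat_le]
    push_cast
    linarith
  · refine Finset.mem_image_of_mem _ ?_
    rw [Fintype.mem_piFinset]
    intro j
    have h1 := abs_le.1 (hb t j)
    have h2 : (0 : ℝ) < 2 ^ n := by positivity
    rw [Finset.mem_Icc]
    constructor
    · rw [Int.le_floor]; push_cast; nlinarith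
    · have : ((⌊(2 : ℝ) ^ n * y t j⌋ : ℤ) : ℝ) ≤ ((2 ^ n : ℤ) : ℝ) := by
        refine (Int.floor_le _).trans ?_
        push_cast; nlinarith
      exact Int.cast_le.1 this
  · rw [dist_pi_le_iff (by positivity)]
    intro j
    have h1 : ⌊(2 : ℝ) ^ n * y (rep (cell t)) j⌋ = ⌊(2 : ℝ) ^ n * y t j⌋ := congrFun (hrep t) j
    have h2 := Int.abs_sub_lt_one_of_floor_eq_floor h1
    rw [Real.dist_eq, one_div, inv_pow, ← one_div, le_div_iff₀ (by positivity)]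
    rw [← mul_sub, abs_mul, abs_of_pos (by positivity : (0 : ℝ) < 2 ^ n)] at h2
    linarith

theorem holder_compact {d : ℕ} (y : T → (Fin d → ℝ)) (hy : IsInducing y)
    (hb : ∀ t j, |y t j| ≤ 1 / 2) (o : T) (B r : ℝ) (hr0 : 0 ≤ r) (hr : r < 1) :
    IsCompact {f : C(T, ℝ) | f o = 0 ∧ ∀ k : ℕ, ∀ s t, dist (y s) (y t) ≤ (1 / 2) ^ k →
      |f s - f t| ≤ B * r ^ k} := by
  have hequi : ∀ (F : Set (T → ℝ)), (∀ f ∈ F, ∀ k : ℕ, ∀ s t, dist (y s) (y t) ≤ (1 / 2) ^ k →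
      |f s - f t| ≤ B * r ^ k) → Equicontinuous ((↑) : F → T → ℝ) := by
    intro F hF t
    rw [Metric.equicontinuousAt_iff_right]
    intro ε hε
    have : Tendsto (fun k : ℕ => B * r ^ k) atTop (𝓝 (B * 0)) :=
      (tendsto_pow_atTop_nhds_zero_of_lt_one hr0 hr).const_mul B
    rw [mul_zero] at this
    obtain ⟨k, hk⟩ := (this.eventually (gt_mem_nhds hε)).exists
    have hy' : ∀ᶠ s in 𝓝 t, dist (y s) (y t) < (1 / 2) ^ k := by
      have := hy.continuous.tendsto t
      exact this.eventually (Metric.ball_mem_nhds (y t) (by positivity))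
    filter_upwards [hy'] with s hs f
    rw [dist_comm, Real.dist_eq]
    exact (hF f f.2 k s t hs.le).trans_lt hk
  set S : Set (T → ℝ) := {f | f o = 0 ∧ ∀ k : ℕ, ∀ s t, dist (y s) (y t) ≤ (1 / 2) ^ k →
      |f s - f t| ≤ B * r ^ k} with hS
  refine ArzelaAscoli.isCompact_of_equicontinuous _ ?_ ?_
  · have himg : ContinuousMap.toFun '' {f : C(T, ℝ) | f o = 0 ∧ ∀ k : ℕ, ∀ s t,
        dist (y s) (y t) ≤ (1 / 2) ^ k → |f s - f t| ≤ B * r ^ k} = S := by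
      ext f
      constructor
      · rintro ⟨f, hf, rfl⟩; exact hf
      · intro hf
        have : Continuous f := (hequi S (fun f hf => hf.2)).continuous ⟨f, hf⟩
        exact ⟨⟨f, this⟩, hf, rfl⟩
    rw [himg]
    have hcl : IsClosed S := by
      have : S = {f | f o = 0} ∩ ⋂ k : ℕ, ⋂ s, ⋂ t, ⋂ (_ : dist (y s) (y t) ≤ (1 / 2) ^ k),
          {f | |f s - f t| ≤ B * r ^ k} := by
        ext f; simp [hS]
      rw [this]
      refine IsClosed.inter (isClosed_eq (continuous_apply o) continuous_const) ?_
      refine isClosed_iInter fun k => isClosed_iInter fun s => isClosed_iInter fun t =>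
        isClosed_iInter fun _ => isClosed_le (by fun_prop) continuous_const
    refine (isCompact_univ_pi (fun _ : T => isCompact_Icc (a := -B) (b := B))).of_isClosed_subset hcl ?_
    intro f hf t _
    have := hf.2 0 t o ?_
    · rw [hf.1] at this
      simpa [abs_le] using this
    · rw [dist_pi_le_iff (by positivity)]
      intro j
      rw [Real.dist_eq]
      have := abs_sub (y t j) (y o j)
      have := hb t j
      have := hb o j
      simp only [pow_zero]
      linarith
  · have := hequi (ContinuousMap.toFun '' {f : C(T, ℝ) | f o = 0 ∧ ∀ k : ℕ, ∀ s t,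
        dist (y s) (y t) ≤ (1 / 2) ^ k → |f s - f t| ≤ B * r ^ k}) (by rintro _ ⟨f, hf, rfl⟩; exact hf.2)
    intro t U hU
    filter_upwards [this t U hU] with s hs f
    exact hs ⟨_, ⟨f.1, f.2, rfl⟩⟩

variable [MeasurableSpace C(T, ℝ)] [BorelSpace C(T, ℝ)] [SecondCountableTopology C(T, ℝ)]

theorem gauss_tail {m : Measure C(T, ℝ)} (hm : IsCenteredGaussian m) (s t : T) (V q : ℝ)
    (hV : 0 < V) (hq : 0 < q) (p : ℕ) (h : ∫ f, (f t - f s) ^ 2 ∂m ≤ V) :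
    m {f | q < |f t - f s|} ≤ ENNReal.ofReal (2 * p.factorial * (2 * V) ^ p / q ^ (2 * p)) := by
  have := hm.1
  obtain ⟨v, hv⟩ := hm.2 (evd t - evd s)
  have hmeas : Measurable (evd t - evd s : StrongDual ℝ C(T, ℝ)) := (evd t - evd s).continuous.measurable
  have hvar : (v : ℝ) ≤ V := by
    refine le_trans (le_of_eq ?_) h
    have h1 : ∫ x, x ^ 2 ∂(gaussianReal 0 v) = v := by
      have := variance_id_gaussianReal (μ := 0) (v := v)
      rwa [variance_of_integral_eq_zero aemeasurable_id (by simp [integral_id_gaussianReal])] at this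
    rw [← h1, ← hv, integral_map hmeas.aemeasurable (by fun_prop)]
    simp
  have hone : ∀ (ν : Measure ℝ), ν = gaussianReal 0 v → ν {x | q ≤ x} ≤ ENNReal.ofReal (p.factorial * (2 * V) ^ p / q ^ (2 * p)) := by
    rintro ν rfl
    have hmg := measure_ge_le_exp_mul_mgf (μ := gaussianReal 0 v) (X := id) (t := q / V) q (by positivity)
      (integrable_exp_mul_gaussianReal (q / V))
    rw [mgf_id_gaussianReal] at hmg
    rw [← ofReal_measureReal (by finiteness)]
    refine ENNReal.ofReal_le_ofReal (hmg.trans ?_)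
    rw [← Real.exp_add]
    have hz : 0 ≤ q ^ 2 / (2 * V) := by positivity
    have e1 : -(q / V) * q + (0 * (q / V) + v * (q / V) ^ 2 / 2) ≤ -(q ^ 2 / (2 * V)) := by
      have : v * (q / V) ^ 2 / 2 ≤ V * (q / V) ^ 2 / 2 := by gcongr
      have e : V * (q / V) ^ 2 / 2 = q ^ 2 / (2 * V) := by field_simp
      have e' : -(q / V) * q = - 2 * (q ^ 2 / (2 * V)) := by field_simp
      linarith
    refine (Real.exp_le_exp.2 e1).trans ?_
    have h3 := Real.pow_div_factorial_le_exp _ hz p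
    rw [Real.exp_neg]
    have hpos : 0 < (q ^ 2 / (2 * V)) ^ p / p.factorial := by positivity
    refine (inv_anti₀ hpos h3).trans (le_of_eq ?_)
    rw [div_pow, ← pow_mul]
    field_simp
  have hsub : {f : C(T, ℝ) | q < |f t - f s|} ⊆ ((evd t - evd s : StrongDual ℝ C(T, ℝ)) ⁻¹' {x | q ≤ x}) ∪
      ((evd t - evd s : StrongDual ℝ C(T, ℝ)) ⁻¹' ((fun x => - x) ⁻¹' {x | q ≤ x})) := by
    intro f hf
    rcases lt_abs.1 (show q < |f t - f s| from hf) with h | h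
    · left; simpa using h.le
    · right
      have := h.le
      simpa using this
  refine (measure_mono hsub).trans ((measure_union_le _ _).trans ?_)
  have hc : MeasurableSet {x : ℝ | q ≤ x} := measurableSet_Ici
  rw [← Measure.map_apply hmeas hc, ← Measure.map_apply hmeas (hc.preimage measurable_neg), hv,
    ← Measure.map_apply measurable_neg hc]
  have e : (2 : ℝ) * p.factorial * (2 * V) ^ p / q ^ (2 * p) = (p.factorial * (2 * V) ^ p / q ^ (2 * p)) +
    (p.factorial * (2 * V) ^ p / q ^ (2 * p)) := by ring
  rw [e, ENNReal.ofReal_add (by positivity) (by positivity)]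
  refine add_le_add (hone _ rfl) (hone _ ?_)
  have := gaussianReal_map_neg (μ := 0) (v := v)
  rwa [neg_zero] at this

theorem tight_of_holder {d : ℕ} (y : T → (Fin d → ℝ)) (hy : IsInducing y)
    (hb : ∀ t j, |y t j| ≤ 1 / 2) (o : T) (S : Set (Measure C(T, ℝ)))
    (hS : ∀ m ∈ S, IsCenteredGaussian m) (h0 : ∀ m ∈ S, ∀ᵐ f ∂m, f o = 0)
    (K a : ℝ) (hK : 0 < K) (ha : 0 < a)
    (hvar : ∀ m ∈ S, ∀ η, 0 < η → ∀ s t, dist (y s) (y t) ≤ η →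
      ∫ f, (f t - f s) ^ 2 ∂m ≤ K * η ^ a) : IsTightMeasureSet S := by
  classical
  rw [isTightMeasureSet_iff_exists_isCompact_measure_compl_le]
  intro ε hε
  choose A pr hcard hpr using fun n => exists_net y hb o n
  set r : ℝ := (1 / 2) ^ (a / 4) with hr
  have hr0 : 0 < r := by positivity
  have hr1 : r < 1 := Real.rpow_lt_one (by norm_num) (by norm_num) (by positivity)
  obtain ⟨p, hp⟩ := exists_pow_lt_of_lt_one (show (0 : ℝ) < 1 / 2 * (1 / 4) ^ d by positivity)
    (pow_lt_one₀ hr0.le hr1 (two_ne_zero))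
  have hp0 : p ≠ 0 := by
    rintro rfl
    rw [pow_zero] at hp
    have : ((1 : ℝ) / 4) ^ d ≤ 1 := pow_le_one₀ (by norm_num) (by norm_num)
    linarith
  set D : ℝ := (4 * 64 ^ d) * (2 * p.factorial * (2 * (K * 3 ^ a)) ^ p) with hD
  have hD0 : 0 < D := by positivity
  obtain ⟨M, hM1, hM⟩ : ∃ M : ℝ, 1 ≤ M ∧ ENNReal.ofReal (D / M * 2) ≤ ε := by
    have : Tendsto (fun M : ℝ => ENNReal.ofReal (D / M * 2)) atTop (𝓝 (ENNReal.ofReal (0 * 2))) :=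
      ENNReal.tendsto_ofReal ((tendsto_const_nhds.div_atTop tendsto_id).mul_const 2)
    rw [zero_mul, ENNReal.ofReal_zero] at this
    obtain ⟨M, h1, h2⟩ := ((this.eventually (gt_mem_nhds hε)).and (eventually_ge_atTop 1)).exists
    exact ⟨M, h2, h1.le⟩
  refine ⟨_, holder_compact y hy hb o (3 * M / (1 - r)) r hr0.le hr1, fun m hm => ?_⟩
  have := (hS m hm).1
  set B : ℕ → Finset T := fun n => A n ∪ A (n + 1) with hB
  set P : ℕ → Finset (T × T) := fun n => (B n ×ˢ B n).filter
    (fun q => dist (y q.1) (y q.2) ≤ 3 * (1 / 2) ^ n) with hP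
  have hsub : {f : C(T, ℝ) | f o = 0 ∧ ∀ k : ℕ, ∀ s t, dist (y s) (y t) ≤ (1 / 2) ^ k →
      |f s - f t| ≤ 3 * M / (1 - r) * r ^ k}ᶜ ⊆ {f | ¬ f o = 0} ∪
      ⋃ n, ⋃ q ∈ P n, {f | M * r ^ n < |f q.2 - f q.1|} := by
    intro f hf
    by_contra hcon
    apply hf
    simp only [Set.mem_union, Set.mem_setOf_eq, Set.mem_iUnion, not_or, not_not, not_exists, not_lt] at hcon
    refine ⟨hcon.1, fun k s t hst => ?_⟩
    refine chain_det y hy A pr (fun n t => (hpr n t).1) (fun n t => (hpr n t).2) f M r (by linarith)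
      hr0.le hr1 ?_ k s t hst
    intro n s t hs ht hst
    rw [abs_sub_comm]
    refine hcon.2 n (s, t) ?_
    simp only [hP, hB, Finset.mem_filter, Finset.mem_product, Finset.mem_union]
    exact ⟨⟨hs, ht⟩, hst⟩
  refine (measure_mono hsub).trans ((measure_union_le _ _).trans ?_)
  rw [show m {f | ¬ f o = 0} = 0 from h0 m hm, zero_add]
  refine (measure_iUnion_le _).trans ?_
  have hterm : ∀ n, m (⋃ q ∈ P n, {f : C(T, ℝ) | M * r ^ n < |f q.2 - f q.1|}) ≤
      ENNReal.ofReal (D / M * (1 / 2) ^ n) := by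
    intro n
    have hV : K * (3 * (1 / 2) ^ n) ^ a = K * 3 ^ a * (r ^ n) ^ 4 := by
      rw [Real.mul_rpow (by norm_num) (by positivity), hr, ← pow_mul, ← Real.rpow_natCast,
        ← Real.rpow_natCast, ← Real.rpow_mul (by norm_num), ← Real.rpow_mul (by norm_num), mul_assoc]
      congr 3
      push_cast; ring
    have hc : ((P n).card : ℝ) ≤ 4 * 64 ^ d * (4 ^ d) ^ n := by
      have h1 : (P n).card ≤ (2 * (8 * 2 ^ n) ^ d) * (2 * (8 * 2 ^ n) ^ d) := by
        refine (Finset.card_filter_le _ _).trans ?_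
        rw [Finset.card_product]
        have : (B n).card ≤ 2 * (8 * 2 ^ n) ^ d := by
          refine (Finset.card_union_le _ _).trans ?_
          have h1 := hcard n
          have h2 := hcard (n + 1)
          have h3 : (4 * 2 ^ n) ^ d ≤ (8 * 2 ^ n) ^ d := by gcongr; norm_num
          have h4 : 4 * 2 ^ (n + 1) = 8 * 2 ^ n := by ring
          rw [h4] at h2
          omega
        exact Nat.mul_le_mul this this
      have h2 : ((P n).card : ℝ) ≤ (2 * (8 * 2 ^ n) ^ d) * (2 * (8 * 2 ^ n) ^ d) := by exact_mod_cast h1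
      refine h2.trans (le_of_eq ?_)
      rw [show (64 : ℝ) = 8 * 8 by norm_num, show (4 : ℝ) ^ d = 2 ^ d * 2 ^ d by rw [← mul_pow]; norm_num,
        mul_pow, mul_pow, mul_pow, ← pow_mul, ← pow_mul, mul_comm n d]
      ring
    calc _ ≤ ∑ q ∈ P n, m {f : C(T, ℝ) | M * r ^ n < |f q.2 - f q.1|} := measure_biUnion_finset_le _ _
      _ ≤ ∑ q ∈ P n, ENNReal.ofReal (2 * p.factorial * (2 * (K * 3 ^ a * (r ^ n) ^ 4)) ^ p /
          (M * r ^ n) ^ (2 * p)) := by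
        refine Finset.sum_le_sum fun q hq => ?_
        refine gauss_tail (hS m hm) q.1 q.2 _ _ (by positivity) (by positivity) p ?_
        rw [← hV]
        exact hvar m hm _ (by positivity) _ _ (Finset.mem_filter.1 hq).2
      _ = ENNReal.ofReal ((P n).card * (2 * p.factorial * (2 * (K * 3 ^ a * (r ^ n) ^ 4)) ^ p /
          (M * r ^ n) ^ (2 * p))) := by
        rw [Finset.sum_const, nsmul_eq_mul, ENNReal.ofReal_mul (by positivity), ENNReal.ofReal_natCast]
      _ ≤ _ := by
        refine ENNReal.ofReal_le_ofReal ?_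
        have e1 : 2 * p.factorial * (2 * (K * 3 ^ a * (r ^ n) ^ 4)) ^ p / (M * r ^ n) ^ (2 * p) =
          (2 * p.factorial * (2 * (K * 3 ^ a)) ^ p) / M ^ (2 * p) * ((r ^ 2) ^ p) ^ n := by
          have e2 : (2 * (K * 3 ^ a * (r ^ n) ^ 4)) ^ p = (2 * (K * 3 ^ a)) ^ p * ((r ^ n) ^ (2 * p) * (r ^ n) ^ (2 * p)) := by
            rw [← mul_assoc 2, mul_pow, ← pow_mul, ← pow_add]; ring_nf
          have e3 : ((r ^ 2) ^ p) ^ n = (r ^ n) ^ (2 * p) := by ring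
          rw [e2, e3, mul_pow M]
          field_simp
        rw [e1]
        have hM2 : M ≤ M ^ (2 * p) := le_self_pow₀ hM1 (by omega)
        have hM0 : 0 < M := by linarith
        calc _ ≤ 4 * 64 ^ d * (4 ^ d) ^ n * ((2 * p.factorial * (2 * (K * 3 ^ a)) ^ p) / M * ((r ^ 2) ^ p) ^ n) := by gcongr
          _ = D / M * (4 ^ d * (r ^ 2) ^ p) ^ n := by rw [hD, mul_pow]; ring
          _ ≤ D / M * (1 / 2) ^ n := by
            gcongr
            calc _ ≤ (4 : ℝ) ^ d * (1 / 2 * (1 / 4) ^ d) := by gcongr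
              _ = 1 / 2 := by rw [mul_left_comm, ← mul_pow]; norm_num
  refine (ENNReal.tsum_le_tsum hterm).trans ?_
  have hM0 : 0 < M := by linarith
  rw [← ENNReal.ofReal_tsum_of_nonneg (fun n => by positivity) (summable_geometric_two.mul_left _), tsum_mul_left,
    tsum_geometric_two]
  exact hM

end Tight

section Laplace
open ProbabilityTheory Real

theorem port_lemma {X Y ι : Type*} [TopologicalSpace X] [TopologicalSpace.PseudoMetrizableSpace X]
    [SecondCountableTopology X] [MeasurableSpace X] [BorelSpace X]
    [TopologicalSpace Y] [TopologicalSpace.PseudoMetrizableSpace Y]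
    [SecondCountableTopology Y] [MeasurableSpace Y] [BorelSpace Y] {l : Filter ι}
    (ρ : ι → ProbabilityMeasure X) (ρ' : ProbabilityMeasure X) (hρ : Tendsto ρ l (𝓝 ρ'))
    (y : ι → Y) (y' : Y) (hy : Tendsto y l (𝓝 y')) (G : X × Y → ℝ) (hG : Continuous G)
    (h0 : (ρ' : Measure X) {x | G (x, y') = 0} = 0) :
    Tendsto (fun i => (ρ i : Measure X).real {x | 0 < G (x, y i)}) l
      (𝓝 ((ρ' : Measure X).real {x | 0 < G (x, y')})) := by
  have h1 : Tendsto (fun i => (ρ i).prod (diracProba (y i))) l (𝓝 (ρ'.prod (diracProba y'))) :=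
    (ProbabilityMeasure.continuous_prod.tendsto (ρ', diracProba y')).comp
      (hρ.prodMk_nhds ((continuous_diracProba.tendsto y').comp hy))
  have hop : IsOpen {p : X × Y | 0 < G p} := isOpen_lt continuous_const hG
  have hpr : ∀ (m : ProbabilityMeasure X) (z : Y) (s : Set (X × Y)), MeasurableSet s →
      (m.prod (diracProba z) : Measure (X × Y)) s = (m : Measure X) {x | (x, z) ∈ s} := by
    intro m z s hs
    rw [ProbabilityMeasure.toMeasure_prod]
    change (Measure.prod (m : Measure X) (Measure.dirac z)) s = _
    rw [Measure.prod_dirac, Measure.map_apply (by fun_prop) hs]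
    rfl
  have h2 := ProbabilityMeasure.tendsto_measure_of_null_frontier_of_tendsto' h1
    (E := {p : X × Y | 0 < G p}) (by
      refine measure_mono_null (frontier_lt_subset_eq continuous_const hG) ?_
      rw [hpr _ _ _ (isClosed_eq continuous_const hG).measurableSet]
      simpa [eq_comm] using h0)
  rw [hpr _ _ _ hop.measurableSet] at h2
  simp only [hpr _ _ _ hop.measurableSet] at h2
  exact (ENNReal.tendsto_toReal (by finiteness)).comp h2

theorem layer_exp {X : Type*} [MeasurableSpace X] (ρ : Measure X) [IsProbabilityMeasure ρ]
    (Y : X → ℝ) (hY : Measurable Y) :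
    ∫ w, Real.exp w * ρ.real {f | w < Y f} = ∫ f, Real.exp (Y f) ∂ρ := by
  have hms : MeasurableSet {p : ℝ × X | p.1 < Y p.2} :=
    measurableSet_lt measurable_fst (hY.comp measurable_snd)
  have hms' : MeasurableSet {p : X × ℝ | p.2 < Y p.1} :=
    measurableSet_lt measurable_snd (hY.comp measurable_fst)
  have hF : Measurable fun w => ρ {f | w < Y f} := measurable_measure_prodMk_left hms
  rw [integral_eq_lintegral_of_nonneg_ae (ae_of_all _ fun w => by positivity)
      (show AEStronglyMeasurable (fun w => Real.exp w * ρ.real {f | w < Y f}) volume from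
        (Real.measurable_exp.mul hF.ennreal_toReal).aestronglyMeasurable),
    integral_eq_lintegral_of_nonneg_ae (ae_of_all _ fun w => by positivity)
      (by fun_prop)]
  congr 1
  have h1 : ∀ y : ℝ, ENNReal.ofReal (Real.exp y) =
      ∫⁻ w, (Set.Iio y).indicator (fun w => ENNReal.ofReal (Real.exp w)) w := by
    intro y
    rw [lintegral_indicator measurableSet_Iio, Measure.restrict_congr_set Iio_ae_eq_Iic,
      ← ofReal_integral_eq_lintegral_ofReal (integrableOn_exp_Iic y) (ae_of_all _ fun w => by positivity),
      integral_exp_Iic]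
  simp_rw [h1 (Y _)]
  rw [lintegral_lintegral_swap]
  · refine lintegral_congr fun w => ?_
    rw [ENNReal.ofReal_mul (by positivity), ofReal_measureReal (by finiteness)]
    have : ∀ f, (Set.Iio (Y f)).indicator (fun w => ENNReal.ofReal (Real.exp w)) w =
        {f | w < Y f}.indicator (fun _ => ENNReal.ofReal (Real.exp w)) f := by
      intro f; simp [Set.indicator]
    simp_rw [this]
    rw [lintegral_indicator_const (measurableSet_lt measurable_const hY)]
  · have : (Function.uncurry fun f w => (Set.Iio (Y f)).indicator (fun w => ENNReal.ofReal (Real.exp w)) w) =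
        {p : X × ℝ | p.2 < Y p.1}.indicator (fun p => ENNReal.ofReal (Real.exp p.2)) := by
      ext p; simp [Set.indicator, Function.uncurry]
    rw [this]
    exact (Measurable.indicator (by fun_prop) hms').aemeasurable

variable {T : Type*} [TopologicalSpace T] [CompactSpace T]
  [MeasurableSpace C(T, ℝ)] [BorelSpace C(T, ℝ)] [SecondCountableTopology C(T, ℝ)]

/-- the tail factor -/
noncomputable def tailF (Γ : C(T, ℝ) → ℝ) (ρ : Measure C(T, ℝ)) (a k r : C(T, ℝ)) (w : ℝ) : ℝ :=
  ρ.real {f | 0 < Γ (k * (f - (a + w • r)))}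

theorem tailF_measurable (Γ : C(T, ℝ) → ℝ) (hΓ : Continuous Γ) (ρ : Measure C(T, ℝ))
    [IsProbabilityMeasure ρ] (a k r : C(T, ℝ)) : Measurable (tailF Γ ρ a k r) := by
  have hms : MeasurableSet {p : ℝ × C(T, ℝ) | 0 < Γ (k * (p.2 - (a + p.1 • r)))} :=
    (isOpen_lt continuous_const (by fun_prop)).measurableSet
  exact (measurable_measure_prodMk_left hms).ennreal_toReal

theorem tailF_bound (Γ : C(T, ℝ) → ℝ) (hpos : ∀ f, 0 < Γ f → ∃ t, 0 < f t)
    (ρ : Measure C(T, ℝ)) [IsProbabilityMeasure ρ] (M : ENNReal) (hM : M < ⊤)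
    (hρ : ∫⁻ f, ENNReal.ofReal (Real.exp (4 * ‖f‖)) ∂ρ ≤ M) (a k r : C(T, ℝ)) (A : ℝ)
    (ha : ‖a‖ ≤ A) (hk : ∀ t, 0 < k t) (hr : ∀ t, 1 / 2 ≤ r t) (w : ℝ) :
    Real.exp w * tailF Γ ρ a k r w ≤ max 1 (Real.exp (4 * A) * M.toReal) * Real.exp (-|w|) := by
  rcases le_or_gt w 0 with hw | hw
  · rw [abs_of_nonpos hw, neg_neg, mul_comm (max _ _)]
    have : tailF Γ ρ a k r w ≤ 1 := measureReal_le_one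
    gcongr
    exact this.trans (le_max_left _ _)
  · rw [abs_of_pos hw]
    have hsub : {f | 0 < Γ (k * (f - (a + w • r)))} ⊆
        {f | ENNReal.ofReal (Real.exp (2 * w - 4 * A)) ≤ ENNReal.ofReal (Real.exp (4 * ‖f‖))} := by
      intro f hf
      obtain ⟨t, ht⟩ := hpos _ hf
      simp only [ContinuousMap.mul_apply, ContinuousMap.sub_apply, ContinuousMap.add_apply,
        ContinuousMap.smul_apply, smul_eq_mul] at ht
      have h1 := pos_of_mul_pos_right ht (hk t).le
      refine ENNReal.ofReal_le_ofReal (Real.exp_le_exp.2 ?_)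
      have h2 := (abs_le.1 (a.norm_coe_le_norm t)).1
      have h3 := (abs_le.1 (f.norm_coe_le_norm t)).2
      have := hr t
      nlinarith
    have h1 : tailF Γ ρ a k r w ≤ Real.exp (4 * A - 2 * w) * M.toReal := by
      have hm := mul_meas_ge_le_lintegral₀ (μ := ρ) (f := fun f => ENNReal.ofReal (Real.exp (4 * ‖f‖)))
        (by fun_prop) (ENNReal.ofReal (Real.exp (2 * w - 4 * A)))
      have h2 := (mul_le_mul_right (measure_mono (μ := ρ) hsub) (ENNReal.ofReal (Real.exp (2 * w - 4 * A)))).trans (hm.trans hρ)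
      have h3 := ENNReal.toReal_mono hM.ne h2
      rw [ENNReal.toReal_mul, ENNReal.toReal_ofReal (by positivity)] at h3
      rw [show 4 * A - 2 * w = -(2 * w - 4 * A) by ring, Real.exp_neg, ← div_eq_inv_mul,
        le_div_iff₀ (by positivity), mul_comm]
      exact h3
    calc _ ≤ Real.exp w * (Real.exp (4 * A - 2 * w) * M.toReal) := by gcongr
      _ = (Real.exp (4 * A) * M.toReal) * Real.exp (-w) := by
        rw [← mul_assoc, ← Real.exp_add, mul_right_comm, ← Real.exp_add]; ring_nf
      _ ≤ _ := by gcongr; exact le_max_right _ _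

theorem integrable_exp_neg_abs_aux : Integrable (fun w : ℝ => Real.exp (-|w|)) := by
  rw [← integrableOn_univ, ← Set.Iic_union_Ioi (a := (0 : ℝ))]
  refine IntegrableOn.union ?_ ?_
  · refine (integrableOn_exp_Iic 0).congr_fun (fun w hw => ?_) measurableSet_Iic
    simp [abs_of_nonpos (Set.mem_Iic.1 hw)]
  · refine (integrableOn_exp_neg_Ioi 0).congr_fun (fun w hw => ?_) measurableSet_Ioi
    simp [abs_of_pos (Set.mem_Ioi.1 hw)]

theorem laplace_cg {ι : Type*} {l : Filter ι} [l.IsCountablyGenerated] (g : ι → ℝ)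
    (hg : Tendsto g l atTop) (ρ : ι → ProbabilityMeasure C(T, ℝ)) (ρ' : ProbabilityMeasure C(T, ℝ))
    (hρ : Tendsto ρ l (𝓝 ρ')) (a k r : ι → C(T, ℝ)) (a' : C(T, ℝ)) (ha : Tendsto a l (𝓝 a'))
    (hk : Tendsto k l (𝓝 1)) (hr : Tendsto r l (𝓝 1)) (M : ENNReal) (hM : M < ⊤)
    (hρM : ∀ᶠ i in l, ∫⁻ f, ENNReal.ofReal (Real.exp (4 * ‖f‖)) ∂(ρ i : Measure C(T, ℝ)) ≤ M)
    (Γ : C(T, ℝ) → ℝ) (hΓ : Continuous Γ) (hpos : ∀ f, 0 < Γ f → ∃ t, 0 < f t)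
    (hΓb : ∀ (b : ℝ) f, Γ (f + ContinuousMap.const T b) = Γ f + b) :
    Tendsto (fun i => ∫ w, Real.exp (w - w ^ 2 / (2 * g i ^ 2)) * tailF Γ (ρ i) (a i) (k i) (r i) w) l
      (𝓝 (∫ f, Real.exp (Γ (f - a')) ∂(ρ' : Measure C(T, ℝ)))) := by
  have hlim : ∫ f, Real.exp (Γ (f - a')) ∂(ρ' : Measure C(T, ℝ)) =
      ∫ w, Real.exp w * tailF Γ ρ' a' 1 1 w := by
    rw [← layer_exp (ρ' : Measure C(T, ℝ)) (fun f => Γ (f - a')) (by fun_prop)]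
    congr 1
    ext w
    congr 2
    ext f
    have : (1 : C(T, ℝ)) * (f - (a' + w • (1 : C(T, ℝ)))) = (f - a') + ContinuousMap.const T (-w) := by
      ext t; simp; ring
    simp only [Set.mem_ofPred_eq, this, hΓb]
    constructor <;> intro h <;> linarith
  rw [hlim]
  have hnear : ∀ (b : ι → C(T, ℝ)) (b' : C(T, ℝ)), Tendsto b l (𝓝 b') → ∀ ε > 0, ∀ᶠ i in l, ‖b i - b'‖ < ε := by
    intro b b' hb ε hε
    filter_upwards [hb.eventually (Metric.ball_mem_nhds b' hε)] with i hi
    rwa [dist_eq_norm] at hi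
  have hhalf : ∀ (b : C(T, ℝ)), ‖b - 1‖ < 1 / 2 → ∀ t, 1 / 2 ≤ b t := by
    intro b hb t
    have := (b - 1).norm_coe_le_norm t
    have := (abs_le.1 this).1
    simp at this
    linarith
  refine tendsto_integral_filter_of_dominated_convergence
    (fun w => max 1 (Real.exp (4 * (‖a'‖ + 1)) * M.toReal) * Real.exp (-|w|)) ?_ ?_
    (integrable_exp_neg_abs_aux.const_mul _) ?_
  · refine Eventually.of_forall fun i => ?_
    exact ((by fun_prop : Measurable fun w : ℝ => Real.exp (w - w ^ 2 / (2 * g i ^ 2))).mul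
      (tailF_measurable Γ hΓ _ _ _ _)).aestronglyMeasurable
  · filter_upwards [hρM, hnear a a' ha 1 one_pos, hnear k 1 hk (1 / 2) (by norm_num),
      hnear r 1 hr (1 / 2) (by norm_num)] with i h1 h2 h3 h4
    refine ae_of_all _ fun w => ?_
    have hnn : 0 ≤ tailF Γ (ρ i) (a i) (k i) (r i) w := measureReal_nonneg
    rw [Real.norm_of_nonneg (by positivity)]
    refine le_trans ?_ (tailF_bound Γ hpos (ρ i) M hM h1 (a i) (k i) (r i) (‖a'‖ + 1) ?_
      (fun t => by linarith [hhalf _ h3 t]) (hhalf _ h4) w)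
    · gcongr
      have : 0 ≤ w ^ 2 / (2 * g i ^ 2) := by positivity
      linarith
    · have := norm_sub_norm_le (a i) a'
      linarith
  · have hcount : Set.Countable {w : ℝ | 0 < (ρ' : Measure C(T, ℝ)) {f | Γ (f - a') = w}} :=
      Measure.countable_meas_level_set_pos (by fun_prop : Measurable fun f => Γ (f - a'))
    filter_upwards [hcount.ae_notMem volume] with w hw
    refine Tendsto.mul ?_ ?_
    · refine (Real.continuous_exp.tendsto w).comp ?_
      have : Tendsto (fun i => w - w ^ 2 / (2 * g i ^ 2)) l (𝓝 (w - 0)) := by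
        refine tendsto_const_nhds.sub (tendsto_const_nhds.div_atTop ?_)
        exact ((tendsto_pow_atTop two_ne_zero).comp hg).const_mul_atTop two_pos
      rwa [sub_zero] at this
    · have := port_lemma (l := l) ρ ρ' hρ (fun i => (k i, a i + w • r i)) (1, a' + w • (1 : C(T, ℝ)))
        (hk.prodMk_nhds (ha.add (hr.const_smul w))) (fun p => Γ (p.2.1 * (p.1 - p.2.2))) (by fun_prop) ?_
      · exact this
      · have hw' : (ρ' : Measure C(T, ℝ)) {f | Γ (f - a') = w} = 0 := by simpa using hw
        rw [← hw']
        congr 1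
        ext f
        have : (1 : C(T, ℝ)) * (f - (a' + w • (1 : C(T, ℝ)))) = (f - a') + ContinuousMap.const T (-w) := by
          ext t; simp; ring
        simp only [Set.mem_ofPred_eq, this, hΓb]
        constructor <;> intro h <;> linarith

theorem laplace_gen {ι : Type*} {l : Filter ι} (g : ι → ℝ)
    (hg : Tendsto g l atTop) (ρ : ι → ProbabilityMeasure C(T, ℝ)) (ρ' : ProbabilityMeasure C(T, ℝ))
    (hρ : Tendsto ρ l (𝓝 ρ')) (a k r : ι → C(T, ℝ)) (a' : C(T, ℝ)) (ha : Tendsto a l (𝓝 a'))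
    (hk : Tendsto k l (𝓝 1)) (hr : Tendsto r l (𝓝 1)) (M : ENNReal) (hM : M < ⊤)
    (hρM : ∀ᶠ i in l, ∫⁻ f, ENNReal.ofReal (Real.exp (4 * ‖f‖)) ∂(ρ i : Measure C(T, ℝ)) ≤ M)
    (Γ : C(T, ℝ) → ℝ) (hΓ : Continuous Γ) (hpos : ∀ f, 0 < Γ f → ∃ t, 0 < f t)
    (hΓb : ∀ (b : ℝ) f, Γ (f + ContinuousMap.const T b) = Γ f + b) :
    Tendsto (fun i => ∫ w, Real.exp (w - w ^ 2 / (2 * g i ^ 2)) * tailF Γ (ρ i) (a i) (k i) (r i) w) l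
      (𝓝 (∫ f, Real.exp (Γ (f - a')) ∂(ρ' : Measure C(T, ℝ)))) := by
  let Q := ℝ × ProbabilityMeasure C(T, ℝ) × C(T, ℝ) × C(T, ℝ) × C(T, ℝ)
  let S : Set Q :=
    {p | ∫⁻ f, ENNReal.ofReal (Real.exp (4 * ‖f‖)) ∂(p.2.1 : Measure C(T, ℝ)) ≤ M}
  obtain ⟨L0, hL0⟩ : ∃ L0 : Filter Q, L0 = atTop ×ˢ 𝓝 ρ' ×ˢ 𝓝 a' ×ˢ 𝓝 1 ×ˢ 𝓝 1 := ⟨_, rfl⟩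
  have i0 : L0.IsCountablyGenerated := by
    rw [hL0]; infer_instance
  have t1 : Tendsto (fun p : Q => p.1) L0 atTop := by rw [hL0]; exact tendsto_fst
  have u1 : Tendsto (fun p : Q => p.2) L0 (𝓝 ρ' ×ˢ 𝓝 a' ×ˢ 𝓝 1 ×ˢ 𝓝 1) := by
    rw [hL0]; exact tendsto_snd
  have t2 : Tendsto (fun p : Q => p.2.1) L0 (𝓝 ρ') := tendsto_fst.comp u1
  have u2 : Tendsto (fun p : Q => p.2.2) L0 (𝓝 a' ×ˢ 𝓝 1 ×ˢ 𝓝 1) := tendsto_snd.comp u1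
  have t3 : Tendsto (fun p : Q => p.2.2.1) L0 (𝓝 a') := tendsto_fst.comp u2
  have u3 : Tendsto (fun p : Q => p.2.2.2) L0 (𝓝 1 ×ˢ 𝓝 1) := tendsto_snd.comp u2
  have t4 : Tendsto (fun p : Q => p.2.2.2.1) L0 (𝓝 1) := tendsto_fst.comp u3
  have t5 : Tendsto (fun p : Q => p.2.2.2.2) L0 (𝓝 1) := tendsto_snd.comp u3
  have hle : L0 ⊓ 𝓟 S ≤ L0 := inf_le_left
  have i1 : (L0 ⊓ 𝓟 S).IsCountablyGenerated := inferInstance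
  have hS : ∀ᶠ p : Q in L0 ⊓ 𝓟 S,
      ∫⁻ f, ENNReal.ofReal (Real.exp (4 * ‖f‖)) ∂(p.2.1 : Measure C(T, ℝ)) ≤ M :=
    mem_inf_of_right (mem_principal_self S)
  have key := laplace_cg (l := L0 ⊓ 𝓟 S) (fun p : Q => p.1) (t1.mono_left hle) (fun p => p.2.1) ρ'
    (t2.mono_left hle) (fun p => p.2.2.1) (fun p => p.2.2.2.1)
    (fun p => p.2.2.2.2) a' (t3.mono_left hle) (t4.mono_left hle) (t5.mono_left hle) M hM
    hS Γ hΓ hpos hΓb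
  have hto : Tendsto (fun i => ((g i, ρ i, a i, k i, r i) : Q)) l (L0 ⊓ 𝓟 S) := by
    refine tendsto_inf.2 ⟨?_, tendsto_principal.2 hρM⟩
    rw [hL0]
    exact hg.prodMk (hρ.prodMk (ha.prodMk (hk.prodMk hr)))
  have h2 := key.comp hto
  simp only [Function.comp_def] at h2
  exact h2

end Laplace

section Exact
open ProbabilityTheory Real

theorem subst_lemma (G : ℝ → ℝ) (g : ℝ) (hg : 0 < g) :
    ∫ x, Real.exp (-x ^ 2 / 2) * G (g ^ 2 - g * x) =
      Real.exp (-g ^ 2 / 2) * g⁻¹ * ∫ w, Real.exp (w - w ^ 2 / (2 * g ^ 2)) * G w := by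
  set F : ℝ → ℝ := fun w => Real.exp (-(g - w / g) ^ 2 / 2) * G w with hF
  have h1 : ∀ x, Real.exp (-x ^ 2 / 2) * G (g ^ 2 - g * x) = (fun y => F (g ^ 2 - y)) (g * x) := by
    intro x
    simp only [hF]
    congr 3
    field_simp
    ring
  simp_rw [h1]
  rw [Measure.integral_comp_mul_left (fun y => F (g ^ 2 - y)) g,
    integral_sub_left_eq_self F volume (g ^ 2), abs_of_pos (inv_pos.2 hg), smul_eq_mul]
  have h2 : F = fun w => Real.exp (-g ^ 2 / 2) * (Real.exp (w - w ^ 2 / (2 * g ^ 2)) * G w) := by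
    ext w
    simp only [hF]
    rw [← mul_assoc, ← Real.exp_add]
    congr 2
    field_simp
    ring
  rw [h2, integral_const_mul]
  ring

theorem psi_formula (g : ℝ) (hg : 0 < g) :
    stdGaussTail g = (Real.sqrt (2 * Real.pi))⁻¹ * (Real.exp (-g ^ 2 / 2) * g⁻¹ *
      ∫ w, Real.exp (w - w ^ 2 / (2 * g ^ 2)) * (Set.Iio (0 : ℝ)).indicator 1 w) := by
  rw [← subst_lemma _ g hg, stdGaussTail, ← integral_indicator measurableSet_Ioi]
  congr 2
  ext x
  have : g ^ 2 - g * x < 0 ↔ g < x := by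
    constructor <;> intro h <;> nlinarith
  by_cases hx : g < x
  · simp [Set.indicator, hx, this.2 hx]
  · simp only [Set.indicator, Set.mem_Ioi, Set.mem_Iio, hx, this]; simp

theorem J_tendsto : Tendsto (fun g : ℝ => ∫ w, Real.exp (w - w ^ 2 / (2 * g ^ 2)) *
    (Set.Iio (0 : ℝ)).indicator 1 w) atTop (𝓝 1) := by
  have hlim : ∫ w, Real.exp w * (Set.Iio (0 : ℝ)).indicator 1 w = 1 := by
    have : ∀ w : ℝ, Real.exp w * (Set.Iio (0 : ℝ)).indicator 1 w = (Set.Iio (0 : ℝ)).indicator Real.exp w := by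
      intro w; by_cases h : w < 0 <;> simp [Set.indicator, h]
    simp_rw [this]
    rw [integral_indicator measurableSet_Iio, Measure.restrict_congr_set Iio_ae_eq_Iic, integral_exp_Iic]
    simp
  have hlim' : 𝓝 (1 : ℝ) = 𝓝 (∫ w, Real.exp w * (Set.Iio (0 : ℝ)).indicator 1 w) := by rw [hlim]
  rw [hlim']
  have hind : Measurable ((Set.Iio (0 : ℝ)).indicator (1 : ℝ → ℝ)) := measurable_one.indicator measurableSet_Iio
  refine tendsto_integral_filter_of_dominated_convergence (fun w => Real.exp (-|w|)) ?_ ?_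
    integrable_exp_neg_abs_aux ?_
  · refine Eventually.of_forall fun g => ?_
    exact ((by fun_prop : Measurable fun w : ℝ => Real.exp (w - w ^ 2 / (2 * g ^ 2))).mul hind).aestronglyMeasurable
  · refine Eventually.of_forall fun g => ae_of_all _ fun w => ?_
    by_cases h : w < 0
    · simp only [Set.indicator, Set.mem_Iio, h, if_true, Pi.one_apply, mul_one]
      rw [Real.norm_of_nonneg (by positivity), abs_of_neg h, neg_neg]
      refine Real.exp_le_exp.2 ?_
      have : 0 ≤ w ^ 2 / (2 * g ^ 2) := by positivity
      linarith
    · simp [Set.indicator, h]; positivity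
  · refine ae_of_all _ fun w => Tendsto.mul_const _ ((Real.continuous_exp.tendsto w).comp ?_)
    have : Tendsto (fun g : ℝ => w - w ^ 2 / (2 * g ^ 2)) atTop (𝓝 (w - 0)) := by
      refine tendsto_const_nhds.sub (tendsto_const_nhds.div_atTop ?_)
      exact (tendsto_pow_atTop two_ne_zero).const_mul_atTop two_pos
    rwa [sub_zero] at this

variable {T : Type*} [TopologicalSpace T] [CompactSpace T]
  [MeasurableSpace C(T, ℝ)] [BorelSpace C(T, ℝ)] [SecondCountableTopology C(T, ℝ)]

theorem continuous_divByOneAdd (h : C(T, ℝ)) (hpos : ∀ t, 0 < 1 + h t) (k : C(T, ℝ))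
    (hk : ∀ t, k t = (1 + h t)⁻¹) : divByOneAdd h hpos = fun f => k * f := by
  ext f t
  simp [divByOneAdd, hk, div_eq_inv_mul]

theorem xi_formula {μ : Measure C(T, ℝ)} (hμ : IsCenteredGaussian μ) (o : T)
    (ho : ∫ f, (f o) ^ 2 ∂μ = 1) (g : ℝ) (hg : 0 < g) (h : C(T, ℝ)) (hpos : ∀ t, 0 < 1 + h t)
    (k : C(T, ℝ)) (hk : ∀ t, k t = (1 + h t)⁻¹)
    (Γ : C(T, ℝ) → ℝ) (hΓ : Continuous Γ)
    (hF2 : ∀ a : ℝ, 0 < a → ∀ (b : ℝ) (f : C(T, ℝ)),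
      Γ (a • f + ContinuousMap.const T b) = a * Γ f + b) :
    ((μ.map (divByOneAdd h hpos)) {f | g < Γ f}).toReal =
      (Real.sqrt (2 * Real.pi))⁻¹ * (Real.exp (-g ^ 2 / 2) * g⁻¹ *
      ∫ w, Real.exp (w - w ^ 2 / (2 * g ^ 2)) *
        tailF Γ (μ.map (g • resProj μ (evd o))) (g ^ 2 • (1 - regVec μ (evd o)) + g ^ 2 • h) k
          (regVec μ (evd o)) w) := by
  have := hμ.1
  set δ : StrongDual ℝ C(T, ℝ) := evd o
  set r := regVec μ δ with hr
  set P := resProj μ δ with hP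
  have hPm : Measurable P := P.continuous.measurable
  have hgPm : Measurable (g • P) := (g • P).continuous.measurable
  have : IsProbabilityMeasure (μ.map P) := Measure.isProbabilityMeasure_map hPm.aemeasurable
  rw [← subst_lemma _ g hg, continuous_divByOneAdd h hpos k hk]
  have hopen : IsOpen {f | g < Γ f} := isOpen_lt continuous_const hΓ
  have hopen1 : IsOpen {f | g < Γ (k * f)} := isOpen_lt continuous_const (by fun_prop)
  have hopen2 : IsOpen {p : ℝ × C(T, ℝ) | g < Γ (k * (p.1 • r + p.2))} := isOpen_lt continuous_const (by fun_prop)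
  rw [Measure.map_apply (by fun_prop) hopen.measurableSet]
  have hdec := gauss_decomp hμ δ (by simpa [δ] using ho)
  have e1 : μ ((fun f => k * f) ⁻¹' {f | g < Γ f}) =
      ((gaussianReal 0 1).prod (μ.map P)) {p : ℝ × C(T, ℝ) | g < Γ (k * (p.1 • r + p.2))} := by
    conv_lhs => rw [hdec]
    rw [Measure.map_apply (by fun_prop) 
      (show MeasurableSet ((fun f => k * f) ⁻¹' {f | g < Γ f}) from hopen1.measurableSet)]
    rfl
  rw [e1, Measure.prod_apply hopen2.measurableSet, ← integral_toReal
    (measurable_measure_prodMk_left hopen2.measurableSet).aemeasurable (ae_of_all _ fun x => by finiteness),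
    integral_gaussianReal_eq_integral_smul one_ne_zero, ← integral_const_mul]
  congr 1
  ext x
  have e2 : (μ.map P (Prod.mk x ⁻¹' {p : ℝ × C(T, ℝ) | g < Γ (k * (p.1 • r + p.2))})).toReal =
      tailF Γ (μ.map (g • P)) (g ^ 2 • (1 - r) + g ^ 2 • h) k r (g ^ 2 - g * x) := by
    rw [tailF, Measure.real]
    congr 1
    rw [Measure.map_apply hPm (by exact measurable_prodMk_left hopen2.measurableSet),
      Measure.map_apply hgPm (isOpen_lt continuous_const (by fun_prop)).measurableSet]
    congr 1
    ext f
    simp only [Set.mem_preimage, Set.mem_ofPred_eq]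
    have e3 : k * ((g • P) f - (g ^ 2 • (1 - r) + g ^ 2 • h + (g ^ 2 - g * x) • r)) =
        g • (k * (x • r + P f)) + ContinuousMap.const T (- g ^ 2) := by
      ext t
      have := (hpos t).ne'
      simp [hk]
      field_simp
      ring
    rw [e3, hF2 g hg]
    constructor <;> intro h <;> nlinarith
  rw [e2, gaussianPDFReal, smul_eq_mul, ← mul_assoc]
  simp

end Exact

/-- **Uniform tail approximation for homogeneous functionals of threshold-dependent
Gaussian fields** (Theorem 2.1 of Dębicki–Hashorva–Liu). Under the conditions C0–C3
(in the equivalent form of Remark 2.2 ii)), for a continuous functional `Γ` satisfying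
F1–F2, the tail probabilities `ξ_i(Γ > g_i)` are uniformly asymptotic to
`H · Ψ(g_i)`, where `H = ∫ exp(Γ(√2 f − v − h)) dν(f)`. -/
theorem uniform_tail_approximation_gaussian_functionals
    {d : ℕ} {ι : Type*} (l : Filter ι)
    (E : Set (EuclideanSpace ℝ (Fin d))) (hEc : IsCompact E)
    (hE0 : (0 : EuclideanSpace ℝ (Fin d)) ∈ E)
    [MeasurableSpace C(↥E, ℝ)] [BorelSpace C(↥E, ℝ)] [SecondCountableTopology C(↥E, ℝ)]
    -- the thresholds
    (g : ι → ℝ) (hgpos : ∀ i, 0 < g i)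
    -- the trend functions `h_i` with `1 + h_i > 0`
    (trend : ι → C(↥E, ℝ)) (htrend : ∀ i t, 0 < 1 + trend i t)
    -- the centered Gaussian laws of the unit-variance fields `Z_{u,τ_u}`
    (μ : ι → Measure C(↥E, ℝ)) (hμG : ∀ i, IsCenteredGaussian (μ i))
    (hμvar : ∀ i (t : ↥E), ∫ f, (f t) ^ 2 ∂(μ i) = 1)
    -- the laws `ξ_i` of the fields `ξ_{u,τ_u} = Z_{u,τ_u}/(1 + h_{u,τ_u})`
    (ξ : ι → Measure C(↥E, ℝ))
    (hξ : ∀ i, ξ i = (μ i).map (divByOneAdd (trend i) (htrend i)))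
    -- the functional `Γ` and conditions F1, F2
    (Γ : C(↥E, ℝ) → ℝ) (hΓcont : Continuous Γ)
    (c : ℝ) (hc : 0 < c)
    (hF1 : ∀ f : C(↥E, ℝ), Γ f ≤ c * ⨆ t, f t)
    (hF2 : ∀ a : ℝ, 0 < a → ∀ (b : ℝ) (f : C(↥E, ℝ)),
      Γ (a • f + ContinuousMap.const ↥E b) = a * Γ f + b)
    -- condition C0
    (hC0 : Tendsto g l atTop)
    -- condition C1
    (h : C(↥E, ℝ)) (hh0 : h ⟨0, hE0⟩ = 0)
    (hC1 : Tendsto (fun i => ⨆ t, |(g i) ^ 2 * trend i t - h t|) l (𝓝 0))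
    -- conditions C2 and C3 (in the equivalent form of Remark 2.2 ii)):
    -- the limiting centered Gaussian law `ν` of the field `η`, vanishing at the origin
    (ν : Measure C(↥E, ℝ)) (hνG : IsCenteredGaussian ν)
    (hν0 : ∀ᵐ f ∂ν, f ⟨0, hE0⟩ = 0)
    (hC2 : ∀ s t : ↥E,
      Tendsto (fun i => (g i) ^ 2 * ∫ f, (f t - f s) ^ 2 ∂(μ i)) l
        (𝓝 (2 * ∫ f, (f t - f s) ^ 2 ∂ν)))
    (hC2' : Tendsto
      (fun i => ⨆ t, |(g i) ^ 2 * (∫ f, (f t - f ⟨0, hE0⟩) ^ 2 ∂(μ i)) -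
        2 * ∫ f, (f t) ^ 2 ∂ν|) l (𝓝 0))
    (hC3 : ∃ a > (0 : ℝ), ∃ C : ℝ, ∀ᶠ i in l, ∀ s t : ↥E, s ≠ t →
      (g i) ^ 2 * ∫ f, (f t - f s) ^ 2 ∂(μ i) ≤
        C * ∑ j, |(t : EuclideanSpace ℝ (Fin d)) j - (s : EuclideanSpace ℝ (Fin d)) j| ^ a)
    -- nondegeneracy of the tail probabilities
    (hndeg : ∀ᶠ i in l, 0 < ξ i {f | g i < Γ f})
    -- the variance function `v(t) = ∫ f(t)² dν(f)` of `η` (a continuous function)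
    (v : C(↥E, ℝ)) (hv : ∀ t, v t = ∫ f, (f t) ^ 2 ∂ν) :
    Tendsto (fun i => (ξ i {f | g i < Γ f}).toReal / stdGaussTail (g i)) l
      (𝓝 (∫ f, Real.exp (Γ (Real.sqrt 2 • f - v - h)) ∂ν)) := by
  have : CompactSpace ↥E := isCompact_iff_compactSpace.1 hEc
  set o : ↥E := ⟨0, hE0⟩ with ho
  have : Nonempty ↥E := ⟨o⟩
  have hPμ : ∀ i, IsProbabilityMeasure (μ i) := fun i => (hμG i).1
  have hPν : IsProbabilityMeasure ν := hνG.1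
  let k : ι → C(↥E, ℝ) := fun i => ⟨fun t => (1 + trend i t)⁻¹,
    (continuous_const.add (trend i).continuous).inv₀ fun t => (htrend i t).ne'⟩
  have hk : ∀ i t, k i t = (1 + trend i t)⁻¹ := fun i t => rfl
  set r : ι → C(↥E, ℝ) := fun i => regVec (μ i) (evd o) with hr
  have hrt : ∀ i t, r i t = ∫ f, f o * f t ∂(μ i) := fun i t => by
    have := regVec_apply (hμG i) (evd o) (evd t)
    simpa using this
  have hro : ∀ i, r i o = 1 := fun i => by
    rw [hrt, ← hμvar i o]; congr 1; ext f; ring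
  have hrD : ∀ i t, 2 * (1 - r i t) = ∫ f, (f t - f o) ^ 2 ∂(μ i) := by
    intro i t
    have h1 : ∀ f : C(↥E, ℝ), (f t - f o) ^ 2 = (f t) ^ 2 + (f o) ^ 2 - 2 * (f o * f t) := fun f => by ring
    have i1 : ∀ t : ↥E, Integrable (fun f : C(↥E, ℝ) => (f t) ^ 2) (μ i) := fun t => by
      simpa using cg_sq_integrable (hμG i) (evd t)
    have i2 : Integrable (fun f : C(↥E, ℝ) => f o * f t) (μ i) := by
      simpa using cg_mul_integrable (hμG i) (evd o) (evd t)
    have i3 : Integrable (fun f : C(↥E, ℝ) => (f t) ^ 2 + (f o) ^ 2) (μ i) := (i1 t).add (i1 o)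
    simp_rw [h1]
    rw [integral_sub i3 (i2.const_mul 2), integral_add (i1 t) (i1 o), integral_const_mul,
      hμvar, hμvar, hrt]
    ring
  have hg2 : Tendsto (fun i => ((g i) ^ 2)⁻¹) l (𝓝 0) :=
    tendsto_inv_atTop_zero.comp ((tendsto_pow_atTop two_ne_zero).comp hC0)
  have hgne : ∀ i, (g i) ^ 2 ≠ 0 := fun i => (pow_pos (hgpos i) 2).ne'
  -- convergence of the trends
  have hT : Tendsto (fun i => (g i) ^ 2 • trend i) l (𝓝 h) := by
    rw [tendsto_iff_norm_sub_tendsto_zero]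
    refine hC1.congr fun i => ?_
    rw [ContinuousMap.norm_eq_iSup_norm]
    simp [Real.norm_eq_abs]
  have hR : Tendsto (fun i => (g i) ^ 2 • (1 - r i)) l (𝓝 v) := by
    have h1 : Tendsto (fun i => (g i) ^ 2 • ((2 : ℝ) • (1 - r i))) l (𝓝 ((2 : ℝ) • v)) := by
      rw [tendsto_iff_norm_sub_tendsto_zero]
      refine hC2'.congr fun i => ?_
      rw [ContinuousMap.norm_eq_iSup_norm]
      refine iSup_congr fun t => ?_
      rw [Real.norm_eq_abs, ← hrD, ← hv]
      simp
    have h2 := h1.const_smul ((2 : ℝ)⁻¹)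
    rw [smul_smul, inv_mul_cancel₀ two_ne_zero, one_smul] at h2
    refine h2.congr fun i => ?_
    rw [smul_comm ((g i) ^ 2), smul_smul, inv_mul_cancel₀ two_ne_zero, one_smul]
  have hT0 : Tendsto trend l (𝓝 0) := by
    have := hg2.smul hT
    rw [zero_smul] at this
    refine this.congr fun i => ?_
    rw [smul_smul, inv_mul_cancel₀ (hgne i), one_smul]
  have hR0 : Tendsto r l (𝓝 1) := by
    have := hg2.smul hR
    rw [zero_smul] at this
    have h2 := (tendsto_const_nhds (x := (1 : C(↥E, ℝ)))).sub this
    rw [sub_zero] at h2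
    refine h2.congr fun i => ?_
    rw [smul_smul, inv_mul_cancel₀ (hgne i), one_smul, sub_sub_cancel]
  have hk1 : Tendsto k l (𝓝 1) := by
    have h1 : Tendsto (fun i => 1 + trend i) l (𝓝 ((1 : C(↥E, ℝ)ˣ) : C(↥E, ℝ))) := by
      have := (tendsto_const_nhds (x := (1 : C(↥E, ℝ)))).add hT0
      simpa using this
    have h2 := (NormedRing.inverse_continuousAt (1 : C(↥E, ℝ)ˣ)).tendsto.comp h1
    rw [Ring.inverse_unit, inv_one, Units.val_one] at h2
    refine h2.congr fun i => ?_
    let u : C(↥E, ℝ)ˣ := ⟨1 + trend i, k i, by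
      ext t; simp [hk, (htrend i t).ne'], by ext t; simp [hk, (htrend i t).ne']⟩
    exact Ring.inverse_unit u
  -- the conditioned, rescaled laws
  have hcg : ∀ i, IsCenteredGaussian ((μ i).map (g i • resProj (μ i) (evd o))) := fun i =>
    cg_map (hμG i) _
  have hcg' : IsCenteredGaussian (ν.map (Real.sqrt 2 • ContinuousLinearMap.id ℝ C(↥E, ℝ))) :=
    cg_map hνG _
  let ρ : ι → ProbabilityMeasure C(↥E, ℝ) := fun i => ⟨_, (hcg i).1⟩
  let ρ' : ProbabilityMeasure C(↥E, ℝ) := ⟨_, hcg'.1⟩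
  have hρ0 : ∀ i, ∀ᵐ f ∂(ρ i : Measure C(↥E, ℝ)), f o = 0 := by
    intro i
    change ∀ᵐ f ∂((μ i).map (g i • resProj (μ i) (evd o))), f o = 0
    rw [ae_map_iff (ContinuousLinearMap.continuous _).measurable.aemeasurable
      (isClosed_eq (by fun_prop) continuous_const).measurableSet]
    refine ae_of_all _ fun f => ?_
    have := hro i
    simp only [hr] at this
    simp [resProj_apply, this]
  have hρ0' : ∀ᵐ f ∂(ρ' : Measure C(↥E, ℝ)), f o = 0 := by
    change ∀ᵐ f ∂(ν.map (Real.sqrt 2 • ContinuousLinearMap.id ℝ C(↥E, ℝ))), f o = 0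
    rw [ae_map_iff (ContinuousLinearMap.continuous _).measurable.aemeasurable
      (isClosed_eq (by fun_prop) continuous_const).measurableSet]
    filter_upwards [hν0] with f hf
    simp [hf]
  have hvar : ∀ i s t, ∫ f, (f t - f s) ^ 2 ∂(ρ i : Measure C(↥E, ℝ)) =
      (g i) ^ 2 * (∫ f, (f t - f s) ^ 2 ∂(μ i)) - (g i) ^ 2 * (r i t - r i s) ^ 2 := by
    intro i s t
    change ∫ f, (f t - f s) ^ 2 ∂((μ i).map (g i • resProj (μ i) (evd o))) = _
    rw [integral_map (ContinuousLinearMap.continuous _).measurable.aemeasurable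
      (Continuous.aestronglyMeasurable (by fun_prop))]
    have h1 := resProj_var (hμG i) (evd o) (evd t - evd s) (by simpa using hμvar i o)
    have h2 : ∀ f : C(↥E, ℝ), (((g i • resProj (μ i) (evd o)) f) t - ((g i • resProj (μ i) (evd o)) f) s) ^ 2
        = (g i) ^ 2 * ((evd t - evd s : StrongDual ℝ C(↥E, ℝ)) (resProj (μ i) (evd o) f)) ^ 2 := by
      intro f; simp; ring
    simp_rw [h2]
    rw [integral_const_mul, h1]
    simp only [_root_.sub_apply, evd_apply]
    ring
  have hvar' : ∀ s t, ∫ f, (f t - f s) ^ 2 ∂(ρ' : Measure C(↥E, ℝ)) = 2 * ∫ f, (f t - f s) ^ 2 ∂ν := by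
    intro s t
    change ∫ f, (f t - f s) ^ 2 ∂(ν.map (Real.sqrt 2 • ContinuousLinearMap.id ℝ C(↥E, ℝ))) = _
    rw [integral_map (ContinuousLinearMap.continuous _).measurable.aemeasurable
      (Continuous.aestronglyMeasurable (by fun_prop)), ← integral_const_mul]
    congr 1
    ext f
    have : Real.sqrt 2 ^ 2 = 2 := Real.sq_sqrt (by norm_num)
    simp only [_root_.smul_apply, ContinuousLinearMap.id_apply, ContinuousMap.smul_apply, smul_eq_mul]
    rw [← mul_sub, mul_pow, this]
  have hD : ∀ s t, Tendsto (fun i => ∫ f, (f t - f s) ^ 2 ∂(ρ i : Measure C(↥E, ℝ))) l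
      (𝓝 (∫ f, (f t - f s) ^ 2 ∂(ρ' : Measure C(↥E, ℝ)))) := by
    intro s t
    have hev : ∀ (t : ↥E) (b : ι → C(↥E, ℝ)) (b' : C(↥E, ℝ)), Tendsto b l (𝓝 b') →
        Tendsto (fun i => b i t) l (𝓝 (b' t)) := fun t b b' hb =>
      ((evd t).continuous.tendsto b').comp hb
    have h1 := ((hev s _ _ hR).sub (hev t _ _ hR)).mul ((hev t _ _ hR0).sub (hev s _ _ hR0))
    have h2 := (hC2 s t).sub h1
    rw [hvar']
    refine (h2.congr fun i => ?_).trans_eq ?_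
    · rw [hvar]; simp; ring
    · simp
  -- tightness
  obtain ⟨a, ha, C, hC⟩ := hC3
  set G : Set ι := {i | ∀ s t : ↥E, s ≠ t →
      (g i) ^ 2 * ∫ f, (f t - f s) ^ 2 ∂(μ i) ≤
        C * ∑ j, |(t : EuclideanSpace ℝ (Fin d)) j - (s : EuclideanSpace ℝ (Fin d)) j| ^ a} with hG
  obtain ⟨R, hR1, hRE⟩ : ∃ R : ℝ, 0 < R ∧ ∀ x ∈ E, ‖x‖ ≤ R := by
    obtain ⟨R, hR⟩ := hEc.isBounded.exists_norm_le
    exact ⟨max R 1, by positivity, fun x hx => (hR x hx).trans (le_max_left _ _)⟩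
  have hc0 : (2 * R)⁻¹ ≠ 0 := by positivity
  let y : ↥E → (Fin d → ℝ) := fun t => (2 * R)⁻¹ • ((EuclideanSpace.equiv (Fin d) ℝ) (t : EuclideanSpace ℝ (Fin d)))
  have hyI : IsInducing y :=
    (Homeomorph.smulOfNeZero ((2 * R)⁻¹) hc0).isInducing.comp
      ((EuclideanSpace.equiv (Fin d) ℝ).toHomeomorph.isInducing.comp IsInducing.subtypeVal)
  have hyv : ∀ t j, y t j = (2 * R)⁻¹ * (t : EuclideanSpace ℝ (Fin d)) j := fun t j => rfl
  have hyb : ∀ t j, |y t j| ≤ 1 / 2 := by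
    intro t j
    have h1 : |(t : EuclideanSpace ℝ (Fin d)) j| ≤ R := by
      have := PiLp.norm_apply_le (t : EuclideanSpace ℝ (Fin d)) j
      rw [Real.norm_eq_abs] at this
      exact this.trans (hRE _ t.2)
    rw [hyv, abs_mul, abs_of_pos (by positivity)]
    calc _ ≤ (2 * R)⁻¹ * R := by gcongr
      _ = 1 / 2 := by field_simp
  have htight : IsTightMeasureSet ((fun i => (ρ i : Measure C(↥E, ℝ))) '' G) := by
    refine tight_of_holder y hyI hyb o _ ?_ ?_ (|C| * (d * (2 * R) ^ a) + 1) a (by positivity) ha ?_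
    · rintro _ ⟨i, -, rfl⟩; exact hcg i
    · rintro _ ⟨i, -, rfl⟩; exact hρ0 i
    · rintro _ ⟨i, hi, rfl⟩ η hη s t hst
      rcases eq_or_ne s t with rfl | hne
      · simp; positivity
      · rw [hvar]
        have h1 := hi s t hne
        have h2 : 0 ≤ (g i) ^ 2 * (r i t - r i s) ^ 2 := by positivity
        have h3 : ∑ j, |(t : EuclideanSpace ℝ (Fin d)) j - (s : EuclideanSpace ℝ (Fin d)) j| ^ a ≤
            d * (2 * R) ^ a * η ^ a := by
          calc _ ≤ ∑ j : Fin d, ((2 * R) * η) ^ a := by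
                refine Finset.sum_le_sum fun j _ => ?_
                refine Real.rpow_le_rpow (abs_nonneg _) ?_ ha.le
                have h4 := (dist_le_pi_dist (y s) (y t) j).trans hst
                rw [Real.dist_eq, hyv, hyv, ← mul_sub, abs_mul, abs_of_pos (by positivity : 0 < (2 * R)⁻¹),
                  inv_mul_le_iff₀ (by positivity), abs_sub_comm] at h4
                exact h4
            _ = _ := by
              rw [Finset.sum_const, Finset.card_univ, Fintype.card_fin, nsmul_eq_mul,
                Real.mul_rpow (by positivity) hη.le, mul_assoc]
        have h5 : 0 ≤ ∑ j, |(t : EuclideanSpace ℝ (Fin d)) j - (s : EuclideanSpace ℝ (Fin d)) j| ^ a :=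
          Finset.sum_nonneg fun j _ => by positivity
        have h6 : C * ∑ j, |(t : EuclideanSpace ℝ (Fin d)) j - (s : EuclideanSpace ℝ (Fin d)) j| ^ a ≤
            |C| * (d * (2 * R) ^ a * η ^ a) :=
          (mul_le_mul_of_nonneg_right (le_abs_self C) h5).trans (mul_le_mul_of_nonneg_left h3 (abs_nonneg C))
        have h7 : 0 ≤ η ^ a := by positivity
        have h8 : (|C| * (d * (2 * R) ^ a) + 1) * η ^ a = |C| * (d * (2 * R) ^ a * η ^ a) + η ^ a := by ring
        rw [h8]
        linarith
  have htight2 : IsTightMeasureSet (((fun i => (ρ i : Measure C(↥E, ℝ))) '' G) ∪ {(ρ' : Measure C(↥E, ℝ))}) :=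
    htight.union isTightMeasureSet_singleton
  -- weak convergence
  have hw : Tendsto ρ l (𝓝 ρ') := by
    classical
    let σ : ι → ProbabilityMeasure C(↥E, ℝ) := fun i => if i ∈ G then ρ i else ρ'
    have hσ : ∀ᶠ i in l, σ i = ρ i := by
      filter_upwards [hC] with i hi
      exact if_pos hi
    have := weak_conv (l := l) o σ ρ' ?_ hcg' ?_ hρ0' ?_ ?_
    · exact this.congr' hσ
    · intro i
      by_cases hi : i ∈ G
      · simp only [σ, hi, if_true]; exact hcg i
      · simp only [σ, hi, if_false]; exact hcg'
    · intro i
      by_cases hi : i ∈ G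
      · simp only [σ, hi, if_true]; exact hρ0 i
      · simp only [σ, hi, if_false]; exact hρ0'
    · refine htight2.subset ?_
      rintro _ ⟨i, rfl⟩
      by_cases hi : i ∈ G
      · left; exact ⟨i, hi, by simp only [σ, hi, if_true]⟩
      · right; simp only [σ, hi, if_false]; rfl
    · intro s t
      refine (hD s t).congr' ?_
      filter_upwards [hσ] with i hi
      rw [hi]
  -- uniform exponential moments
  obtain ⟨M, hM, hρM⟩ : ∃ M : ENNReal, M < ⊤ ∧ ∀ᶠ i in l,
      ∫⁻ f, ENNReal.ofReal (Real.exp (4 * ‖f‖)) ∂(ρ i : Measure C(↥E, ℝ)) ≤ M := by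
    obtain ⟨Kc, hKc, hK⟩ := isTightMeasureSet_iff_exists_isCompact_measure_compl_le.1 htight (1 / 4) (by simp)
    obtain ⟨B, hB⟩ := hKc.isBounded.exists_norm_le
    obtain ⟨M, hM, hMM⟩ := fernique_unif (X := C(↥E, ℝ)) (max B 1) (by positivity)
    refine ⟨M, hM, ?_⟩
    filter_upwards [hC] with i hi
    refine hMM _ (hcg i) ?_
    have h1 := hK _ ⟨i, hi, rfl⟩
    have h2 : (ρ i : Measure C(↥E, ℝ)) Kc ≤ (ρ i : Measure C(↥E, ℝ)) {f | ‖f‖ ≤ max B 1} :=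
      measure_mono fun f hf => (hB f hf).trans (le_max_left _ _)
    have h3 := prob_add_prob_compl (μ := (ρ i : Measure C(↥E, ℝ))) hKc.measurableSet
    refine le_trans ?_ h2
    have h4 : (1 : ENNReal) ≤ (ρ i : Measure C(↥E, ℝ)) Kc + 1 / 4 :=
      h3.symm.le.trans (add_le_add le_rfl h1)
    have h5 : (3 / 4 : ENNReal) + 1 / 4 = 1 := by
      rw [← ENNReal.add_div]; norm_num
      exact ENNReal.div_self (by norm_num) (by norm_num)
    exact (ENNReal.add_le_add_iff_right (a := 1 / 4) (by norm_num)).1 (h5.le.trans h4)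
  have hpos : ∀ f, 0 < Γ f → ∃ t, 0 < f t := by
    intro f hf
    by_contra hcon
    push Not at hcon
    have h1 : ⨆ t, f t ≤ 0 := ciSup_le hcon
    have := hF1 f
    nlinarith
  have hΓb : ∀ (b : ℝ) f, Γ (f + ContinuousMap.const ↥E b) = Γ f + b := by
    intro b f
    have := hF2 1 one_pos b f
    rwa [one_smul, one_mul] at this
  have key := laplace_gen (l := l) g hC0 ρ ρ' hw (fun i => (g i) ^ 2 • (1 - r i) + (g i) ^ 2 • trend i) k r
    (v + h) (hR.add hT) hk1 hR0 M hM hρM Γ hΓcont hpos hΓb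
  have hlim : ∫ f, Real.exp (Γ (f - (v + h))) ∂(ρ' : Measure C(↥E, ℝ)) =
      ∫ f, Real.exp (Γ (Real.sqrt 2 • f - v - h)) ∂ν := by
    change ∫ f, Real.exp (Γ (f - (v + h))) ∂(ν.map (Real.sqrt 2 • ContinuousLinearMap.id ℝ C(↥E, ℝ))) = _
    rw [integral_map (ContinuousLinearMap.continuous _).measurable.aemeasurable
      (Continuous.aestronglyMeasurable (by fun_prop))]
    simp only [sub_sub]
    rfl
  rw [hlim] at key
  have hq := key.div (J_tendsto.comp hC0) one_ne_zero
  rw [div_one] at hq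
  refine hq.congr fun i => ?_
  rw [hξ i, xi_formula (hμG i) o (hμvar i o) (g i) (hgpos i) (trend i) (htrend i) (k i) (hk i) Γ hΓcont hF2,
    psi_formula (g i) (hgpos i), mul_div_mul_left _ _ (by positivity), mul_div_mul_left]
  · rfl
  · have := hgpos i
    positivity
end

section
/- Uniform tail approximation under conditions D1–D3 (Theorem 2.5). Let E ⊆ ℝ^d be a compact set containing the origin, and let ι be an index type equipped with a filter l. For each i ∈ ι let g_i > 0 and let ξ_i be a centered Gaussian measure on the separable Banach space C(E,ℝ), with variance function σ_i²(t) = ∫ (f(t))² dξ_i(f) satisfying σ_i(0) = 1. Let Γ : C(E,ℝ) → ℝ be continuous with Γ(f) ≤ c·sup_{t∈E} f(t) for some c > 0 and Γ(a f + b) = a Γ(f) + b for all a > 0, b ∈ ℝ. Assume: (D1) g_i → ∞ along l and there is h ∈ C(E,ℝ) with h(0) = 0 such that sup_{t∈E} |g_i²(1 − σ_i(t)) − h(t)| → 0 along l; (D2) there is a centered Gaussian measure ν on C(E,ℝ) whose evaluation at 0 vanishes ν-a.s. such that for all s,t ∈ E, g_i² ∫(f(t)−f(s))² dξ_i(f)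 → 2∫(f(t)−f(s))² dν(f) along l, and sup_{t∈E} |g_i² ∫(f(t)−f(0))² dξ_i(f) − 2∫(f(t))² dν(f)| → 0 along l; (D3) there exist G, κ > 0 such that eventually along l, g_i² ∫(f(t)−f(s))² dξ_i(f) ≤ G‖t−s‖^κ for all s,t ∈ E; and eventually along l, ξ_i({f : Γ(f) > g_i}) > 0. Then, along l, ξ_i({f : Γ(f) > g_i}) / Ψ(g_i) converges to H := ∫ exp(Γ(t ↦ √2 f(t) − v(t) − h(t))) dν(f), where v(t) = ∫ (f(t))² dν(f). -/
open MeasureTheory Filter Topology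
open scoped NNReal

section UTbasic
open ProbabilityTheory
variable {X : Type*} [NormedAddCommGroup X] [NormedSpace ℝ X] [MeasurableSpace X] [BorelSpace X]
  {Y : Type*} [NormedAddCommGroup Y] [NormedSpace ℝ Y] [MeasurableSpace Y] [BorelSpace Y]
  {μ : Measure X}

lemma ut_isGaussian (hμ : IsCenteredGaussian μ) : IsGaussian μ :=
  isGaussian_of_map_eq_gaussianReal fun L => ⟨0, hμ.2 L⟩

lemma ut_mean (hμ : IsCenteredGaussian μ) (L : X →L[ℝ] ℝ) : ∫ f, L f ∂μ = 0 := by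
  obtain ⟨v, hv⟩ := hμ.2 L
  have h1 : ∫ x, x ∂(μ.map L) = ∫ f, L f ∂μ :=
    integral_map (by fun_prop) (by fun_prop)
  rw [← h1, hv, integral_id_gaussianReal]

lemma ut_map (hμ : IsCenteredGaussian μ) (L : X →L[ℝ] Y) : IsCenteredGaussian (μ.map L) := by
  have := hμ.1
  refine ⟨Measure.isProbabilityMeasure_map (by fun_prop), fun L' => ?_⟩
  obtain ⟨v, hv⟩ := hμ.2 (L' ∘L L)
  refine ⟨v, ?_⟩
  rw [← hv, Measure.map_map (by fun_prop) (by fun_prop)]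
  rfl

lemma ut_memLp (hμ : IsCenteredGaussian μ) (L : X →L[ℝ] ℝ) : MemLp L 2 μ := by
  have := ut_isGaussian hμ
  exact IsGaussian.memLp_dual μ L 2 (by simp)

lemma ut_int_sq (hμ : IsCenteredGaussian μ) (L : X →L[ℝ] ℝ) : Integrable (fun f => (L f) ^ 2) μ :=
  (ut_memLp hμ L).integrable_sq

lemma ut_int_mul (hμ : IsCenteredGaussian μ) (L L' : X →L[ℝ] ℝ) :
    Integrable (fun f => L f * L' f) μ :=
  (ut_memLp hμ L).integrable_mul (ut_memLp hμ L')

lemma ut_var (hμ : IsCenteredGaussian μ) (L : X →L[ℝ] ℝ) :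
    Var[L; μ] = ∫ f, (L f) ^ 2 ∂μ := by
  rw [variance_of_integral_eq_zero (by fun_prop) (ut_mean hμ L)]

lemma ut_map_eq (hμ : IsCenteredGaussian μ) (L : X →L[ℝ] ℝ) :
    μ.map L = gaussianReal 0 (∫ f, (L f) ^ 2 ∂μ).toNNReal := by
  have := ut_isGaussian hμ
  rw [IsGaussian.map_eq_gaussianReal L, ut_mean hμ L, ut_var hμ L]

/-- even moments -/
lemma ut_moment (q : ℕ) : ∃ C : ℝ≥0, ∀ v : ℝ≥0,
    ∫⁻ x, ‖x‖ₑ ^ (2 * q) ∂(gaussianReal 0 v) = C * (v : ENNReal) ^ q := by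
  have hfin : ∫⁻ x, ‖x‖ₑ ^ (2 * q) ∂(gaussianReal 0 1) < ⊤ := by
    have h1 := (memLp_id_gaussianReal (μ := 0) (v := 1) ((2 * q : ℕ) : ℝ≥0))
    rcases Nat.eq_zero_or_pos q with rfl | hq
    · simp
    · have := lintegral_rpow_enorm_lt_top_of_eLpNorm_lt_top (by simp; omega) (by finiteness) h1.2
      simpa [← ENNReal.rpow_natCast] using this
  refine ⟨(∫⁻ x, ‖x‖ₑ ^ (2 * q) ∂(gaussianReal 0 1)).toNNReal, fun v => ?_⟩
  rw [ENNReal.coe_toNNReal hfin.ne]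
  have hv : gaussianReal 0 v = (gaussianReal 0 1).map (fun x => (NNReal.sqrt v : ℝ) * x) := by
    rw [gaussianReal_map_const_mul]
    congr 1
    · simp
    · ext; simp [Real.sq_sqrt]
  rw [hv, lintegral_map (by fun_prop) (by fun_prop)]
  simp_rw [enorm_mul, mul_pow]
  rw [lintegral_const_mul _ (by fun_prop), mul_comm]
  congr 1
  have : ‖(NNReal.sqrt v : ℝ)‖ₑ = (NNReal.sqrt v : ENNReal) := by
    have h0 : (0 : ℝ) ≤ (NNReal.sqrt v : ℝ) := NNReal.coe_nonneg _
    rw [Real.enorm_of_nonneg h0, ENNReal.ofReal_coe_nnreal]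
  rw [this, pow_mul, ← ENNReal.coe_pow]
  simp

lemma ut_moment_le (q : ℕ) : ∃ C : ℝ≥0, ∀ (μ : Measure X), IsCenteredGaussian μ →
    ∀ (L : X →L[ℝ] ℝ) (V : ℝ), ∫ f, (L f) ^ 2 ∂μ ≤ V →
    ∫⁻ f, ‖L f‖ₑ ^ (2 * q) ∂μ ≤ C * (ENNReal.ofReal V) ^ q := by
  obtain ⟨C, hC⟩ := ut_moment q
  refine ⟨C, fun μ hμ L V hV => ?_⟩
  have h1 := hC (∫ f, (L f) ^ 2 ∂μ).toNNReal
  rw [← ut_map_eq hμ L, lintegral_map (by fun_prop) (by fun_prop)] at h1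
  rw [h1]
  gcongr
  exact ENNReal.ofReal_le_ofReal hV

/-- uniform Fernique -/
lemma ut_fernique [SecondCountableTopology X] [CompleteSpace X] (M K : ℝ) (hM : 0 < M)
    (hK : 0 < K) : ∃ C : ℝ≥0, ∀ (μ : Measure X), IsCenteredGaussian μ →
    ∫⁻ f, ‖f‖ₑ ∂μ ≤ ENNReal.ofReal M →
    ∫⁻ f, ENNReal.ofReal (Real.exp (K * ‖f‖)) ∂μ ≤ C := by
  set c : ENNReal := ENNReal.ofReal (3 / 4) with hc
  have hc1 : (2 : ENNReal)⁻¹ < c := by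
    rw [hc, show (2 : ENNReal)⁻¹ = ENNReal.ofReal (1 / 2) by
      rw [one_div, ENNReal.ofReal_inv_of_pos (by norm_num)]; simp]
    exact (ENNReal.ofReal_lt_ofReal_iff (by norm_num)).2 (by norm_num)
  have hc2 : c < 1 := by
    rw [hc, ← ENNReal.ofReal_one]
    exact (ENNReal.ofReal_lt_ofReal_iff (by norm_num)).2 (by norm_num)
  have hcsub : 1 - c = ENNReal.ofReal (1 / 4) := by
    rw [hc, ← ENNReal.ofReal_one, ← ENNReal.ofReal_sub _ (by norm_num)]; norm_num
  set lam : ℝ := Fernique.logRatio c * (4 * M)⁻¹ ^ 2 with hlam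
  have hlam0 : 0 < lam := mul_pos (Fernique.logRatio_pos hc1 hc2) (by positivity)
  set B : ENNReal := .ofReal (Real.exp (Fernique.logRatio c))
        + ∑' n : ℕ, .ofReal (Real.exp (-2⁻¹ * Real.log (c / (1 - c)).toReal * 2 ^ n)) with hB
  have hBfin : B < ⊤ := by
    refine ENNReal.add_lt_top.mpr ⟨ENNReal.ofReal_lt_top, ?_⟩
    refine Summable.tsum_ofReal_lt_top <|
      Real.summable_exp_nat_mul_of_ge ?_ (fun i ↦ mod_cast (Nat.lt_pow_self (by simp)).le)
    refine mul_neg_of_neg_of_pos (by simp) (Real.log_pos ?_)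
    rw [hcsub, hc, ENNReal.toReal_div, ENNReal.toReal_ofReal (by norm_num),
      ENNReal.toReal_ofReal (by norm_num)]
    norm_num
  refine ⟨(ENNReal.ofReal (Real.exp (K ^ 2 / (4 * lam))) * B).toNNReal, fun μ hμ hm => ?_⟩
  rw [ENNReal.coe_toNNReal (ENNReal.mul_lt_top ENNReal.ofReal_lt_top hBfin).ne]
  have := ut_isGaussian hμ
  have hprob : c ≤ μ {x | ‖x‖ ≤ 4 * M} := by
    have h1 : ENNReal.ofReal (4 * M) * μ {x | ENNReal.ofReal (4 * M) ≤ ‖x‖ₑ}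
        ≤ ∫⁻ f, ‖f‖ₑ ∂μ := mul_meas_ge_le_lintegral (by fun_prop) _
    have h2 : μ {x | ENNReal.ofReal (4 * M) ≤ ‖x‖ₑ} ≤ ENNReal.ofReal (1 / 4) := by
      have h3 := h1.trans hm
      rw [mul_comm] at h3
      have h4 := (ENNReal.le_div_iff_mul_le (Or.inl (by simp; positivity)) (Or.inl ENNReal.ofReal_ne_top)).2 h3
      refine h4.trans ?_
      rw [← ENNReal.ofReal_div_of_pos (by positivity)]
      apply ENNReal.ofReal_le_ofReal
      apply le_of_eq; field_simp
    have h5 : {x : X | ‖x‖ ≤ 4 * M}ᶜ ⊆ {x | ENNReal.ofReal (4 * M) ≤ ‖x‖ₑ} := by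
      intro x hx
      simp only [Set.mem_compl_iff, Set.mem_ofPred_eq, not_le] at hx ⊢
      rw [← ofReal_norm]
      exact ENNReal.ofReal_le_ofReal hx.le
    have h6 : MeasurableSet {x : X | ‖x‖ ≤ 4 * M} := measurableSet_le (by fun_prop) (by fun_prop)
    have h7 := prob_add_prob_compl (μ := μ) h6
    have h8 : (1 : ENNReal) ≤ μ {x | ‖x‖ ≤ 4 * M} + ENNReal.ofReal (1 / 4) := by
      rw [← h7]; gcongr; exact (measure_mono h5).trans h2
    have h9 : (1 : ENNReal) = c + ENNReal.ofReal (1 / 4) := by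
      rw [hc, ← ENNReal.ofReal_add (by norm_num) (by norm_num)]; norm_num
    rw [h9] at h8
    exact (ENNReal.add_le_add_iff_right (by simp)).1 h8
  have hrot := IsGaussian.map_rotation_eq_self_of_forall_strongDual_eq_zero
    (μ := μ) (ut_mean hμ) (-(Real.pi / 4))
  have hmain := lintegral_exp_mul_sq_norm_le_of_map_rotation_eq_self hrot hprob hc1
  calc ∫⁻ f, ENNReal.ofReal (Real.exp (K * ‖f‖)) ∂μ
      ≤ ∫⁻ f, ENNReal.ofReal (Real.exp (K ^ 2 / (4 * lam))) *
          ENNReal.ofReal (Real.exp (Fernique.logRatio c * (4 * M)⁻¹ ^ 2 * ‖f‖ ^ 2)) ∂μ := by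
        apply lintegral_mono
        intro f
        beta_reduce
        rw [← ENNReal.ofReal_mul (by positivity), ← Real.exp_add]
        apply ENNReal.ofReal_le_ofReal
        apply Real.exp_le_exp.2
        rw [← hlam]
        have : K ^ 2 / (4 * lam) + lam * ‖f‖ ^ 2 - K * ‖f‖ = lam * (‖f‖ - K / (2 * lam)) ^ 2 := by
          field_simp; ring
        have h2 : 0 ≤ lam * (‖f‖ - K / (2 * lam)) ^ 2 := by positivity
        linarith
    _ ≤ _ := by
        rw [lintegral_const_mul _ (by fun_prop)]
        gcongr
end UTbasic


lemma ut_net {d : ℕ} (E : Set (EuclideanSpace ℝ (Fin d))) (hEc : IsCompact E) [Nonempty E] :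
    ∃ (S : ℕ → Finset E) (A B D : ℝ), 0 < A ∧ 0 < B ∧ 0 < D ∧
      (∀ m, ((S m).card : ℝ) ≤ B * A ^ m) ∧
      ∀ m (t : E), ∃ u ∈ S m, dist t u ≤ D / 2 ^ m := by
  classical
  obtain ⟨R, hR⟩ := hEc.isBounded.exists_norm_le
  obtain ⟨N, hN⟩ := exists_nat_ge R
  let key : ℕ → E → (Fin d → ℤ) := fun m t j => ⌊(2 : ℝ) ^ m * (t : EuclideanSpace ℝ (Fin d)) j⌋
  let I : ℕ → Finset (Fin d → ℤ) := fun m =>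
    Fintype.piFinset (fun _ : Fin d => Finset.Icc (-((N : ℤ) * 2 ^ m)) ((N : ℤ) * 2 ^ m))
  let ch : ℕ → (Fin d → ℤ) → E := fun m => Function.invFun (key m)
  refine ⟨fun m => (I m).image (ch m), 2 ^ d, (2 * N + 1) ^ d, √d + 1, by positivity, by positivity,
    by positivity, fun m => ?_, fun m t => ?_⟩
  · have h1 : (((I m).image (ch m)).card : ℝ) ≤ ((I m).card : ℝ) := by
      exact_mod_cast Finset.card_image_le
    refine h1.trans ?_
    have h2 : (I m).card = (2 * N * 2 ^ m + 1) ^ d := by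
      simp only [I, Fintype.card_piFinset, Int.card_Icc, Finset.prod_const, Finset.card_univ,
        Fintype.card_fin]
      congr 1
      zify
      rw [Int.toNat_of_nonneg (by have : (0 : ℤ) ≤ N * 2 ^ m := by positivity
                                  linarith)]
      ring
    rw [h2]
    push_cast
    rw [← pow_mul, mul_comm d m, pow_mul, ← mul_pow]
    gcongr
    have : (1 : ℝ) ≤ 2 ^ m := one_le_pow₀ (by norm_num)
    nlinarith
  · have hkey : key m t ∈ I m := by
      simp only [I, Fintype.mem_piFinset, Finset.mem_Icc, key]
      intro j
      have h1 : |(t : EuclideanSpace ℝ (Fin d)) j| ≤ N := by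
        have := PiLp.norm_apply_le (t : EuclideanSpace ℝ (Fin d)) j
        rw [Real.norm_eq_abs] at this
        exact this.trans ((hR _ t.2).trans hN)
      obtain ⟨h2, h3⟩ := abs_le.1 h1
      have h4 : (0 : ℝ) < 2 ^ m := by positivity
      constructor
      · apply Int.le_floor.2
        push_cast
        nlinarith
      · have : (⌊(2 : ℝ) ^ m * (t : EuclideanSpace ℝ (Fin d)) j⌋ : ℝ) ≤ ((N : ℤ) * 2 ^ m : ℤ) := by
          refine (Int.floor_le _).trans ?_
          push_cast
          nlinarith
        exact_mod_cast this
    refine ⟨ch m (key m t), Finset.mem_image_of_mem _ hkey, ?_⟩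
    have hk : key m (ch m (key m t)) = key m t := Function.invFun_eq ⟨t, rfl⟩
    set u := ch m (key m t)
    rw [Subtype.dist_eq, EuclideanSpace.dist_eq]
    have h5 : ∀ j, dist ((t : EuclideanSpace ℝ (Fin d)) j) ((u : EuclideanSpace ℝ (Fin d)) j) ^ 2
        ≤ (1 / 2 ^ m) ^ 2 := by
      intro j
      have h6 : ⌊(2 : ℝ) ^ m * (u : EuclideanSpace ℝ (Fin d)) j⌋ =
        ⌊(2 : ℝ) ^ m * (t : EuclideanSpace ℝ (Fin d)) j⌋ := congrFun hk j
      have h7 := Int.abs_sub_lt_one_of_floor_eq_floor h6.symm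
      rw [← mul_sub, abs_mul, abs_of_pos (by positivity : (0 : ℝ) < 2 ^ m)] at h7
      rw [Real.dist_eq]
      gcongr
      rw [le_div_iff₀ (by positivity)]
      linarith
    calc √(∑ j, dist ((t : EuclideanSpace ℝ (Fin d)) j) ((u : EuclideanSpace ℝ (Fin d)) j) ^ 2)
        ≤ √(∑ j : Fin d, (1 / 2 ^ m : ℝ) ^ 2) := by
          apply Real.sqrt_le_sqrt
          exact Finset.sum_le_sum fun j _ => h5 j
      _ = √d / 2 ^ m := by
          rw [Finset.sum_const, Finset.card_univ, Fintype.card_fin, nsmul_eq_mul,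
            Real.sqrt_mul (by positivity), Real.sqrt_sq (by positivity)]
          ring
      _ ≤ (√d + 1) / 2 ^ m := by gcongr; linarith

section UTchain
variable {T : Type*} [MetricSpace T] [CompactSpace T]

lemma ut_pou (S : Finset T) (r : ℝ) (hr : 0 < r) (hS : ∀ t : T, ∃ u ∈ S, dist t u ≤ r) :
    ∃ ψ : T → C(T, ℝ), (∀ u t, 0 ≤ ψ u t) ∧ (∀ t, ∑ u ∈ S, ψ u t = 1) ∧
      ∀ u t, ψ u t ≠ 0 → dist t u ≤ 2 * r := by
  have hpos : ∀ t, 0 < ∑ u ∈ S, max 0 (2 * r - dist t u) := by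
    intro t
    obtain ⟨u, hu, hd⟩ := hS t
    refine Finset.sum_pos' (fun _ _ => le_max_left _ _) ⟨u, hu, ?_⟩
    exact lt_max_of_lt_right (by linarith)
  refine ⟨fun u => ⟨fun t => max 0 (2 * r - dist t u) / ∑ u ∈ S, max 0 (2 * r - dist t u), ?_⟩,
    ?_, ?_, ?_⟩
  · refine Continuous.div (by fun_prop) (by fun_prop) fun t => (hpos t).ne'
  · intro u t
    exact div_nonneg (le_max_left _ _) (hpos t).le
  · intro t
    simp only [ContinuousMap.coe_mk]
    rw [← Finset.sum_div, div_self (hpos t).ne']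
  · intro u t h
    by_contra hlt
    push Not at hlt
    apply h
    simp only [ContinuousMap.coe_mk]
    rw [max_eq_left (by linarith), zero_div]

/-- interpolation operator -/
noncomputable def utP (S : Finset T) (ψ : T → C(T, ℝ)) (f : C(T, ℝ)) : C(T, ℝ) :=
  ∑ u ∈ S, f u • ψ u

lemma utP_apply (S : Finset T) (ψ : T → C(T, ℝ)) (f : C(T, ℝ)) (t : T) :
    utP S ψ f t = ∑ u ∈ S, f u * ψ u t := by
  simp [utP]

lemma ut_chain_det (S : ℕ → Finset T) (D : ℝ) (hD : 0 < D)
    (hS : ∀ m (t : T), ∃ u ∈ S m, dist t u ≤ D / 2 ^ m)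
    (f : C(T, ℝ)) (M : ℕ → ENNReal)
    (hM : ∀ m, ∀ u ∈ S m, ∀ u' ∈ S (m + 1), dist u u' ≤ 3 * D / 2 ^ m → ‖f u - f u'‖ₑ ≤ M m)
    (m : ℕ) (u : T) (hu : u ∈ S m) (t : T) (htu : dist t u ≤ 2 * (D / 2 ^ m)) :
    ‖f u - f t‖ₑ ≤ ∑' j, M (m + j) := by
  choose π hπ hπd using hS
  have hpow : ∀ k : ℕ, D / 2 ^ (k + 1) = D / 2 ^ k / 2 := fun k => by rw [pow_succ]; field_simp
  have hposk : ∀ k : ℕ, 0 < D / 2 ^ k := fun k => by positivity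
  have step : ∀ k, ‖f u - f (π (m + 1 + k) t)‖ₑ ≤ ∑ j ∈ Finset.range (k + 1), M (m + j) := by
    intro k
    induction k with
    | zero =>
      simp only [add_zero, zero_add, Finset.sum_range_one]
      apply hM m u hu _ (hπ _ _)
      have := dist_triangle u t (π (m + 1) t)
      rw [dist_comm u t] at this
      have h2 := hπd (m + 1) t
      have h3 := hposk m
      rw [hpow] at h2
      rw [mul_div_assoc]
      linarith
    | succ k ih =>
      rw [Finset.sum_range_succ]
      have : f u - f (π (m + 1 + (k + 1)) t) = (f u - f (π (m + 1 + k) t)) +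
        (f (π (m + 1 + k) t) - f (π (m + 1 + (k + 1)) t)) := by ring
      rw [this]
      refine (enorm_add_le _ _).trans (add_le_add ih ?_)
      rw [show m + (k + 1) = m + 1 + k by ring]
      apply hM _ _ (hπ _ _) _ (hπ _ _)
      have h1 := dist_triangle (π (m + 1 + k) t) t (π (m + 1 + k + 1) t)
      rw [dist_comm _ t] at h1
      have h2 := hπd (m + 1 + k) t
      have h3 := hπd (m + 1 + k + 1) t
      rw [hpow] at h3
      have h4 := hposk (m + 1 + k)
      rw [mul_div_assoc]
      linarith!
  have hlim : Tendsto (fun k => π (m + 1 + k) t) atTop (𝓝 t) := by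
    rw [tendsto_iff_dist_tendsto_zero]
    have h0 : Tendsto (fun k : ℕ => D / 2 ^ (m + 1 + k)) atTop (𝓝 0) := by
      have h1 : Tendsto (fun k : ℕ => D * (1 / 2 : ℝ) ^ k) atTop (𝓝 (D * 0)) :=
        (tendsto_pow_atTop_nhds_zero_of_lt_one (by norm_num) (by norm_num)).const_mul D
      rw [mul_zero] at h1
      have h2 := (tendsto_add_atTop_iff_nat (m + 1)).2 h1
      refine h2.congr fun k => ?_
      rw [one_div, inv_pow, add_comm k]; rfl
    refine squeeze_zero (fun _ => dist_nonneg) (fun k => ?_) h0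
    rw [dist_comm]; exact hπd _ _
  have hlim2 : Tendsto (fun k => ‖f u - f (π (m + 1 + k) t)‖ₑ) atTop (𝓝 ‖f u - f t‖ₑ) := by
    have hc : Continuous fun s => ‖f u - f s‖ₑ := by fun_prop
    exact (hc.tendsto t).comp hlim
  exact le_of_tendsto' hlim2 fun k => (step k).trans (ENNReal.sum_le_tsum _)

lemma ut_interp (S : Finset T) (ψ : T → C(T, ℝ)) (r : ℝ) (h0 : ∀ u t, 0 ≤ ψ u t)
    (h1 : ∀ t, ∑ u ∈ S, ψ u t = 1) (h2 : ∀ u t, ψ u t ≠ 0 → dist t u ≤ 2 * r)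
    (f : C(T, ℝ)) (b : ENNReal)
    (hb : ∀ u ∈ S, ∀ t, dist t u ≤ 2 * r → ‖f u - f t‖ₑ ≤ b) :
    ‖utP S ψ f - f‖ₑ ≤ b := by
  rcases eq_or_ne b ⊤ with rfl | hbt
  · exact le_top
  lift b to ℝ≥0 using hbt
  rw [enorm_le_coe]
  have : ‖utP S ψ f - f‖ ≤ b := by
    refine (ContinuousMap.norm_le _ b.2).2 ?_
    intro t
    have h3 : (utP S ψ f - f) t = ∑ u ∈ S, (f u - f t) * ψ u t := by
      simp only [ContinuousMap.sub_apply, utP_apply, sub_mul, Finset.sum_sub_distrib]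
      rw [← Finset.mul_sum, h1, mul_one]
    rw [h3]
    calc ‖∑ u ∈ S, (f u - f t) * ψ u t‖ ≤ ∑ u ∈ S, ‖(f u - f t) * ψ u t‖ := norm_sum_le _ _
      _ ≤ ∑ u ∈ S, b * ψ u t := by
        apply Finset.sum_le_sum
        intro u hu
        by_cases hz : ψ u t = 0
        · simp [hz]
        · rw [norm_mul, Real.norm_of_nonneg (h0 u t)]
          gcongr
          · exact h0 u t
          · have := hb u hu t (h2 u t hz)
            rw [enorm_le_coe] at this
            exact_mod_cast this
      _ = b := by rw [← Finset.mul_sum, h1, mul_one]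
  exact_mod_cast this
end UTchain


lemma ut_enorm_le {X : Type*} [NormedAddCommGroup X] (p f : X) : ‖f‖ₑ ≤ ‖p - f‖ₑ + ‖p‖ₑ := by
  have h3 : f = -(p - f) + p := by abel
  calc ‖f‖ₑ = ‖-(p - f) + p‖ₑ := by rw [← h3]
    _ ≤ ‖-(p - f)‖ₑ + ‖p‖ₑ := enorm_add_le _ _
    _ = _ := by rw [enorm_neg]

lemma ut_enorm_sum_le {X ι : Type*} [NormedAddCommGroup X] (s : Finset ι) (p : ι → X) :
    ‖∑ i ∈ s, p i‖ₑ ≤ ∑ i ∈ s, ‖p i‖ₑ := enorm_sum_le _ _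

section UTchainE
variable {T : Type*} [MetricSpace T] [CompactSpace T] [MeasurableSpace C(T, ℝ)]
  [BorelSpace C(T, ℝ)]

noncomputable def utE (t s : T) : C(T, ℝ) →L[ℝ] ℝ :=
  ContinuousMap.evalCLM ℝ t - ContinuousMap.evalCLM ℝ s

lemma utE_apply (t s : T) (f : C(T, ℝ)) : utE t s f = f t - f s := by
  simp [utE]

lemma ut_young (x : ENNReal) (a : ℝ) (ha : 0 < a) (n : ℕ) :
    x ≤ ENNReal.ofReal a + x ^ (n + 1) * ENNReal.ofReal ((a ^ n)⁻¹) := by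
  rcases le_or_gt x (ENNReal.ofReal a) with h | h
  · exact h.trans le_self_add
  · refine le_add_left ?_
    have h1 : ENNReal.ofReal a ^ n * ENNReal.ofReal ((a ^ n)⁻¹) = 1 := by
      rw [← ENNReal.ofReal_pow ha.le, ← ENNReal.ofReal_mul (by positivity),
        mul_inv_cancel₀ (by positivity), ENNReal.ofReal_one]
    calc x = x * (ENNReal.ofReal a ^ n * ENNReal.ofReal ((a ^ n)⁻¹)) := by rw [h1, mul_one]
      _ ≤ x * (x ^ n * ENNReal.ofReal ((a ^ n)⁻¹)) := by gcongr
      _ = _ := by rw [pow_succ]; ring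

lemma ut_chaining (S : ℕ → Finset T) (A B D : ℝ) (hA : 0 < A) (hB : 0 < B) (hD : 0 < D)
    (hcard : ∀ m, ((S m).card : ℝ) ≤ B * A ^ m)
    (hS : ∀ m (t : T), ∃ u ∈ S m, dist t u ≤ D / 2 ^ m)
    (ψ : ℕ → T → C(T, ℝ)) (h0 : ∀ m u t, 0 ≤ ψ m u t)
    (h1 : ∀ m t, ∑ u ∈ S m, ψ m u t = 1)
    (h2 : ∀ m u t, ψ m u t ≠ 0 → dist t u ≤ 2 * (D / 2 ^ m))
    (U : Set T) (hU : ∀ m, ∀ u ∈ S m, u ∈ U) (G κ : ℝ) (hG : 0 < G) (hκ : 0 < κ) :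
    ∃ ε : ℕ → ENNReal, Tendsto ε atTop (𝓝 0) ∧ ∀ μ : Measure C(T, ℝ), IsCenteredGaussian μ →
      (∀ s ∈ U, ∀ t ∈ U, ∫ f, (f t - f s) ^ 2 ∂μ ≤ G * dist t s ^ κ) →
      ∀ m, ∫⁻ f, ‖utP (S m) (ψ m) f - f‖ₑ ∂μ ≤ ε m := by
  classical
  set θ : ℝ := (2 : ℝ) ^ (-(κ / 4)) with hθ
  have hθ0 : 0 < θ := by positivity
  have hθ1 : θ < 1 := Real.rpow_lt_one_of_one_lt_of_neg (by norm_num) (by linarith)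
  have hθ4 : θ ^ 4 = (2 ^ κ)⁻¹ := by
    rw [hθ, ← Real.rpow_natCast, ← Real.rpow_mul (by norm_num), ← Real.rpow_neg (by norm_num)]
    congr 1; push_cast; ring
  obtain ⟨q, hq⟩ := exists_pow_lt_of_lt_one (show 0 < (A ^ 2)⁻¹ by positivity) hθ1
  set ρ : ℝ := A ^ 2 * θ ^ (2 * q + 3) with hρ
  have hρ0 : 0 < ρ := by positivity
  have hρ1 : ρ < 1 := by
    have : θ ^ (2 * q + 3) ≤ θ ^ q := pow_le_pow_of_le_one hθ0.le hθ1.le (by omega)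
    have h3 : A ^ 2 * θ ^ q < A ^ 2 * (A ^ 2)⁻¹ := by gcongr
    rw [mul_inv_cancel₀ (by positivity)] at h3
    have h4 : ρ ≤ A ^ 2 * θ ^ q := by rw [hρ]; gcongr
    linarith
  obtain ⟨C, hC⟩ := ut_moment_le (X := C(T, ℝ)) (q + 1)
  set K : ℝ := B ^ 2 * A * (C * (G * (3 * D) ^ κ) ^ (q + 1)) with hK
  have hK0 : 0 ≤ K := by positivity
  set b : ℕ → ENNReal := fun j => ENNReal.ofReal (θ ^ j + K * ρ ^ j) with hb
  have hbsum : ∑' j, b j ≠ ⊤ := by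
    refine (Summable.tsum_ofReal_lt_top ?_).ne
    exact (summable_geometric_of_lt_one hθ0.le hθ1).add
      ((summable_geometric_of_lt_one hρ0.le hρ1).mul_left K)
  refine ⟨fun m => ∑' j, b (m + j), ?_, ?_⟩
  · have := ENNReal.tendsto_sum_nat_add b hbsum
    simpa [add_comm] using this
  intro μ hμ hinc m
  have hprob := hμ.1
  let cl : ℕ → T → Finset T := fun j u => (S (j + 1)).filter (fun u' => dist u u' ≤ 3 * D / 2 ^ j)
  let n := 2 * q + 1
  let M : ℕ → C(T, ℝ) → ENNReal := fun j f => ENNReal.ofReal (θ ^ j) +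
    ∑ u ∈ S j, ∑ u' ∈ cl j u, ‖utE u u' f‖ₑ ^ (n + 1) * ENNReal.ofReal (((θ ^ j) ^ n)⁻¹)
  have hMmeas : ∀ j, Measurable (M j) := by
    intro j
    refine Measurable.const_add ?_ _
    refine Finset.measurable_sum _ fun u _ => Finset.measurable_sum _ fun u' _ => ?_
    fun_prop
  have hpt : ∀ f, ‖utP (S m) (ψ m) f - f‖ₑ ≤ ∑' j, M (m + j) f := by
    intro f
    refine ut_interp (S m) (ψ m) _ (h0 m) (h1 m) (h2 m) f _ ?_
    intro u hu t htu
    refine ut_chain_det S D hD hS f (fun j => M j f) ?_ m u hu t htu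
    intro j u hu u' hu' hd
    refine (ut_young ‖f u - f u'‖ₑ (θ ^ j) (by positivity) n).trans ?_
    refine add_le_add le_rfl ?_
    rw [← utE_apply]
    have hmem : u' ∈ cl j u := Finset.mem_filter.2 ⟨hu', hd⟩
    refine le_trans ?_ (Finset.single_le_sum (f := fun u => ∑ u' ∈ cl j u,
      ‖utE u u' f‖ₑ ^ (n + 1) * ENNReal.ofReal (((θ ^ j) ^ n)⁻¹)) (fun _ _ => zero_le) hu)
    exact Finset.single_le_sum (f := fun u' =>
      ‖utE u u' f‖ₑ ^ (n + 1) * ENNReal.ofReal (((θ ^ j) ^ n)⁻¹)) (fun _ _ => zero_le) hmem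
  have hMint : ∀ j, ∫⁻ f, M j f ∂μ ≤ b j := by
    intro j
    have e1 : ∫⁻ f, M j f ∂μ = ENNReal.ofReal (θ ^ j) + ∑ u ∈ S j, ∑ u' ∈ cl j u,
        (∫⁻ f, ‖utE u u' f‖ₑ ^ (n + 1) ∂μ) * ENNReal.ofReal (((θ ^ j) ^ n)⁻¹) := by
      simp only [M]
      rw [lintegral_add_left measurable_const, lintegral_const, measure_univ, mul_one,
        lintegral_finsetSum]
      · congr 1
        refine Finset.sum_congr rfl fun u _ => ?_
        rw [lintegral_finsetSum]
        · refine Finset.sum_congr rfl fun u' _ => ?_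
          rw [lintegral_mul_const _ (by fun_prop)]
        · intro u' _; fun_prop
      · intro u _
        refine Finset.measurable_sum _ fun u' _ => ?_
        fun_prop
    have e2 : ∀ u ∈ S j, ∀ u' ∈ cl j u, (∫⁻ f, ‖utE u u' f‖ₑ ^ (n + 1) ∂μ)
        * ENNReal.ofReal (((θ ^ j) ^ n)⁻¹) ≤
        ENNReal.ofReal (C * (G * (3 * D / 2 ^ j) ^ κ) ^ (q + 1) * ((θ ^ j) ^ n)⁻¹) := by
      intro u hu u' hu'
      obtain ⟨hu'1, hu'2⟩ := Finset.mem_filter.1 hu'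
      have h5 : ∫ f, (utE u u' f) ^ 2 ∂μ ≤ G * (3 * D / 2 ^ j) ^ κ := by
        simp only [utE_apply]
        refine (hinc u' (hU _ _ hu'1) u (hU _ _ hu)).trans ?_
        gcongr
      have h6 := hC μ hμ (utE u u') _ h5
      rw [show 2 * (q + 1) = n + 1 by simp only [n]; ring] at h6
      rw [ENNReal.ofReal_mul (by positivity), ENNReal.ofReal_mul (by positivity),
        ENNReal.ofReal_coe_nnreal, ENNReal.ofReal_pow (by positivity)]
      gcongr
    have e3 : ∫⁻ f, M j f ∂μ ≤ ENNReal.ofReal (θ ^ j) + ((S j).card : ENNReal) *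
        (((S (j + 1)).card : ENNReal) *
        ENNReal.ofReal (C * (G * (3 * D / 2 ^ j) ^ κ) ^ (q + 1) * ((θ ^ j) ^ n)⁻¹)) := by
      rw [e1]
      gcongr
      rw [← nsmul_eq_mul]
      refine Finset.sum_le_card_nsmul _ _ _ fun u hu => ?_
      refine (Finset.sum_le_card_nsmul _ _ _ fun u' hu' => e2 u hu u' hu').trans ?_
      rw [nsmul_eq_mul]
      gcongr
      exact Finset.filter_subset _ _
    refine e3.trans ?_
    rw [← ENNReal.ofReal_natCast, ← ENNReal.ofReal_natCast, ← ENNReal.ofReal_mul (by positivity),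
      ← ENNReal.ofReal_mul (by positivity), ← ENNReal.ofReal_add (by positivity) (by positivity)]
    apply ENNReal.ofReal_le_ofReal
    refine add_le_add le_rfl ?_
    have e4 : (3 * D / 2 ^ j) ^ κ = (3 * D) ^ κ * (θ ^ 4) ^ j := by
      rw [Real.div_rpow (by positivity) (by positivity), hθ4, div_eq_mul_inv, inv_pow]
      congr 2
      rw [← Real.rpow_natCast, ← Real.rpow_natCast, ← Real.rpow_mul (by norm_num),
        ← Real.rpow_mul (by norm_num), mul_comm]
    calc ((S j).card : ℝ) * ((S (j + 1)).card *
          (C * (G * (3 * D / 2 ^ j) ^ κ) ^ (q + 1) * ((θ ^ j) ^ n)⁻¹))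
        ≤ (B * A ^ j) * ((B * A ^ (j + 1)) *
          (C * (G * (3 * D / 2 ^ j) ^ κ) ^ (q + 1) * ((θ ^ j) ^ n)⁻¹)) := by
          gcongr
          · exact hcard j
          · exact hcard (j + 1)
      _ = K * ρ ^ j := by
          rw [e4, hK, hρ]
          have e5 : ((θ ^ 4) ^ j) ^ (q + 1) * ((θ ^ j) ^ n)⁻¹ = (θ ^ (2 * q + 3)) ^ j := by
            rw [mul_inv_eq_iff_eq_mul₀ (by positivity)]
            simp only [n, ← pow_mul, ← pow_add]
            congr 1; ring
          have e6 : (A ^ 2 * θ ^ (2 * q + 3)) ^ j = (A ^ 2) ^ j *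
            (((θ ^ 4) ^ j) ^ (q + 1) * ((θ ^ j) ^ n)⁻¹) := by rw [e5, mul_pow]
          rw [e6, ← mul_assoc G, mul_pow _ ((θ ^ 4) ^ j), pow_succ A j, ← pow_mul A 2 j, mul_comm 2 j,
            pow_mul A j 2]
          ring
  calc ∫⁻ f, ‖utP (S m) (ψ m) f - f‖ₑ ∂μ ≤ ∫⁻ f, ∑' j, M (m + j) f ∂μ := lintegral_mono hpt
    _ = ∑' j, ∫⁻ f, M (m + j) f ∂μ := lintegral_tsum fun j => (hMmeas _).aemeasurable
    _ ≤ _ := ENNReal.tsum_le_tsum fun j => hMint _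

lemma ut_norm_bound (S : ℕ → Finset T) (ψ : ℕ → T → C(T, ℝ)) 
    (U : Set T) (hU : ∀ m, ∀ u ∈ S m, u ∈ U) (t0 : T) (ht0 : t0 ∈ U) (G κ : ℝ)
    (ε : ℕ → ENNReal) (hε : Tendsto ε atTop (𝓝 0)) :
    ∃ M : ℝ, 0 < M ∧ ∀ μ : Measure C(T, ℝ), IsCenteredGaussian μ →
      (∀ s ∈ U, ∀ t ∈ U, ∫ f, (f t - f s) ^ 2 ∂μ ≤ G * dist t s ^ κ) →
      (∀ m, ∫⁻ f, ‖utP (S m) (ψ m) f - f‖ₑ ∂μ ≤ ε m) →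
      (∀ᵐ f ∂μ, f t0 = 0) →
      ∫⁻ f, ‖f‖ₑ ∂μ ≤ ENNReal.ofReal M := by
  obtain ⟨m, hm⟩ := (hε.eventually (gt_mem_nhds (show (0 : ENNReal) < 1 by simp))).exists
  obtain ⟨C, hC⟩ := ut_moment_le (X := C(T, ℝ)) 1
  set B : ENNReal := 1 + ∑ u ∈ S m, (1 + C * ENNReal.ofReal (G * dist u t0 ^ κ)) * ‖ψ m u‖ₑ with hB
  have hBt : B ≠ ⊤ := by
    refine ENNReal.add_ne_top.2 ⟨by simp, ?_⟩
    refine ENNReal.sum_ne_top.2 fun u _ => ?_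
    exact ENNReal.mul_ne_top (ENNReal.add_ne_top.2 ⟨by simp, ENNReal.mul_ne_top (by simp) (by simp)⟩)
      (by simp)
  refine ⟨B.toReal, ENNReal.toReal_pos (by simp [hB]) hBt, fun μ hμ hinc hch h0 => ?_⟩
  have := hμ.1
  rw [ENNReal.ofReal_toReal hBt]
  have hpt : ∀ᵐ f ∂μ, ‖f‖ₑ ≤ ‖utP (S m) (ψ m) f - f‖ₑ +
      ∑ u ∈ S m, (1 + ‖utE u t0 f‖ₑ ^ (2 * 1)) * ‖ψ m u‖ₑ := by
    filter_upwards [h0] with f hf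
    refine (ut_enorm_le (utP (S m) (ψ m) f) f).trans ?_
    · refine add_le_add le_rfl ?_
      · refine (ut_enorm_sum_le (S m) (fun u => f u • ψ m u)).trans ?_
        refine Finset.sum_le_sum fun u _ => ?_
        rw [enorm_smul]
        gcongr
        rw [utE_apply, hf, sub_zero]
        have := ut_young ‖f u‖ₑ 1 one_pos 1
        simpa using this
  refine (lintegral_mono_ae hpt).trans ?_
  rw [lintegral_add_right _ (Finset.measurable_sum _ fun u _ => by fun_prop)]
  refine add_le_add ((hch m).trans hm.le) ?_
  rw [lintegral_finsetSum _ (fun u _ => by fun_prop)]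
  refine Finset.sum_le_sum fun u hu => ?_
  rw [lintegral_mul_const _ (by fun_prop), lintegral_add_left measurable_const, lintegral_const,
    measure_univ, mul_one]
  gcongr
  have h5 : ∫ f, (utE u t0 f) ^ 2 ∂μ ≤ G * dist u t0 ^ κ := by
    simp only [utE_apply]
    exact hinc _ ht0 _ (hU _ _ hu)
  simpa using hC μ hμ (utE u t0) _ h5
end UTchainE


section UTweak
open ProbabilityTheory

lemma ut_fdd {W : Type*} [NormedAddCommGroup W] [InnerProductSpace ℝ W] [FiniteDimensional ℝ W]
    [MeasurableSpace W] [BorelSpace W] (μ : ℕ → Measure W) (hμ : ∀ n, IsCenteredGaussian (μ n))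
    (μ0 : Measure W) (hμ0 : IsCenteredGaussian μ0)
    (hv : ∀ t : W, Tendsto (fun n => ∫ x, (inner ℝ t x) ^ 2 ∂(μ n)) atTop
      (𝓝 (∫ x, (inner ℝ t x) ^ 2 ∂μ0))) (F : BoundedContinuousFunction W ℝ) :
    Tendsto (fun n => ∫ x, F x ∂(μ n)) atTop (𝓝 (∫ x, F x ∂μ0)) := by
  let P : ℕ → ProbabilityMeasure W := fun n => ⟨μ n, (hμ n).1⟩
  let P0 : ProbabilityMeasure W := ⟨μ0, hμ0.1⟩
  have hP : Tendsto P atTop (𝓝 P0) := by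
    rw [ProbabilityMeasure.tendsto_iff_tendsto_charFun]
    intro t
    have key : ∀ ρ : Measure W, IsCenteredGaussian ρ → charFun ρ t =
        Complex.exp (-(((∫ x, (inner ℝ t x) ^ 2 ∂ρ : ℝ) : ℂ) / 2)) := by
      intro ρ hρ
      rw [charFun_eq_charFunDual_toDualMap, charFunDual_eq_charFun_map_one, ut_map_eq hρ,
        charFun_gaussianReal]
      congr 1
      have h0 : 0 ≤ ∫ x, (inner ℝ t x) ^ 2 ∂ρ := integral_nonneg fun _ => sq_nonneg _
      simp [InnerProductSpace.toDualMap_apply_apply, Real.coe_toNNReal _ h0]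
    simp only [P, P0, ProbabilityMeasure.coe_mk]
    rw [key _ hμ0]
    simp only [key _ (hμ _)]
    refine (Complex.continuous_exp.tendsto _).comp ?_
    refine Tendsto.neg (Tendsto.div_const ?_ 2)
    exact (Complex.continuous_ofReal.tendsto _).comp (hv t)
  exact (ProbabilityMeasure.tendsto_iff_forall_integral_tendsto.1 hP) F

lemma ut_cont_sum {X Y ι : Type*} [TopologicalSpace Y] [NormedAddCommGroup X] [NormedSpace ℝ X]
    (s : Finset ι) (a : ι → Y → ℝ) (p : ι → X) (ha : ∀ i, Continuous (a i)) :
    Continuous (fun y => ∑ i ∈ s, a i y • p i) :=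
  continuous_finsetSum _ fun u _ => (ha u).smul continuous_const

noncomputable def utPM {X : Type*} [MeasurableSpace X] (μ : Measure X)
    (h : IsProbabilityMeasure μ) : ProbabilityMeasure X := ⟨μ, h⟩

lemma utPM_coe {X : Type*} [MeasurableSpace X] (μ : Measure X)
    (h : IsProbabilityMeasure μ) : (utPM μ h : Measure X) = μ := rfl

variable {T : Type*} [MetricSpace T] [CompactSpace T] [MeasurableSpace C(T, ℝ)]
  [BorelSpace C(T, ℝ)]

lemma ut_cov (μ : Measure C(T, ℝ)) (hμ : IsCenteredGaussian μ) (t0 u w : T)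
    (h0 : ∀ᵐ f ∂μ, f t0 = 0) :
    ∫ f, f u * f w ∂μ = (∫ f, (f u - f t0) ^ 2 ∂μ + ∫ f, (f w - f t0) ^ 2 ∂μ
      - ∫ f, (f u - f w) ^ 2 ∂μ) / 2 := by
  have i : ∀ s t : T, Integrable (fun f : C(T, ℝ) => (f s - f t) ^ 2) μ := fun s t => by
    simpa only [utE_apply] using ut_int_sq hμ (utE s t)
  have e1 := integral_add (i u t0) (i w t0)
  have e2 := integral_sub ((i u t0).add (i w t0)) (i u w)
  simp only [Pi.add_apply] at e2
  rw [← e1, ← e2, ← integral_div]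
  refine integral_congr_ae ?_
  filter_upwards [h0] with f hf
  simp only [hf]
  ring

lemma ut_weak_P (S : Finset T) (ψ : T → C(T, ℝ)) (U : Set T) (hU : ∀ u ∈ S, u ∈ U)
    (t0 : T) (ht0 : t0 ∈ U)
    (μ : ℕ → Measure C(T, ℝ)) (hμ : ∀ n, IsCenteredGaussian (μ n))
    (μ0 : Measure C(T, ℝ)) (hμ0 : IsCenteredGaussian μ0)
    (hz : ∀ n, ∀ᵐ f ∂(μ n), f t0 = 0) (hz0 : ∀ᵐ f ∂μ0, f t0 = 0)
    (hinc : ∀ s ∈ U, ∀ t ∈ U, Tendsto (fun n => ∫ f, (f t - f s) ^ 2 ∂(μ n)) atTop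
      (𝓝 (∫ f, (f t - f s) ^ 2 ∂μ0)))
    (F : BoundedContinuousFunction C(T, ℝ) ℝ) :
    Tendsto (fun n => ∫ f, F (utP S ψ f) ∂(μ n)) atTop (𝓝 (∫ f, F (utP S ψ f) ∂μ0)) := by
  let π : C(T, ℝ) →L[ℝ] EuclideanSpace ℝ S :=
    (EuclideanSpace.equiv S ℝ).symm.toContinuousLinearMap ∘L
      (ContinuousLinearMap.pi fun u : S => ContinuousMap.evalCLM ℝ (u : T))
  have hπ : ∀ f (u : S), π f u = f u := fun f u => rfl
  let e : EuclideanSpace ℝ S → C(T, ℝ) := fun x => ∑ u : S, x u • ψ u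
  have he : Continuous e := by
    exact ut_cont_sum Finset.univ (fun u (x : EuclideanSpace ℝ S) => x u) (fun u => ψ u)
      (fun u => by fun_prop)
  have hPe : ∀ f, utP S ψ f = e (π f) := fun f => by
    simp only [utP, e, hπ]
    exact (Finset.sum_coe_sort S (fun u => f u • ψ u)).symm
  have key := ut_fdd (fun n => (μ n).map π) (fun n => ut_map (hμ n) π) (μ0.map π)
    (ut_map hμ0 π) ?_ (F.compContinuous ⟨e, he⟩)
  · have h1 : ∀ ρ : Measure C(T, ℝ), ∫ x, (F.compContinuous ⟨e, he⟩) x ∂(ρ.map π) =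
        ∫ f, F (utP S ψ f) ∂ρ := by
      intro ρ
      rw [integral_map (by fun_prop) (by
        exact (F.compContinuous ⟨e, he⟩).continuous.aestronglyMeasurable)]
      simp [hPe]
    simpa only [h1] using key
  · intro t
    have h2 : ∀ ρ : Measure C(T, ℝ), IsCenteredGaussian ρ → (∀ᵐ f ∂ρ, f t0 = 0) →
        ∫ x, (inner ℝ t x) ^ 2 ∂(ρ.map π) = ∑ u : S, ∑ w : S, (t u * t w) *
        ((∫ f, (f u - f t0) ^ 2 ∂ρ + ∫ f, (f w - f t0) ^ 2 ∂ρ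
      - ∫ f, (f u - f w) ^ 2 ∂ρ) / 2) := by
      intro ρ hρ hz
      rw [integral_map (by fun_prop) (by
        exact Continuous.aestronglyMeasurable (by fun_prop))]
      have h3 : ∀ f : C(T, ℝ), (inner ℝ t (π f)) ^ 2 =
          ∑ u : S, ∑ w : S, (t u * t w) * (f u * f w) := by
        intro f
        rw [PiLp.inner_apply, sq, Finset.sum_mul_sum]
        refine Finset.sum_congr rfl fun u _ => Finset.sum_congr rfl fun w _ => ?_
        rw [hπ, hπ]
        simp
        ring
      simp only [h3]
      have hi : ∀ u w : S, Integrable (fun f : C(T, ℝ) => (t u * t w) * (f u * f w)) ρ :=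
        fun u w => (ut_int_mul hρ (ContinuousMap.evalCLM ℝ (u : T))
          (ContinuousMap.evalCLM ℝ (w : T))).const_mul _
      rw [integral_finsetSum _ fun u _ => integrable_finsetSum _ fun w _ => hi u w]
      refine Finset.sum_congr rfl fun u _ => ?_
      rw [integral_finsetSum _ fun w _ => hi u w]
      refine Finset.sum_congr rfl fun w _ => ?_
      rw [integral_const_mul, ut_cov ρ hρ t0 u w hz]
    rw [h2 _ hμ0 hz0]
    simp only [h2 _ (hμ _) (hz _)]
    refine tendsto_finsetSum _ fun u _ => tendsto_finsetSum _ fun w _ => ?_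
    refine Tendsto.const_mul _ (Tendsto.div_const ?_ _)
    exact ((hinc _ ht0 _ (hU _ u.2)).add (hinc _ ht0 _ (hU _ w.2))).sub
      (hinc _ (hU _ w.2) _ (hU _ u.2))

lemma ut_P_cont (S : Finset T) (ψ : T → C(T, ℝ)) : Continuous (utP S ψ) := by
  exact ut_cont_sum S (fun u (f : C(T, ℝ)) => f u) ψ
    (fun u => (ContinuousMap.evalCLM ℝ u).continuous)

lemma ut_weak [SecondCountableTopology C(T, ℝ)] (S : ℕ → Finset T) (ψ : ℕ → T → C(T, ℝ))
    (U : Set T) (hU : ∀ m, ∀ u ∈ S m, u ∈ U)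
    (t0 : T) (ht0 : t0 ∈ U) (ε : ℕ → ENNReal) (hε : Tendsto ε atTop (𝓝 0))
    (μ : ℕ → Measure C(T, ℝ)) (hμ : ∀ n, IsCenteredGaussian (μ n))
    (μ0 : Measure C(T, ℝ)) (hμ0 : IsCenteredGaussian μ0)
    (hch : ∀ n m, ∫⁻ f, ‖utP (S m) (ψ m) f - f‖ₑ ∂(μ n) ≤ ε m)
    (hch0 : ∀ m, ∫⁻ f, ‖utP (S m) (ψ m) f - f‖ₑ ∂μ0 ≤ ε m)
    (hz : ∀ n, ∀ᵐ f ∂(μ n), f t0 = 0) (hz0 : ∀ᵐ f ∂μ0, f t0 = 0)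
    (hinc : ∀ s ∈ U, ∀ t ∈ U, Tendsto (fun n => ∫ f, (f t - f s) ^ 2 ∂(μ n)) atTop
      (𝓝 (∫ f, (f t - f s) ^ 2 ∂μ0))) :
    Tendsto (fun n => utPM (μ n) (hμ n).1) atTop (𝓝 (utPM μ0 hμ0.1)) := by
  rw [tendsto_iff_forall_lipschitz_integral_tendsto]
  rintro F ⟨C, hC⟩ ⟨L, hL⟩
  simp only [utPM_coe]
  have hFc := hL.continuous
  let Fb : BoundedContinuousFunction C(T, ℝ) ℝ := BoundedContinuousFunction.mkOfBound ⟨F, hFc⟩ C hC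
  have hFb : ∀ f, F f = Fb f := fun f => rfl
  have hint : ∀ ρ : Measure C(T, ℝ), IsCenteredGaussian ρ → ∀ m,
      ∫⁻ f, ‖utP (S m) (ψ m) f - f‖ₑ ∂ρ ≤ ε m → ε m ≠ ⊤ →
      |∫ f, F (utP (S m) (ψ m) f) ∂ρ - ∫ f, F f ∂ρ| ≤ L * (ε m).toReal := by
    intro ρ hρ m hm ht
    have := hρ.1
    have i1 : Integrable F ρ := Fb.integrable ρ
    have i2 : Integrable (fun f => F (utP (S m) (ψ m) f)) ρ :=
      (Fb.compContinuous ⟨_, ut_P_cont (S m) (ψ m)⟩).integrable ρ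
    rw [← integral_sub i2 i1]
    have hmeas : AEStronglyMeasurable (fun f => utP (S m) (ψ m) f - f) ρ :=
      ((ut_P_cont (S m) (ψ m)).sub continuous_id).aestronglyMeasurable
    have i3 : Integrable (fun f => utP (S m) (ψ m) f - f) ρ :=
      ⟨hmeas, hm.trans_lt (lt_top_iff_ne_top.2 ht)⟩
    calc |∫ f, F (utP (S m) (ψ m) f) - F f ∂ρ| ≤ ∫ f, |F (utP (S m) (ψ m) f) - F f| ∂ρ :=
          abs_integral_le_integral_abs
      _ ≤ ∫ f, L * ‖utP (S m) (ψ m) f - f‖ ∂ρ := by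
          refine integral_mono (i2.sub i1).abs (i3.norm.const_mul _) fun f => ?_
          have := hL.dist_le_mul (utP (S m) (ψ m) f) f
          rwa [Real.dist_eq, dist_eq_norm] at this
      _ = L * ∫ f, ‖utP (S m) (ψ m) f - f‖ ∂ρ := integral_const_mul _ _
      _ ≤ _ := by
          gcongr
          rw [integral_norm_eq_lintegral_enorm hmeas]
          exact ENNReal.toReal_mono ht hm
  rw [Metric.tendsto_atTop]
  intro δ hδ
  have hεr : Tendsto (fun m => L * (ε m).toReal) atTop (𝓝 0) := by
    have := ((ENNReal.tendsto_toReal (by simp)).comp hε).const_mul (L : ℝ)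
    simpa using this
  obtain ⟨m, hm1, hm2⟩ := ((hεr.eventually (gt_mem_nhds (show 0 < δ / 3 by positivity))).and
    (hε.eventually (gt_mem_nhds (show (0 : ENNReal) < 1 by simp)))).exists
  have hmt : ε m ≠ ⊤ := (hm2.trans (by simp)).ne
  have hw := ut_weak_P (S m) (ψ m) U (hU m) t0 ht0 μ hμ μ0 hμ0 hz hz0 hinc Fb
  obtain ⟨N, hN⟩ := (Metric.tendsto_atTop.1 hw) (δ / 3) (by positivity)
  refine ⟨N, fun n hn => ?_⟩
  have a1 := hN n hn
  have a2 := hint _ (hμ n) m (hch n m) hmt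
  have a3 := hint _ hμ0 m (hch0 m) hmt
  simp only [Real.dist_eq, ← hFb] at a1 ⊢
  rw [abs_le] at a2 a3
  rw [abs_lt] at a1 ⊢
  constructor <;> linarith
end UTweak


section UTdecomp
open ProbabilityTheory
variable {X : Type*} [NormedAddCommGroup X] [NormedSpace ℝ X] [MeasurableSpace X] [BorelSpace X]
  [SecondCountableTopology X] [CompleteSpace X]

noncomputable def utR (ξ : Measure X) (L : X →L[ℝ] ℝ) : X := ∫ f, L f • f ∂ξ

noncomputable def utQ (ξ : Measure X) (L : X →L[ℝ] ℝ) : X →L[ℝ] X :=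
  ContinuousLinearMap.id ℝ X - L.smulRight (utR ξ L)

lemma utQ_apply (ξ : Measure X) (L : X →L[ℝ] ℝ) (f : X) : utQ ξ L f = f - L f • utR ξ L := rfl

lemma utR_apply (ξ : Measure X) (hξ : IsCenteredGaussian ξ) (L L' : X →L[ℝ] ℝ) :
    L' (utR ξ L) = ∫ f, L f * L' f ∂ξ := by
  have := ut_isGaussian hξ
  have hi : Integrable (fun f => L f • f) ξ := by
    have h1 : MemLp (fun f : X => f) 2 ξ := IsGaussian.memLp_two_id
    exact memLp_one_iff_integrable.1 (MemLp.smul h1 (ut_memLp hξ L))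
  rw [utR, ← L'.integral_comp_comm hi]
  simp

lemma ut_indep (ξ : Measure X) (hξ : IsCenteredGaussian ξ) (L : X →L[ℝ] ℝ)
    (h1 : ∫ f, (L f) ^ 2 ∂ξ = 1) : IndepFun L (utQ ξ L) ξ := by
  have hG := ut_isGaussian hξ
  have := hξ.1
  refine HasGaussianLaw.indepFun_of_covariance_strongDual ?_ ?_
  · have h2 := ut_isGaussian (ut_map hξ (L.prod (utQ ξ L)))
    exact ⟨h2⟩
  · intro L1 L2
    have a1 : ∀ f, (L1 ∘ L) f = L1 1 * L f := by
      intro f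
      have := L1.map_smul (L f) 1
      simp only [smul_eq_mul, mul_one] at this
      simp [this, mul_comm]
    have e : ∫ f, L f * L2 (utQ ξ L f) ∂ξ = 0 := by
      have e2 : ∀ f, L f * L2 (utQ ξ L f) = L f * L2 f - (L f) ^ 2 * L2 (utR ξ L) := by
        intro f; rw [utQ_apply, map_sub, map_smul, smul_eq_mul]; ring
      simp only [e2]
      rw [integral_sub (ut_int_mul hξ L L2) ((ut_int_sq hξ L).mul_const _), integral_mul_const, h1,
        utR_apply ξ hξ, one_mul, sub_self]
    have c1 : ∫ f, (L1 ∘ L) f ∂ξ = 0 := ut_mean hξ (L1 ∘L L)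
    have c2 : ∫ f, (L2 ∘ utQ ξ L) f ∂ξ = 0 := ut_mean hξ (L2 ∘L utQ ξ L)
    have := covariance_eq_sub (μ := ξ) (ut_memLp hξ (L1 ∘L L)) (ut_memLp hξ (L2 ∘L utQ ξ L))
    simp only [ContinuousLinearMap.coe_comp] at this
    rw [this, c1, c2]
    simp only [Pi.mul_apply, a1, mul_assoc]
    rw [integral_const_mul]
    simp only [Function.comp]
    rw [e]; simp

lemma ut_disint (ξ : Measure X) (hξ : IsCenteredGaussian ξ) (L : X →L[ℝ] ℝ)
    (h1 : ∫ f, (L f) ^ 2 ∂ξ = 1) (A : Set X) (hA : MeasurableSet A) :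
    ξ A = ∫⁻ x, (ξ.map (utQ ξ L)) {f | x • utR ξ L + f ∈ A} ∂(gaussianReal 0 1) := by
  have := hξ.1
  have h2 := (indepFun_iff_map_prod_eq_prod_map_map (μ := ξ) (f := L) (g := utQ ξ L)
    (by fun_prop) (by fun_prop)).1 (ut_indep ξ hξ L h1)
  have hm : Measurable (fun p : ℝ × X => p.1 • utR ξ L + p.2) := by fun_prop
  have h3 : ξ A = (ξ.map (fun f => (L f, utQ ξ L f))) ((fun p : ℝ × X => p.1 • utR ξ L + p.2) ⁻¹' A) := by
    rw [Measure.map_apply (by fun_prop) (hm hA)]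
    congr 1
    ext f
    simp [utQ_apply]
  have h4 : ξ.map L = gaussianReal 0 1 := by
    rw [ut_map_eq hξ, h1, Real.toNNReal_one]
  have : IsProbabilityMeasure (ξ.map (utQ ξ L)) := Measure.isProbabilityMeasure_map (by fun_prop)
  rw [h3, h2, h4, Measure.prod_apply (hm hA)]
  rfl
end UTdecomp


section UTtail
open ProbabilityTheory
variable {T : Type*} [MetricSpace T] [CompactSpace T] [MeasurableSpace C(T, ℝ)]
  [BorelSpace C(T, ℝ)] [SecondCountableTopology C(T, ℝ)]

lemma ut_gauss_map (g : ℝ) (hg : 0 < g) :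
    (gaussianReal (g ^ 2) (g ^ 2).toNNReal).map (fun w => g - w / g) = gaussianReal 0 1 := by
  have h1 : (fun w => g - w / g) = (fun x => g - x) ∘ (fun w => w / g) := rfl
  rw [h1, ← Measure.map_map (by fun_prop) (by fun_prop), gaussianReal_map_div_const,
    gaussianReal_map_const_sub]
  congr 1
  · field_simp; simp
  · apply NNReal.eq
    rw [NNReal.coe_div, Real.coe_toNNReal _ (sq_nonneg g)]
    exact div_self (by positivity)

lemma ut_gauss_lint (g : ℝ) (hg : 0 < g) (φ : ℝ → ENNReal) (hφ : Measurable φ) :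
    ∫⁻ x, φ x ∂(gaussianReal 0 1) =
      ENNReal.ofReal ((g * √(2 * Real.pi))⁻¹ * Real.exp (-g ^ 2 / 2)) *
      ∫⁻ w, ENNReal.ofReal (Real.exp (w - w ^ 2 / (2 * g ^ 2))) * φ (g - w / g) := by
  have hv : (g ^ 2).toNNReal ≠ 0 := by
    have : 0 < (g ^ 2).toNNReal := Real.toNNReal_pos.2 (by positivity)
    exact this.ne'
  rw [← ut_gauss_map g hg, lintegral_map hφ (by fun_prop), gaussianReal_of_var_ne_zero _ hv,
    lintegral_withDensity_eq_lintegral_mul _ (by fun_prop) (by fun_prop),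
    ← lintegral_const_mul _ (by fun_prop)]
  refine lintegral_congr fun w => ?_
  simp only [Pi.mul_apply]
  rw [← mul_assoc]
  congr 1
  rw [← ENNReal.ofReal_mul (by positivity), gaussianPDF_def, gaussianPDFReal_def]
  beta_reduce
  congr 1
  rw [mul_assoc ((g * √(2 * Real.pi))⁻¹), ← Real.exp_add]
  congr 1
  · congr 1
    rw [mul_comm g, Real.coe_toNNReal _ (sq_nonneg g),
      Real.sqrt_mul (by positivity), Real.sqrt_sq hg.le]
  · congr 1
    rw [Real.coe_toNNReal _ (sq_nonneg g)]
    field_simp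
    ring

lemma ut_tail (ξ : Measure C(T, ℝ)) (hξ : IsCenteredGaussian ξ) (t0 : T)
    (h1 : ∫ f, (f t0) ^ 2 ∂ξ = 1) (g : ℝ) (hg : 0 < g)
    (Γ : C(T, ℝ) → ℝ) (hΓ : Continuous Γ)
    (hF2 : ∀ a : ℝ, 0 < a → ∀ (b : ℝ) (f : C(T, ℝ)),
      Γ (a • f + ContinuousMap.const T b) = a * Γ f + b)
    (d : C(T, ℝ)) (hd : d = ContinuousMap.const T 1 - utR ξ (ContinuousMap.evalCLM ℝ t0)) :
    ξ {f | g < Γ f} = ENNReal.ofReal ((g * √(2 * Real.pi))⁻¹ * Real.exp (-g ^ 2 / 2)) *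
      ∫⁻ w, ENNReal.ofReal (Real.exp (w - w ^ 2 / (2 * g ^ 2))) *
        (ξ.map (g • utQ ξ (ContinuousMap.evalCLM ℝ t0)))
          {f | w < Γ (f - g ^ 2 • d + w • d)} := by
  have := hξ.1
  set L : C(T, ℝ) →L[ℝ] ℝ := ContinuousMap.evalCLM ℝ t0 with hL
  have hA : MeasurableSet {f | g < Γ f} := (isOpen_lt continuous_const hΓ).measurableSet
  rw [ut_disint ξ hξ L (by simpa [hL] using h1) _ hA]
  have : IsProbabilityMeasure (ξ.map (utQ ξ L)) := Measure.isProbabilityMeasure_map (by fun_prop)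
  have hcont : Continuous (fun p : ℝ × C(T, ℝ) => p.1 • utR ξ L + p.2) := by fun_prop
  have hm : MeasurableSet {p : ℝ × C(T, ℝ) | p.1 • utR ξ L + p.2 ∈ {f | g < Γ f}} :=
    hcont.measurable hA
  have hmm : Measurable fun x : ℝ => (ξ.map (utQ ξ L)) {f | x • utR ξ L + f ∈ {f | g < Γ f}} :=
    measurable_measure_prodMk_left hm
  rw [ut_gauss_lint g hg _ hmm]
  congr 1
  refine lintegral_congr fun w => ?_
  congr 1
  have hS : MeasurableSet {f | w < Γ (f - g ^ 2 • d + w • d)} := by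
    refine (isOpen_lt continuous_const (hΓ.comp ?_)).measurableSet
    fun_prop
  rw [show ⇑(g • utQ ξ L) = (fun f => g • f) ∘ (utQ ξ L) from rfl,
    ← Measure.map_map (measurable_const_smul g) (by fun_prop),
    Measure.map_apply (measurable_const_smul g) hS]
  congr 1
  ext f
  simp only [Set.mem_setOf_eq, Set.mem_preimage]
  have e : (g - w / g) • utR ξ L + f = g⁻¹ • (g • f - g ^ 2 • d + w • d) +
      ContinuousMap.const T (g - w / g) := by
    ext t
    simp [hd]
    field_simp
    ring
  rw [e, hF2 _ (by positivity), ← sub_pos, ← sub_pos (b := w)]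
  have : g⁻¹ * Γ (g • f - g ^ 2 • d + w • d) + (g - w / g) - g =
    g⁻¹ * (Γ (g • f - g ^ 2 • d + w • d) - w) := by field_simp; ring
  rw [this]
  exact mul_pos_iff_of_pos_left (by positivity)
end UTtail


section UTlimit
open ProbabilityTheory

lemma ut_shift {X : Type*} [NormedAddCommGroup X] [MeasurableSpace X] [BorelSpace X]
    [SecondCountableTopology X]
    (Y : ℕ → Measure X) (hY : ∀ n, IsProbabilityMeasure (Y n)) (μ : Measure X)
    (hμ : IsProbabilityMeasure μ)
    (hw : Tendsto (fun n => utPM (Y n) (hY n)) atTop (𝓝 (utPM μ hμ)))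
    (c : ℕ → X) (c0 : X) (hc : Tendsto c atTop (𝓝 c0)) (A : Set X) (hA : MeasurableSet A)
    (hfr : μ {f | f + c0 ∈ frontier A} = 0) :
    Tendsto (fun n => Y n {f | f + c n ∈ A}) atTop (𝓝 (μ {f | f + c0 ∈ A})) := by
  have hm : ∀ a : X, Measurable (fun f : X => f + a) := fun a => measurable_add_const a
  have hp : ∀ n, IsProbabilityMeasure ((Y n).map (fun f => f + c n)) := fun n =>
    Measure.isProbabilityMeasure_map (hm _).aemeasurable
  have hp0 : IsProbabilityMeasure (μ.map (fun f => f + c0)) :=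
    Measure.isProbabilityMeasure_map (hm _).aemeasurable
  have key : Tendsto (fun n => utPM _ (hp n)) atTop (𝓝 (utPM _ hp0)) := by
    rw [tendsto_iff_forall_lipschitz_integral_tendsto]
    rintro F ⟨C, hC⟩ ⟨L, hL⟩
    simp only [utPM_coe]
    have hFc := hL.continuous
    let Fb : BoundedContinuousFunction X ℝ := BoundedContinuousFunction.mkOfBound ⟨F, hFc⟩ C hC
    have hi : ∀ (ρ : Measure X) (_ : IsProbabilityMeasure ρ) (a : X),
        Integrable (fun f => F (f + a)) ρ := fun ρ _ a =>
      (Fb.compContinuous ⟨fun f => f + a, by fun_prop⟩).integrable ρ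
    have e1 : ∀ (ρ : Measure X) (a : X), ∫ f, F f ∂(ρ.map (fun f => f + a)) = ∫ f, F (f + a) ∂ρ :=
      fun ρ a => integral_map (hm a).aemeasurable hFc.aestronglyMeasurable
    simp only [e1]
    have h2 := (ProbabilityMeasure.tendsto_iff_forall_integral_tendsto.1 hw)
      (Fb.compContinuous ⟨fun f => f + c0, by fun_prop⟩)
    simp only [utPM_coe] at h2
    have h2' : Tendsto (fun n => ∫ f, F (f + c0) ∂(Y n)) atTop (𝓝 (∫ f, F (f + c0) ∂μ)) := h2
    have h3 : Tendsto (fun n => ∫ f, F (f + c n) ∂(Y n) - ∫ f, F (f + c0) ∂(Y n)) atTop (𝓝 0) := by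
      have h4 : Tendsto (fun n => (L : ℝ) * ‖c n - c0‖) atTop (𝓝 0) := by
        have := (tendsto_iff_norm_sub_tendsto_zero.1 hc).const_mul (L : ℝ)
        simpa using this
      refine squeeze_zero_norm (fun n => ?_) h4
      rw [← integral_sub (hi _ (hY n) _) (hi _ (hY n) _)]
      have := norm_integral_le_of_norm_le_const (μ := Y n)
        (f := fun f => F (f + c n) - F (f + c0)) (C := (L : ℝ) * ‖c n - c0‖) (ae_of_all _ fun f => by
          have := hL.dist_le_mul (f + c n) (f + c0)
          rw [dist_eq_norm, dist_eq_norm] at this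
          simpa using this)
      simpa using this
    simpa using h3.add h2'
  have h5 := ProbabilityMeasure.tendsto_measure_of_null_frontier_of_tendsto' key (E := A) (by
    rw [utPM_coe, Measure.map_apply (hm _) isClosed_frontier.measurableSet]
    exact hfr)
  simp only [utPM_coe] at h5
  rw [Measure.map_apply (hm _) hA] at h5
  simp only [Measure.map_apply (hm _) hA] at h5
  exact h5

lemma ut_exp_lint (z : ℝ) : ∫⁻ w in Set.Iio z, ENNReal.ofReal (Real.exp w) =
    ENNReal.ofReal (Real.exp z) := by
  rw [← ofReal_integral_eq_lintegral_ofReal]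
  · rw [← integral_Iic_eq_integral_Iio, integral_exp_Iic]
  · exact (integrableOn_exp_Iic z).mono_set Set.Iio_subset_Iic_self
  · exact ae_of_all _ fun _ => (Real.exp_pos _).le

lemma ut_layer {X : Type*} [MeasurableSpace X] (μ : Measure X) [SFinite μ] (Z : X → ℝ)
    (hZ : Measurable Z) :
    ∫⁻ w, ENNReal.ofReal (Real.exp w) * μ {f | w < Z f} = ∫⁻ f, ENNReal.ofReal (Real.exp (Z f)) ∂μ := by
  have h1 : ∀ w, ENNReal.ofReal (Real.exp w) * μ {f | w < Z f} =
      ∫⁻ f, (Set.Iio (Z f)).indicator (fun w => ENNReal.ofReal (Real.exp w)) w ∂μ := by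
    intro w
    rw [← lintegral_indicator_const (measurableSet_lt measurable_const hZ)]
    rfl
  simp only [h1]
  rw [lintegral_lintegral_swap]
  · refine lintegral_congr fun f => ?_
    rw [lintegral_indicator measurableSet_Iio, ut_exp_lint]
  · have : Measurable (({p : ℝ × X | p.1 < Z p.2}).indicator
        (fun p => ENNReal.ofReal (Real.exp p.1))) := by
      refine Measurable.indicator (by fun_prop) ?_
      exact measurableSet_lt measurable_fst (hZ.comp measurable_snd)
    exact this.aemeasurable

lemma ut_exp_abs : ∫⁻ w : ℝ, ENNReal.ofReal (Real.exp (-|w|)) ≠ ⊤ := by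
  have h : Integrable (fun w : ℝ => Real.exp (-|w|)) := by
    rw [← integrableOn_univ, ← Set.Iic_union_Ioi (a := (0 : ℝ))]
    refine IntegrableOn.union ?_ ?_
    · refine (integrableOn_exp_Iic 0).congr_fun (fun x hx => ?_) measurableSet_Iic
      rw [abs_of_nonpos hx, neg_neg]
    · refine (integrableOn_exp_neg_Ioi 0).congr_fun (fun x hx => ?_) measurableSet_Ioi
      rw [abs_of_pos hx]
  exact h.lintegral_lt_top.ne

variable {T : Type*} [MetricSpace T] [CompactSpace T] 

lemma ut_Gamma_le [Nonempty T] (Γ : C(T, ℝ) → ℝ) (c : ℝ)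
    (hF1 : ∀ f : C(T, ℝ), Γ f ≤ c * ⨆ t, f t)
    (hF2 : ∀ a : ℝ, 0 < a → ∀ (b : ℝ) (f : C(T, ℝ)),
      Γ (a • f + ContinuousMap.const T b) = a * Γ f + b) (f : C(T, ℝ)) : Γ f ≤ ‖f‖ := by
  have h0 : Γ 0 = 0 := by
    have := hF2 2 (by norm_num) 0 0
    have e : (2 : ℝ) • (0 : C(T, ℝ)) + ContinuousMap.const T 0 = 0 := by ext; simp
    rw [e] at this
    linarith
  have h1 : ∀ b : ℝ, b ≤ c * b := by
    intro b
    have h2 := hF2 1 one_pos b 0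
    have h3 := hF1 ((1 : ℝ) • (0 : C(T, ℝ)) + ContinuousMap.const T b)
    rw [h2, h0] at h3
    simpa using h3
  have hc : c = 1 := by
    have a1 := h1 1
    have a2 := h1 (-1)
    linarith
  refine (hF1 f).trans ?_
  rw [hc, one_mul]
  exact ciSup_le fun t => (le_abs_self _).trans (f.norm_coe_le_norm t)

variable [MeasurableSpace C(T, ℝ)]
  [BorelSpace C(T, ℝ)] [SecondCountableTopology C(T, ℝ)]

lemma ut_limit [Nonempty T] (Y : ℕ → Measure C(T, ℝ)) (hY : ∀ n, IsProbabilityMeasure (Y n))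
    (μ : Measure C(T, ℝ)) (hμ : IsProbabilityMeasure μ)
    (hw : Tendsto (fun n => utPM (Y n) (hY n)) atTop (𝓝 (utPM μ hμ)))
    (C : ℝ≥0) (hC : ∀ n, ∫⁻ f, ENNReal.ofReal (Real.exp (4 * ‖f‖)) ∂(Y n) ≤ C)
    (g : ℕ → ℝ) (hg : Tendsto g atTop atTop) (d : ℕ → C(T, ℝ)) (b : C(T, ℝ))
    (hd : Tendsto (fun n => g n ^ 2 • d n) atTop (𝓝 b))
    (Γ : C(T, ℝ) → ℝ) (hΓ : Continuous Γ) (hΓle : ∀ f, Γ f ≤ ‖f‖) :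
    Tendsto (fun n => ∫⁻ w, ENNReal.ofReal (Real.exp (w - w ^ 2 / (2 * g n ^ 2))) *
        (Y n) {f | w < Γ (f - g n ^ 2 • d n + w • d n)}) atTop
      (𝓝 (∫⁻ f, ENNReal.ofReal (Real.exp (Γ (f - b))) ∂μ)) ∧
    ∫⁻ f, ENNReal.ofReal (Real.exp (Γ (f - b))) ∂μ ≠ ⊤ := by
  have hg2 : Tendsto (fun n => (g n ^ 2)⁻¹) atTop (𝓝 0) :=
    ((tendsto_pow_atTop (by norm_num)).comp hg).inv_tendsto_atTop
  have hgpos : ∀ᶠ n in atTop, 0 < g n := hg.eventually_gt_atTop 0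
  have hd0 : Tendsto d atTop (𝓝 0) := by
    have := hg2.smul hd
    rw [zero_smul] at this
    refine this.congr' ?_
    filter_upwards [hgpos] with n hn
    rw [smul_smul, inv_mul_cancel₀ (by positivity), one_smul]
  set R : ℝ := ‖b‖ + 1
  have hR : ∀ᶠ n in atTop, ‖g n ^ 2 • d n‖ ≤ R := by
    have := hd.norm.eventually (gt_mem_nhds (show ‖b‖ < R by simp [R]))
    filter_upwards [this] with n hn using hn.le
  have hhalf : ∀ᶠ n in atTop, ‖d n‖ ≤ 1 / 2 := by
    have := hd0.norm.eventually (gt_mem_nhds (show ‖(0 : C(T, ℝ))‖ < 1 / 2 by simp))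
    filter_upwards [this] with n hn using hn.le
  set K : ℝ := 1 + C * Real.exp (4 * R)
  have hK1 : 1 ≤ K := by simp only [K]; linarith [show 0 ≤ C * Real.exp (4 * R) by positivity]
  set bound : ℝ → ENNReal := fun w => ENNReal.ofReal (K * Real.exp (-|w|)) with hbound
  have hbt : ∫⁻ w, bound w ≠ ⊤ := by
    simp only [hbound, ENNReal.ofReal_mul (zero_le_one.trans hK1)]
    rw [lintegral_const_mul _ (by fun_prop)]
    exact ENNReal.mul_ne_top (by simp) ut_exp_abs
  have hcontn : ∀ n, Continuous (fun p : ℝ × C(T, ℝ) => Γ (p.2 - g n ^ 2 • d n + p.1 • d n)) := by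
    intro n
    exact hΓ.comp (by fun_prop)
  set F : ℕ → ℝ → ENNReal := fun n w => ENNReal.ofReal (Real.exp (w - w ^ 2 / (2 * g n ^ 2))) *
        (Y n) {f | w < Γ (f - g n ^ 2 • d n + w • d n)} with hF
  have hFm : ∀ n, Measurable (F n) := by
    intro n
    refine Measurable.mul (by fun_prop) ?_
    have hm : MeasurableSet {p : ℝ × C(T, ℝ) | p.1 < Γ (p.2 - g n ^ 2 • d n + p.1 • d n)} :=
      (isOpen_lt continuous_fst (hcontn n)).measurableSet
    have := hY n
    exact measurable_measure_prodMk_left (ν := Y n) hm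
  have hdom : ∀ᶠ n in atTop, ∀ w, F n w ≤ bound w := by
    filter_upwards [hR, hhalf] with n hn1 hn2 w
    have hexp : Real.exp (w - w ^ 2 / (2 * g n ^ 2)) ≤ Real.exp w :=
      Real.exp_le_exp.2 (sub_le_self _ (by positivity))
    rcases le_or_gt w 0 with hw0 | hw0
    · have := hY n
      calc F n w ≤ ENNReal.ofReal (Real.exp w) * 1 :=
            mul_le_mul' (ENNReal.ofReal_le_ofReal hexp) prob_le_one
        _ ≤ bound w := by
            rw [mul_one, hbound]
            apply ENNReal.ofReal_le_ofReal
            rw [abs_of_nonpos hw0, neg_neg]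
            exact le_mul_of_one_le_left (Real.exp_pos _).le hK1
    · have hsub : {f | w < Γ (f - g n ^ 2 • d n + w • d n)} ⊆
          {f | ENNReal.ofReal (Real.exp (2 * w - 4 * R)) ≤
            ENNReal.ofReal (Real.exp (4 * ‖f‖))} := by
        intro f hf
        apply ENNReal.ofReal_le_ofReal
        apply Real.exp_le_exp.2
        have h1 : w < ‖f - g n ^ 2 • d n + w • d n‖ := lt_of_lt_of_le hf (hΓle _)
        have h2 : ‖f - g n ^ 2 • d n + w • d n‖ ≤ ‖f‖ + R + w * (1 / 2) := by
          refine (norm_add_le _ _).trans ?_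
          have h3 : ‖f - g n ^ 2 • d n‖ ≤ ‖f‖ + R := (norm_sub_le _ _).trans (by linarith)
          have h4 : ‖w • d n‖ ≤ w * (1 / 2) := by
            rw [norm_smul, Real.norm_of_nonneg hw0.le]
            gcongr
          linarith
        linarith
      have hmk : (Y n) {f | w < Γ (f - g n ^ 2 • d n + w • d n)} ≤
          ENNReal.ofReal (C * Real.exp (-(2 * w - 4 * R))) := by
        have h5 := (meas_ge_le_lintegral_div (μ := Y n)
          (f := fun f => ENNReal.ofReal (Real.exp (4 * ‖f‖))) (by fun_prop)
          (ε := ENNReal.ofReal (Real.exp (2 * w - 4 * R)))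
          (by simp [Real.exp_pos]) (by simp))
        refine (measure_mono hsub).trans (h5.trans ?_)
        refine (ENNReal.div_le_div_right (hC n) _).trans ?_
        rw [Real.exp_neg, ENNReal.ofReal_mul (by positivity), ENNReal.ofReal_coe_nnreal,
          ENNReal.ofReal_inv_of_pos (Real.exp_pos _), ENNReal.div_eq_inv_mul, mul_comm]
      calc F n w ≤ ENNReal.ofReal (Real.exp w) * ENNReal.ofReal (C * Real.exp (-(2 * w - 4 * R))) :=
            mul_le_mul' (ENNReal.ofReal_le_ofReal hexp) hmk
        _ ≤ bound w := by
            rw [← ENNReal.ofReal_mul (Real.exp_pos _).le, hbound]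
            apply ENNReal.ofReal_le_ofReal
            rw [abs_of_pos hw0]
            have : Real.exp w * (C * Real.exp (-(2 * w - 4 * R))) =
                C * Real.exp (4 * R) * Real.exp (-w) := by
              rw [mul_left_comm, ← Real.exp_add, mul_assoc, ← Real.exp_add]
              congr 2; ring
            rw [this]
            gcongr
            simp [K]
  have hpt : ∀ᵐ w, Tendsto (fun n => F n w) atTop
      (𝓝 (ENNReal.ofReal (Real.exp w) * μ {f | w < Γ (f - b)})) := by
    have hcount : Set.Countable {w : ℝ | 0 < μ {f | Γ (f - b) = w}} :=
      Measure.countable_meas_level_set_pos (hΓ.comp (by fun_prop)).measurable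
    filter_upwards [hcount.ae_notMem volume] with w hw'
    have hw0 : μ {f | Γ (f - b) = w} = 0 := by
      by_contra hne
      exact hw' (pos_iff_ne_zero.2 hne)
    have hex : Tendsto (fun n => ENNReal.ofReal (Real.exp (w - w ^ 2 / (2 * g n ^ 2)))) atTop
        (𝓝 (ENNReal.ofReal (Real.exp w))) := by
      refine ENNReal.tendsto_ofReal ((Real.continuous_exp.tendsto _).comp ?_)
      have : Tendsto (fun n => w - w ^ 2 / 2 * (g n ^ 2)⁻¹) atTop (𝓝 (w - w ^ 2 / 2 * 0)) :=
        (hg2.const_mul _).const_sub _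
      rw [mul_zero, sub_zero] at this
      refine this.congr fun n => ?_
      rw [← div_eq_mul_inv, div_div]
    have hcn : Tendsto (fun n => -(g n ^ 2 • d n) + w • d n) atTop (𝓝 (-b)) := by
      have := hd.neg.add (hd0.const_smul w)
      simpa using this
    have hA : IsOpen {f : C(T, ℝ) | w < Γ f} := isOpen_lt continuous_const hΓ
    have hfr : μ {f | f + -b ∈ frontier {f : C(T, ℝ) | w < Γ f}} = 0 := by
      refine measure_mono_null ?_ hw0
      intro f hf
      have := frontier_lt_subset_eq continuous_const hΓ hf
      simp only [Set.mem_setOf_eq, ← sub_eq_add_neg] at this ⊢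
      exact this.symm
    have hsh := ut_shift Y hY μ hμ hw _ _ hcn _ hA.measurableSet hfr
    have e1 : ∀ n, {f : C(T, ℝ) | w < Γ (f - g n ^ 2 • d n + w • d n)} =
        {f | f + (-(g n ^ 2 • d n) + w • d n) ∈ {f : C(T, ℝ) | w < Γ f}} := by
      intro n
      ext f
      simp only [Set.mem_setOf_eq]
      rw [sub_eq_add_neg, add_assoc]
    simp only [hF, e1]
    have e2 : {f : C(T, ℝ) | w < Γ (f - b)} = {f | f + -b ∈ {f : C(T, ℝ) | w < Γ f}} := by
      ext f; simp only [Set.mem_setOf_eq]; rw [sub_eq_add_neg]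
    rw [e2]
    exact ENNReal.Tendsto.mul hex (Or.inr (measure_ne_top _ _)) hsh (Or.inr (by simp))
  have hmain := tendsto_lintegral_filter_of_dominated_convergence (μ := volume) (l := atTop) bound
    (F := F) (Eventually.of_forall hFm) (hdom.mono fun n hn => ae_of_all _ hn) hbt hpt
  rw [ut_layer μ (fun f => Γ (f - b)) (hΓ.comp (by fun_prop)).measurable] at hmain
  refine ⟨hmain, ?_⟩
  have : ∫⁻ f, ENNReal.ofReal (Real.exp (Γ (f - b))) ∂μ ≤ ∫⁻ w, bound w :=
    le_of_tendsto hmain (hdom.mono fun n hn => lintegral_mono hn)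
  exact ne_top_of_le_ne_top hbt this
end UTlimit


section UTseq
open ProbabilityTheory
variable {T : Type*} [MetricSpace T] [CompactSpace T] [MeasurableSpace C(T, ℝ)]
  [BorelSpace C(T, ℝ)] [SecondCountableTopology C(T, ℝ)]

lemma ut_Y_inc (ξ : Measure C(T, ℝ)) (hξ : IsCenteredGaussian ξ) (t0 : T)
    (h1 : ∫ f, (f t0) ^ 2 ∂ξ = 1) (g : ℝ) (d : C(T, ℝ))
    (hd : d = ContinuousMap.const T 1 - utR ξ (ContinuousMap.evalCLM ℝ t0)) (s t : T) :
    ∫ f, (f t - f s) ^ 2 ∂(ξ.map (g • utQ ξ (ContinuousMap.evalCLM ℝ t0))) =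
      g ^ 2 * ∫ f, (f t - f s) ^ 2 ∂ξ - g ^ 2 * (d t - d s) ^ 2 := by
  set L : C(T, ℝ) →L[ℝ] ℝ := ContinuousMap.evalCLM ℝ t0 with hL
  have h1' : ∫ f, (L f) ^ 2 ∂ξ = 1 := h1
  simp only [← utE_apply]
  rw [integral_map (by fun_prop) (by exact Continuous.aestronglyMeasurable (by fun_prop))]
  have e : ∀ f, (utE t s ((g • utQ ξ L) f)) ^ 2 = g ^ 2 * ((utE t s f) ^ 2
      - 2 * utE t s (utR ξ L) * (L f * utE t s f) + (utE t s (utR ξ L)) ^ 2 * (L f) ^ 2) := by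
    intro f
    rw [ContinuousLinearMap.smul_apply, utQ_apply, map_smul, map_sub, map_smul, smul_eq_mul,
      smul_eq_mul]
    ring
  simp only [e]
  rw [integral_const_mul, integral_add, integral_sub, integral_const_mul, integral_const_mul, h1',
    ← utR_apply ξ hξ]
  · have : utE t s (utR ξ L) = - (utE t s d) := by
      rw [hd]; simp [utE_apply]
    rw [this]; ring
  · exact ut_int_sq hξ _
  · exact (ut_int_mul hξ _ _).const_mul _
  · exact (ut_int_sq hξ _).sub ((ut_int_mul hξ _ _).const_mul _)
  · exact (ut_int_sq hξ _).const_mul _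

lemma ut_d_formula (ξ : Measure C(T, ℝ)) (hξ : IsCenteredGaussian ξ) (t0 : T)
    (h1 : ∫ f, (f t0) ^ 2 ∂ξ = 1) (d : C(T, ℝ))
    (hd : d = ContinuousMap.const T 1 - utR ξ (ContinuousMap.evalCLM ℝ t0)) (t : T) :
    d t = (1 - ∫ f, (f t) ^ 2 ∂ξ + ∫ f, (f t - f t0) ^ 2 ∂ξ) / 2 := by
  set L : C(T, ℝ) →L[ℝ] ℝ := ContinuousMap.evalCLM ℝ t0 with hL
  set L' : C(T, ℝ) →L[ℝ] ℝ := ContinuousMap.evalCLM ℝ t with hL'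
  have h2 : utR ξ L t = ∫ f, L f * L' f ∂ξ := utR_apply ξ hξ L L'
  have h3 : ∫ f, (f t - f t0) ^ 2 ∂ξ = ∫ f, (L' f) ^ 2 ∂ξ - 2 * ∫ f, L f * L' f ∂ξ
      + ∫ f, (L f) ^ 2 ∂ξ := by
    have e : ∀ f : C(T, ℝ), (f t - f t0) ^ 2 = (L' f) ^ 2 - 2 * (L f * L' f) + (L f) ^ 2 := by
      intro f; simp [hL, hL']; ring
    simp only [e]
    rw [integral_add, integral_sub, integral_const_mul]
    · exact ut_int_sq hξ _
    · exact (ut_int_mul hξ _ _).const_mul _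
    · exact (ut_int_sq hξ _).sub ((ut_int_mul hξ _ _).const_mul _)
    · exact ut_int_sq hξ _
  have h4 : ∫ f, (L' f) ^ 2 ∂ξ = ∫ f, (f t) ^ 2 ∂ξ := rfl
  have h5 : ∫ f, (L f) ^ 2 ∂ξ = 1 := h1
  have h6 : d t = 1 - utR ξ L t := by rw [hd]; simp
  rw [h6, h3, h2, h4, h5]
  ring

lemma ut_Y_zero (ξ : Measure C(T, ℝ)) (hξ : IsCenteredGaussian ξ) (t0 : T)
    (h1 : ∫ f, (f t0) ^ 2 ∂ξ = 1) (g : ℝ) :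
    ∀ᵐ f ∂(ξ.map (g • utQ ξ (ContinuousMap.evalCLM ℝ t0))), f t0 = 0 := by
  set L : C(T, ℝ) →L[ℝ] ℝ := ContinuousMap.evalCLM ℝ t0 with hL
  have hm : MeasurableSet {f : C(T, ℝ) | f t0 = 0} :=
    (isClosed_eq L.continuous continuous_const).measurableSet
  rw [ae_map_iff (by fun_prop) hm]
  refine ae_of_all _ fun f => ?_
  have h2 : L (utR ξ L) = 1 := by
    rw [utR_apply ξ hξ, ← h1]
    refine integral_congr_ae (ae_of_all _ fun f => ?_)
    simp [hL, sq]
  show L ((g • utQ ξ L) f) = 0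
  rw [ContinuousLinearMap.smul_apply, utQ_apply, map_smul, map_sub, map_smul, h2]
  simp

lemma ut_D_conv (g : ℕ → ℝ) (hgpos : ∀ n, 0 < g n) (hg : Tendsto g atTop atTop)
    (ξ : ℕ → Measure C(T, ℝ)) (hξ : ∀ n, IsCenteredGaussian (ξ n)) (t0 : T)
    (h1 : ∀ n, ∫ f, (f t0) ^ 2 ∂(ξ n) = 1)
    (h v : C(T, ℝ)) (ε : ℕ → ℝ) (hε : Tendsto ε atTop (𝓝 0))
    (hD1 : ∀ n t, |g n ^ 2 * (1 - √(∫ f, (f t) ^ 2 ∂(ξ n))) - h t| ≤ ε n)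
    (ε' : ℕ → ℝ) (hε' : Tendsto ε' atTop (𝓝 0))
    (hD2' : ∀ n t, |g n ^ 2 * (∫ f, (f t - f t0) ^ 2 ∂(ξ n)) - 2 * v t| ≤ ε' n)
    (d : ℕ → C(T, ℝ))
    (hd : ∀ n, d n = ContinuousMap.const T 1 - utR (ξ n) (ContinuousMap.evalCLM ℝ t0)) :
    Tendsto (fun n => g n ^ 2 • d n) atTop (𝓝 (v + h)) := by
  have hg2 : Tendsto (fun n => (g n ^ 2)⁻¹) atTop (𝓝 0) :=
    ((tendsto_pow_atTop (by norm_num)).comp hg).inv_tendsto_atTop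
  rw [tendsto_iff_norm_sub_tendsto_zero]
  have hb : Tendsto (fun n => ε n + (‖h‖ + ε n) ^ 2 / 2 * (g n ^ 2)⁻¹ + ε' n / 2) atTop (𝓝 0) := by
    have := (hε.add ((((hε.const_add ‖h‖).pow 2).div_const 2).mul hg2)).add (hε'.div_const 2)
    simpa using this
  refine squeeze_zero (fun _ => norm_nonneg _) (fun n => ?_) hb
  have hε0 : 0 ≤ ε n := (abs_nonneg _).trans (hD1 n t0)
  have hε0' : 0 ≤ ε' n := (abs_nonneg _).trans (hD2' n t0)
  refine (ContinuousMap.norm_le _ (by positivity)).2 fun t => ?_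
  have e1 := ut_d_formula (ξ n) (hξ n) t0 (h1 n) (d n) (hd n) t
  have a1 := hD1 n t
  have a2 := hD2' n t
  set V := ∫ f, (f t) ^ 2 ∂(ξ n) with hV
  have hV0 : 0 ≤ V := integral_nonneg fun _ => sq_nonneg _
  have hsq : V = √V ^ 2 := (Real.sq_sqrt hV0).symm
  set J := ∫ f, (f t - f t0) ^ 2 ∂(ξ n)
  set a := g n ^ 2 * (1 - √V) with ha
  have hgn := hgpos n
  have e2 : (g n ^ 2 • d n - (v + h)) t = (a - h t) - a ^ 2 / 2 * (g n ^ 2)⁻¹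
      + (g n ^ 2 * J - 2 * v t) / 2 := by
    have : (g n ^ 2 • d n - (v + h)) t = g n ^ 2 * d n t - (v t + h t) := by simp
    rw [this, e1, hsq, ha]
    field_simp
    ring
  rw [e2, Real.norm_eq_abs]
  have hat : |a| ≤ ‖h‖ + ε n := by
    have : |h t| ≤ ‖h‖ := h.norm_coe_le_norm t
    calc |a| = |h t + (a - h t)| := by ring_nf
      _ ≤ |h t| + |a - h t| := abs_add_le _ _
      _ ≤ _ := by linarith
  have ha2 : a ^ 2 ≤ (‖h‖ + ε n) ^ 2 := by
    rw [← sq_abs a]; gcongr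
  have hq : |a ^ 2 / 2 * (g n ^ 2)⁻¹| ≤ (‖h‖ + ε n) ^ 2 / 2 * (g n ^ 2)⁻¹ := by
    rw [abs_of_nonneg (by positivity)]; gcongr
  have hr : |(g n ^ 2 * J - 2 * v t) / 2| ≤ ε' n / 2 := by
    rw [abs_div, abs_two]; gcongr
  exact (abs_add_le _ _).trans (add_le_add ((abs_sub _ _).trans (add_le_add a1 hq)) hr)

lemma ut_seq (S : ℕ → Finset T) (A B D : ℝ) (hA : 0 < A) (hB : 0 < B) (hD : 0 < D)
    (hcard : ∀ m, ((S m).card : ℝ) ≤ B * A ^ m)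
    (hS : ∀ m (t : T), ∃ u ∈ S m, dist t u ≤ D / 2 ^ m)
    (U : Set T) (hU : ∀ m, ∀ u ∈ S m, u ∈ U) (t0 : T) (ht0 : t0 ∈ U)
    (g : ℕ → ℝ) (hgpos : ∀ n, 0 < g n) (hg : Tendsto g atTop atTop)
    (ξ : ℕ → Measure C(T, ℝ)) (hξ : ∀ n, IsCenteredGaussian (ξ n))
    (h1 : ∀ n, ∫ f, (f t0) ^ 2 ∂(ξ n) = 1)
    (h v : C(T, ℝ)) (ε : ℕ → ℝ) (hε : Tendsto ε atTop (𝓝 0))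
    (hD1 : ∀ n t, |g n ^ 2 * (1 - √(∫ f, (f t) ^ 2 ∂(ξ n))) - h t| ≤ ε n)
    (ε' : ℕ → ℝ) (hε' : Tendsto ε' atTop (𝓝 0))
    (hD2' : ∀ n t, |g n ^ 2 * (∫ f, (f t - f t0) ^ 2 ∂(ξ n)) - 2 * v t| ≤ ε' n)
    (ν : Measure C(T, ℝ)) (hν : IsCenteredGaussian ν) (hν0 : ∀ᵐ f ∂ν, f t0 = 0)
    (hD2 : ∀ s ∈ U, ∀ t ∈ U, Tendsto (fun n => g n ^ 2 * ∫ f, (f t - f s) ^ 2 ∂(ξ n)) atTop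
        (𝓝 (2 * ∫ f, (f t - f s) ^ 2 ∂ν)))
    (G κ : ℝ) (hG : 0 < G) (hκ : 0 < κ)
    (hD3 : ∀ n (s t : T), g n ^ 2 * ∫ f, (f t - f s) ^ 2 ∂(ξ n) ≤ G * dist t s ^ κ)
    (Γ : C(T, ℝ) → ℝ) (hΓ : Continuous Γ) (hΓle : ∀ f, Γ f ≤ ‖f‖)
    (hF2 : ∀ a : ℝ, 0 < a → ∀ (b : ℝ) (f : C(T, ℝ)),
      Γ (a • f + ContinuousMap.const T b) = a * Γ f + b) :
    ∃ I : ℕ → ENNReal, (∀ n, ξ n {f | g n < Γ f} =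
        ENNReal.ofReal ((g n * √(2 * Real.pi))⁻¹ * Real.exp (-g n ^ 2 / 2)) * I n) ∧
      Tendsto I atTop (𝓝 (∫⁻ f, ENNReal.ofReal (Real.exp (Γ (√2 • f - v - h))) ∂ν)) ∧
      ∫⁻ f, ENNReal.ofReal (Real.exp (Γ (√2 • f - v - h))) ∂ν ≠ ⊤ := by
  have : Nonempty T := ⟨t0⟩
  choose ψ p0 p1 p2 using fun m => ut_pou (S m) (D / 2 ^ m) (by positivity) (hS m)
  obtain ⟨η, hη, hchain⟩ := ut_chaining S A B D hA hB hD hcard hS ψ p0 p1 p2 U hU G κ hG hκ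
  obtain ⟨M, hM, hMb⟩ := ut_norm_bound S ψ U hU t0 ht0 G κ η hη
  obtain ⟨C, hC⟩ := ut_fernique (X := C(T, ℝ)) M 4 hM (by norm_num)
  set L : C(T, ℝ) →L[ℝ] ℝ := ContinuousMap.evalCLM ℝ t0 with hL
  let d : ℕ → C(T, ℝ) := fun n => ContinuousMap.const T 1 - utR (ξ n) L
  have hd := ut_D_conv g hgpos hg ξ hξ t0 h1 h v ε hε hD1 ε' hε' hD2' d (fun n => rfl)
  have hg2 : Tendsto (fun n => (g n ^ 2)⁻¹) atTop (𝓝 0) :=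
    ((tendsto_pow_atTop (by norm_num)).comp hg).inv_tendsto_atTop
  let Y : ℕ → Measure C(T, ℝ) := fun n => (ξ n).map (g n • utQ (ξ n) L)
  have hY : ∀ n, IsCenteredGaussian (Y n) := fun n => ut_map (hξ n) _
  have hYinc : ∀ n s t, ∫ f, (f t - f s) ^ 2 ∂(Y n) =
      g n ^ 2 * ∫ f, (f t - f s) ^ 2 ∂(ξ n) - g n ^ 2 * (d n t - d n s) ^ 2 := fun n s t =>
    ut_Y_inc (ξ n) (hξ n) t0 (h1 n) (g n) (d n) rfl s t
  have hYz : ∀ n, ∀ᵐ f ∂(Y n), f t0 = 0 := fun n => ut_Y_zero (ξ n) (hξ n) t0 (h1 n) (g n)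
  have hYD3 : ∀ n, ∀ s ∈ U, ∀ t ∈ U, ∫ f, (f t - f s) ^ 2 ∂(Y n) ≤ G * dist t s ^ κ := by
    intro n s _ t _
    rw [hYinc]
    have := hD3 n s t
    have : 0 ≤ g n ^ 2 * (d n t - d n s) ^ 2 := by positivity
    linarith
  let M2 : C(T, ℝ) →L[ℝ] C(T, ℝ) := √2 • ContinuousLinearMap.id ℝ C(T, ℝ)
  have hM2 : ∀ f, M2 f = √2 • f := fun f => rfl
  let μ0 : Measure C(T, ℝ) := ν.map M2
  have hμ0 : IsCenteredGaussian μ0 := ut_map hν M2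
  have hμ0inc : ∀ s t, ∫ f, (f t - f s) ^ 2 ∂μ0 = 2 * ∫ f, (f t - f s) ^ 2 ∂ν := by
    intro s t
    simp only [← utE_apply]
    rw [integral_map (by fun_prop) (by exact Continuous.aestronglyMeasurable (by fun_prop)),
      ← integral_const_mul]
    refine integral_congr_ae (ae_of_all _ fun f => ?_)
    simp only [hM2, map_smul, smul_eq_mul, mul_pow]
    rw [Real.sq_sqrt (by norm_num)]
  have hμ0z : ∀ᵐ f ∂μ0, f t0 = 0 := by
    have hm : MeasurableSet {f : C(T, ℝ) | f t0 = 0} :=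
      (isClosed_eq L.continuous continuous_const).measurableSet
    rw [ae_map_iff (by fun_prop) hm]
    filter_upwards [hν0] with f hf
    simp [hM2, hf]
  have hpt : ∀ t, Tendsto (fun n => g n ^ 2 * d n t) atTop (𝓝 ((v + h) t)) := by
    intro t
    exact ((ContinuousMap.evalCLM ℝ t : C(T, ℝ) →L[ℝ] ℝ).continuous.tendsto _).comp hd
  have hinc : ∀ s ∈ U, ∀ t ∈ U, Tendsto (fun n => ∫ f, (f t - f s) ^ 2 ∂(Y n)) atTop
      (𝓝 (∫ f, (f t - f s) ^ 2 ∂μ0)) := by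
    intro s hs t ht
    rw [hμ0inc]
    simp only [hYinc]
    have e1 : Tendsto (fun n => (g n ^ 2 * d n t - g n ^ 2 * d n s) ^ 2 * (g n ^ 2)⁻¹) atTop
        (𝓝 0) := by
      have := ((((hpt t).sub (hpt s))).pow 2).mul hg2
      simpa using this
    have e2 := (hD2 s hs t ht).sub e1
    rw [sub_zero] at e2
    refine e2.congr fun n => ?_
    have := hgpos n
    field_simp
  have hμ0D3 : ∀ s ∈ U, ∀ t ∈ U, ∫ f, (f t - f s) ^ 2 ∂μ0 ≤ G * dist t s ^ κ := fun s hs t ht =>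
    le_of_tendsto (hinc s hs t ht) (Eventually.of_forall fun n => hYD3 n s hs t ht)
  have hchY : ∀ n m, ∫⁻ f, ‖utP (S m) (ψ m) f - f‖ₑ ∂(Y n) ≤ η m := fun n =>
    hchain (Y n) (hY n) (hYD3 n)
  have hw := ut_weak S ψ U hU t0 ht0 η hη Y hY μ0 hμ0 hchY (hchain μ0 hμ0 hμ0D3) hYz hμ0z hinc
  have hlim := ut_limit Y (fun n => (hY n).1) μ0 hμ0.1 hw C
    (fun n => hC _ (hY n) (hMb _ (hY n) (hYD3 n) (hchY n) (hYz n))) g hg d (v + h) hd Γ hΓ hΓle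
  have hfin : ∫⁻ f, ENNReal.ofReal (Real.exp (Γ (f - (v + h)))) ∂μ0 =
      ∫⁻ f, ENNReal.ofReal (Real.exp (Γ (√2 • f - v - h))) ∂ν := by
    rw [lintegral_map _ (by fun_prop)]
    · refine lintegral_congr fun f => ?_
      rw [hM2, sub_sub]
    · refine ENNReal.measurable_ofReal.comp (Real.measurable_exp.comp ?_)
      exact (hΓ.comp (by fun_prop)).measurable
  rw [hfin] at hlim
  exact ⟨_, fun n => ut_tail (ξ n) (hξ n) t0 (h1 n) (g n) (hgpos n) Γ hΓ hF2 (d n) rfl,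
    hlim.1, hlim.2⟩
end UTseq


section UTfinal
open ProbabilityTheory

lemma ut_bdd {T : Type*} [MetricSpace T] [CompactSpace T] [MeasurableSpace C(T, ℝ)]
    [BorelSpace C(T, ℝ)] [SecondCountableTopology C(T, ℝ)] (ξ : Measure C(T, ℝ))
    (hξ : IsCenteredGaussian ξ) : ∃ K : ℝ, 0 ≤ K ∧ (∀ t, ∫ f, (f t) ^ 2 ∂ξ ≤ K) ∧
      ∀ s t, ∫ f, (f t - f s) ^ 2 ∂ξ ≤ 4 * K := by
  have := ut_isGaussian hξ
  have hi : Integrable (fun f : C(T, ℝ) => ‖f‖ ^ 2) ξ :=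
    (IsGaussian.memLp_two_id (μ := ξ)).integrable_norm_pow (by norm_num)
  have hb : ∀ (f : C(T, ℝ)) t, |f t| ≤ ‖f‖ := fun f t => f.norm_coe_le_norm t
  refine ⟨∫ f, ‖f‖ ^ 2 ∂ξ, integral_nonneg fun _ => by positivity, fun t => ?_, fun s t => ?_⟩
  · refine integral_mono (ut_int_sq hξ (ContinuousMap.evalCLM ℝ t)) hi fun f => ?_
    simp only
    rw [← sq_abs]
    gcongr
    exact hb f t
  · rw [← integral_const_mul]
    refine integral_mono (by simpa only [utE_apply] using ut_int_sq hξ (utE t s)) (hi.const_mul _)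
      fun f => ?_
    have h1 := abs_le.1 (hb f t)
    have h2 := abs_le.1 (hb f s)
    simp only
    nlinarith

lemma ut_stdGaussTail {T : Type*} [MetricSpace T] [CompactSpace T] [MeasurableSpace C(T, ℝ)]
    [BorelSpace C(T, ℝ)] (ξ : Measure C(T, ℝ))
    (hξ : IsCenteredGaussian ξ) (t0 : T) (h1 : ∫ f, (f t0) ^ 2 ∂ξ = 1) (x : ℝ) :
    stdGaussTail x = (ξ {f | x < f t0}).toReal := by
  set L : C(T, ℝ) →L[ℝ] ℝ := ContinuousMap.evalCLM ℝ t0 with hL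
  have h2 : ∫ f, (L f) ^ 2 ∂ξ = 1 := h1
  have h4 : ξ.map L = gaussianReal 0 1 := by
    rw [ut_map_eq hξ, h2, Real.toNNReal_one]
  have h3 : ξ {f | x < f t0} = (ξ.map L) (Set.Ioi x) := by
    rw [Measure.map_apply (by fun_prop) measurableSet_Ioi]
    rfl
  rw [h3, h4, gaussianReal_apply_eq_integral _ one_ne_zero, ENNReal.toReal_ofReal
    (integral_nonneg fun _ => gaussianPDFReal_nonneg _ _ _), stdGaussTail]
  simp only [gaussianPDFReal_def]
  rw [integral_const_mul]
  simp

lemma ut_ratio {T : Type*} [MetricSpace T] [CompactSpace T] [MeasurableSpace C(T, ℝ)]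
    [BorelSpace C(T, ℝ)] [SecondCountableTopology C(T, ℝ)]
    (S : ℕ → Finset T) (A B D : ℝ) (hA : 0 < A) (hB : 0 < B) (hD : 0 < D)
    (hcard : ∀ m, ((S m).card : ℝ) ≤ B * A ^ m)
    (hS : ∀ m (t : T), ∃ u ∈ S m, dist t u ≤ D / 2 ^ m)
    (U : Set T) (hU : ∀ m, ∀ u ∈ S m, u ∈ U) (t0 : T) (ht0 : t0 ∈ U)
    (g : ℕ → ℝ) (hgpos : ∀ n, 0 < g n) (hg : Tendsto g atTop atTop)
    (ξ : ℕ → Measure C(T, ℝ)) (hξ : ∀ n, IsCenteredGaussian (ξ n))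
    (h1 : ∀ n, ∫ f, (f t0) ^ 2 ∂(ξ n) = 1)
    (h v : C(T, ℝ)) (hh0 : h t0 = 0) (ε : ℕ → ℝ) (hε : Tendsto ε atTop (𝓝 0))
    (hD1 : ∀ n t, |g n ^ 2 * (1 - √(∫ f, (f t) ^ 2 ∂(ξ n))) - h t| ≤ ε n)
    (ε' : ℕ → ℝ) (hε' : Tendsto ε' atTop (𝓝 0))
    (hD2' : ∀ n t, |g n ^ 2 * (∫ f, (f t - f t0) ^ 2 ∂(ξ n)) - 2 * v t| ≤ ε' n)
    (ν : Measure C(T, ℝ)) (hν : IsCenteredGaussian ν) (hν0 : ∀ᵐ f ∂ν, f t0 = 0)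
    (hv : ∀ t, v t = ∫ f, (f t) ^ 2 ∂ν)
    (hD2 : ∀ s ∈ U, ∀ t ∈ U, Tendsto (fun n => g n ^ 2 * ∫ f, (f t - f s) ^ 2 ∂(ξ n)) atTop
        (𝓝 (2 * ∫ f, (f t - f s) ^ 2 ∂ν)))
    (G κ : ℝ) (hG : 0 < G) (hκ : 0 < κ)
    (hD3 : ∀ n (s t : T), g n ^ 2 * ∫ f, (f t - f s) ^ 2 ∂(ξ n) ≤ G * dist t s ^ κ)
    (Γ : C(T, ℝ) → ℝ) (hΓ : Continuous Γ) (hΓle : ∀ f, Γ f ≤ ‖f‖)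
    (hF2 : ∀ a : ℝ, 0 < a → ∀ (b : ℝ) (f : C(T, ℝ)),
      Γ (a • f + ContinuousMap.const T b) = a * Γ f + b) :
    Tendsto (fun n => (ξ n {f | g n < Γ f}).toReal / stdGaussTail (g n)) atTop
      (𝓝 (∫ f, Real.exp (Γ (√2 • f - v - h)) ∂ν)) := by
  have := hν.1
  obtain ⟨I, hI1, hI2, hI3⟩ := ut_seq S A B D hA hB hD hcard hS U hU t0 ht0 g hgpos hg ξ hξ h1
    h v ε hε hD1 ε' hε' hD2' ν hν hν0 hD2 G κ hG hκ hD3 Γ hΓ hΓle hF2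
  obtain ⟨J, hJ1, hJ2, -⟩ := ut_seq S A B D hA hB hD hcard hS U hU t0 ht0 g hgpos hg ξ hξ h1
    h v ε hε hD1 ε' hε' hD2' ν hν hν0 hD2 G κ hG hκ hD3 (fun f => f t0)
    (ContinuousMap.evalCLM ℝ t0 : C(T, ℝ) →L[ℝ] ℝ).continuous
    (fun f => (le_abs_self _).trans (f.norm_coe_le_norm t0)) (fun a _ b f => by simp)
  have hv0 : v t0 = 0 := by
    rw [hv]
    have : (fun f : C(T, ℝ) => (f t0) ^ 2) =ᵐ[ν] fun _ => 0 := by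
      filter_upwards [hν0] with f hf
      simp [hf]
    rw [integral_congr_ae this]; simp
  have hone : ∫⁻ f, ENNReal.ofReal (Real.exp ((√2 • f - v - h) t0)) ∂ν = 1 := by
    have : (fun f : C(T, ℝ) => ENNReal.ofReal (Real.exp ((√2 • f - v - h) t0))) =ᵐ[ν]
        fun _ => 1 := by
      filter_upwards [hν0] with f hf
      simp [hf, hv0, hh0]
    rw [lintegral_congr_ae this]; simp
  rw [hone] at hJ2
  have hH : ∫ f, Real.exp (Γ (√2 • f - v - h)) ∂ν =
      (∫⁻ f, ENNReal.ofReal (Real.exp (Γ (√2 • f - v - h))) ∂ν).toReal := by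
    rw [integral_eq_lintegral_of_nonneg_ae (ae_of_all _ fun _ => (Real.exp_pos _).le)]
    refine Continuous.aestronglyMeasurable (Real.continuous_exp.comp (hΓ.comp ?_))
    fun_prop
  have hlim := ((ENNReal.tendsto_toReal hI3).comp hI2).div
    ((ENNReal.tendsto_toReal ENNReal.one_ne_top).comp hJ2) (by simp)
  rw [hH]
  simp only [ENNReal.toReal_one, div_one] at hlim
  refine hlim.congr fun n => ?_
  rw [ut_stdGaussTail (ξ n) (hξ n) t0 (h1 n), hI1, hJ1]
  have hgn := hgpos n
  simp only [Function.comp, Pi.div_apply, ENNReal.toReal_mul]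
  rw [mul_div_mul_left]
  rw [ENNReal.toReal_ofReal (by positivity)]
  positivity
end UTfinal

/-- **Uniform tail approximation under conditions D1–D3** (Theorem 2.5 of
Dębicki–Hashorva–Liu). For centered Gaussian measures `ξ_i` on `C(E,ℝ)` whose standard
deviation functions `σ_i` satisfy `σ_i(0) = 1` and D1–D3, and a continuous functional
`Γ` satisfying F1–F2, the tail probabilities `ξ_i(Γ > g_i)` are uniformly asymptotic to
`H · Ψ(g_i)`, where `H = ∫ exp(Γ(√2 f − v − h)) dν(f)`. -/
theorem uniform_tail_approximation_D_conditions
    {d : ℕ} {ι : Type*} (l : Filter ι)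
    (E : Set (EuclideanSpace ℝ (Fin d))) (hEc : IsCompact E)
    (hE0 : (0 : EuclideanSpace ℝ (Fin d)) ∈ E)
    [MeasurableSpace C(↥E, ℝ)] [BorelSpace C(↥E, ℝ)] [SecondCountableTopology C(↥E, ℝ)]
    -- the thresholds
    (g : ι → ℝ) (hgpos : ∀ i, 0 < g i)
    -- the centered Gaussian laws `ξ_i`
    (ξ : ι → Measure C(↥E, ℝ)) (hξG : ∀ i, IsCenteredGaussian (ξ i))
    -- the standard deviation functions `σ_i(t) = (∫ f(t)² dξ_i(f))^{1/2}`
    (σ : ι → ↥E → ℝ) (hσ : ∀ i t, σ i t = Real.sqrt (∫ f, (f t) ^ 2 ∂(ξ i)))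
    (hσ0 : ∀ i, σ i ⟨0, hE0⟩ = 1)
    -- the functional `Γ` and conditions F1, F2
    (Γ : C(↥E, ℝ) → ℝ) (hΓcont : Continuous Γ)
    (c : ℝ) (hc : 0 < c)
    (hF1 : ∀ f : C(↥E, ℝ), Γ f ≤ c * ⨆ t, f t)
    (hF2 : ∀ a : ℝ, 0 < a → ∀ (b : ℝ) (f : C(↥E, ℝ)),
      Γ (a • f + ContinuousMap.const ↥E b) = a * Γ f + b)
    -- condition D1
    (hD1g : Tendsto g l atTop)
    (h : C(↥E, ℝ)) (hh0 : h ⟨0, hE0⟩ = 0)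
    (hD1 : Tendsto (fun i => ⨆ t, |(g i) ^ 2 * (1 - σ i t) - h t|) l (𝓝 0))
    -- condition D2: the limiting centered Gaussian law `ν` of the field `η`,
    -- vanishing at the origin
    (ν : Measure C(↥E, ℝ)) (hνG : IsCenteredGaussian ν)
    (hν0 : ∀ᵐ f ∂ν, f ⟨0, hE0⟩ = 0)
    (hD2 : ∀ s t : ↥E,
      Tendsto (fun i => (g i) ^ 2 * ∫ f, (f t - f s) ^ 2 ∂(ξ i)) l
        (𝓝 (2 * ∫ f, (f t - f s) ^ 2 ∂ν)))
    (hD2' : Tendsto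
      (fun i => ⨆ t, |(g i) ^ 2 * (∫ f, (f t - f ⟨0, hE0⟩) ^ 2 ∂(ξ i)) -
        2 * ∫ f, (f t) ^ 2 ∂ν|) l (𝓝 0))
    -- condition D3
    (hD3 : ∃ G > (0 : ℝ), ∃ κ > (0 : ℝ), ∀ᶠ i in l, ∀ s t : ↥E,
      (g i) ^ 2 * ∫ f, (f t - f s) ^ 2 ∂(ξ i) ≤
        G * ‖(t : EuclideanSpace ℝ (Fin d)) - (s : EuclideanSpace ℝ (Fin d))‖ ^ κ)
    -- nondegeneracy of the tail probabilities
    (hndeg : ∀ᶠ i in l, 0 < ξ i {f | g i < Γ f})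
    -- the variance function `v(t) = ∫ f(t)² dν(f)` of `η` (a continuous function)
    (v : C(↥E, ℝ)) (hv : ∀ t, v t = ∫ f, (f t) ^ 2 ∂ν) :
    Tendsto (fun i => (ξ i {f | g i < Γ f}).toReal / stdGaussTail (g i)) l
      (𝓝 (∫ f, Real.exp (Γ (Real.sqrt 2 • f - v - h)) ∂ν)) := by
  classical
  haveI : CompactSpace ↥E := isCompact_iff_compactSpace.1 hEc
  haveI : Nonempty ↥E := ⟨⟨0, hE0⟩⟩
  obtain ⟨S, A, B, D, hA, hB, hD, hcard, hS⟩ := ut_net E hEc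
  obtain ⟨G, hG, κ, hκ, hD3⟩ := hD3
  let t0 : ↥E := ⟨0, hE0⟩
  let U : Set ↥E := {t0} ∪ ⋃ m, (↑(S m) : Set ↥E)
  have hUc : U.Countable :=
    (Set.countable_singleton t0).union (Set.countable_iUnion fun m => (S m).countable_toSet)
  haveI : Countable ↥U := hUc.to_subtype
  have ht0 : t0 ∈ U := Or.inl rfl
  have hU : ∀ m, ∀ u ∈ S m, u ∈ U := fun m u hu =>
    Or.inr (Set.mem_iUnion.2 ⟨m, Finset.mem_coe.2 hu⟩)
  have h1 : ∀ i, ∫ f, (f t0) ^ 2 ∂(ξ i) = 1 := fun i => by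
    have := hσ i t0
    rw [hσ0 i] at this
    exact Real.sqrt_eq_one.1 this.symm
  have hb1 : ∀ i, BddAbove (Set.range fun t => |(g i) ^ 2 * (1 - σ i t) - h t|) := fun i => by
    obtain ⟨K, hK0, hK1, hK2⟩ := ut_bdd (ξ i) (hξG i)
    refine ⟨(g i) ^ 2 * (1 + √K) + ‖h‖, ?_⟩
    rintro _ ⟨t, rfl⟩
    have e1 : 0 ≤ σ i t := by rw [hσ]; positivity
    have e2 : σ i t ≤ √K := by rw [hσ]; exact Real.sqrt_le_sqrt (hK1 t)
    have e3 : |h t| ≤ ‖h‖ := h.norm_coe_le_norm t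
    have e4 : |(g i) ^ 2 * (1 - σ i t)| ≤ (g i) ^ 2 * (1 + √K) := by
      rw [abs_mul, abs_of_nonneg (sq_nonneg (g i))]
      refine mul_le_mul_of_nonneg_left (abs_le.2 ⟨?_, ?_⟩) (sq_nonneg _) <;> linarith
    exact (abs_sub _ _).trans (add_le_add e4 e3)
  have hb2 : ∀ i, BddAbove (Set.range fun t => |(g i) ^ 2 * (∫ f, (f t - f ⟨0, hE0⟩) ^ 2 ∂(ξ i)) -
        2 * ∫ f, (f t) ^ 2 ∂ν|) := fun i => by
    obtain ⟨K, hK0, hK1, hK2⟩ := ut_bdd (ξ i) (hξG i)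
    refine ⟨(g i) ^ 2 * (4 * K) + 2 * ‖v‖, ?_⟩
    rintro _ ⟨t, rfl⟩
    have e3 : |v t| ≤ ‖v‖ := v.norm_coe_le_norm t
    have e1 : 0 ≤ ∫ f, (f t - f ⟨0, hE0⟩) ^ 2 ∂(ξ i) := integral_nonneg fun _ => sq_nonneg _
    have e4 : |(g i) ^ 2 * (∫ f, (f t - f ⟨0, hE0⟩) ^ 2 ∂(ξ i))| ≤ (g i) ^ 2 * (4 * K) := by
      rw [abs_of_nonneg (mul_nonneg (sq_nonneg _) e1)]
      exact mul_le_mul_of_nonneg_left (hK2 _ t) (sq_nonneg _)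
    have e5 : |2 * ∫ f, (f t) ^ 2 ∂ν| ≤ 2 * ‖v‖ := by
      rw [← hv, abs_mul, abs_two]; linarith
    exact (abs_sub _ _).trans (add_le_add e4 e5)
  let P : Set ι := {i | ∀ s t : ↥E, (g i) ^ 2 * ∫ f, (f t - f s) ^ 2 ∂(ξ i) ≤
        G * ‖(t : EuclideanSpace ℝ (Fin d)) - (s : EuclideanSpace ℝ (Fin d))‖ ^ κ}
  let F1 : ι → ℝ := fun i => ⨆ t, |(g i) ^ 2 * (1 - σ i t) - h t|
  let F2 : ι → ℝ := fun i => ⨆ t, |(g i) ^ 2 * (∫ f, (f t - f ⟨0, hE0⟩) ^ 2 ∂(ξ i)) -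
        2 * ∫ f, (f t) ^ 2 ∂ν|
  let F3 : ↥U × ↥U → ι → ℝ := fun p i => (g i) ^ 2 * ∫ f, (f p.2.1 - f p.1.1) ^ 2 ∂(ξ i)
  let l1 : Filter ι := ⨅ p : ↥U × ↥U, comap (F3 p) (𝓝 (2 * ∫ f, (f p.2.1 - f p.1.1) ^ 2 ∂ν))
  let l' : Filter ι := comap g atTop ⊓ (comap F1 (𝓝 0) ⊓ (comap F2 (𝓝 0) ⊓ (l1 ⊓ 𝓟 P)))
  haveI : l1.IsCountablyGenerated := by
    have : ∀ p : ↥U × ↥U, (comap (F3 p)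
      (𝓝 (2 * ∫ f, (f p.2.1 - f p.1.1) ^ 2 ∂ν))).IsCountablyGenerated := fun p => inferInstance
    exact iInf.isCountablyGenerated _
  haveI : l'.IsCountablyGenerated := inferInstance
  have hl : l ≤ l' := by
    refine le_inf hD1g.le_comap (le_inf hD1.le_comap (le_inf hD2'.le_comap (le_inf ?_ ?_)))
    · exact le_iInf fun p => (hD2 p.1.1 p.2.1).le_comap
    · exact le_principal_iff.2 hD3
  refine Tendsto.mono_left ?_ hl
  refine tendsto_of_seq_tendsto fun x hx => ?_
  obtain ⟨x1, hx⟩ := tendsto_inf.1 hx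
  obtain ⟨x2, hx⟩ := tendsto_inf.1 hx
  obtain ⟨x3, hx⟩ := tendsto_inf.1 hx
  obtain ⟨x4, x5⟩ := tendsto_inf.1 hx
  rw [tendsto_comap_iff] at x1 x2 x3
  obtain ⟨N, hN⟩ := eventually_atTop.1 (tendsto_principal.1 x5)
  refine (tendsto_add_atTop_iff_nat N).1 ?_
  have sh := tendsto_add_atTop_nat N
  refine ut_ratio S A B D hA hB hD hcard hS U hU t0 ht0 (fun n => g (x (n + N)))
    (fun n => hgpos _) (x1.comp sh) (fun n => ξ (x (n + N))) (fun n => hξG _) (fun n => h1 _)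
    h v hh0 (fun n => F1 (x (n + N))) (x2.comp sh) (fun n t => ?_)
    (fun n => F2 (x (n + N))) (x3.comp sh) (fun n t => ?_) ν hνG hν0 hv (fun s hs t ht => ?_)
    G κ hG hκ (fun n s t => ?_) Γ hΓcont (ut_Gamma_le Γ c hF1 hF2) hF2
  · rw [← hσ]
    exact le_ciSup (hb1 (x (n + N))) t
  · rw [hv]
    exact le_ciSup (hb2 (x (n + N))) t
  · have := tendsto_iInf.1 x4 (⟨s, hs⟩, ⟨t, ht⟩)
    rw [tendsto_comap_iff] at this
    exact this.comp sh
  · have := hN (n + N) (Nat.le_add_left _ _) s t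
    rwa [← dist_eq_norm] at this
end
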